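/- Let f be a rational map of degree at least 2 with Julia set J. Assume f is non-exceptional, or f is exceptional but Σ ∩ J = ∅. Then there exist a sequence {a_m} of positive integers and a sequence {Λ_m} of f^{a_m}-invariant uniformly expanding topologically transitive subsets of J such that: (i) for every d ∈ ℝ, P(φ_d) = lim_{m→∞} (1/a_m)·P_{f^{a_m}|Λ_m}(S_{a_m}φ_d) = sup_{m≥1} (1/a_m)·P_{f^{a_m}|Λ_m}(S_{a_m}φ_d); (ii) for every α ∈ (α⁻, α⁺), F(α) = lim_{m→∞} F_m(α) = sup_{m≥1} F_m(α); (iii) lim_{m→∞} α_m⁻ = inf_{m≥1} α_m⁻ = α⁻ and lim_{m→∞} α_m⁺ = sup_{m≥1} α_m⁺ = α⁺, where F_m and α_m^± are defined like F and α^± but with (1/a_m)·P_{f^{a_m}|Λ_m}(S_{a_m}·) in place of P(·). -/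

import Mathlib

open Filter Set Metric MeasureTheory Topology
open scoped ENNReal NNReal

noncomputable section

/-! ### The Riemann sphere with the chordal (spherical) metric -/

/-- The Riemann sphere `ℂ ∪ {∞}`. -/
structure RSphere : Type where
  val : Option ℂ

namespace RSphere

/-- The inclusion of `ℂ` into the Riemann sphere. -/
def ofC (z : ℂ) : RSphere := ⟨some z⟩

/-- The point at infinity. -/
def infty : RSphere := ⟨none⟩

/-- Case elimination on a point of the Riemann sphere. -/
def elim {α : Sort*} (x : RSphere) (i : α) (h : ℂ → α) : α := Option.elim x.val i h

/-- Stereographic embedding of the Riemann sphere onto the round unit sphere in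
`ℝ³ = ℂ ×₂ ℝ`.  It induces the chordal (spherical) metric on `RSphere`. -/
def embed (x : RSphere) : WithLp 2 (ℂ × ℝ) :=
  elim x ((WithLp.equiv 2 (ℂ × ℝ)).symm (0, 1))
    fun z => (WithLp.equiv 2 (ℂ × ℝ)).symm
      (((2 / (‖z‖ ^ 2 + 1)) : ℝ) • z, (‖z‖ ^ 2 - 1) / (‖z‖ ^ 2 + 1))

/-- Inverse of the stereographic embedding. -/
def unembed (v : WithLp 2 (ℂ × ℝ)) : RSphere :=
  if (WithLp.equiv 2 (ℂ × ℝ) v).2 = 1 then infty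
  else ofC ((1 - (WithLp.equiv 2 (ℂ × ℝ) v).2)⁻¹ • (WithLp.equiv 2 (ℂ × ℝ) v).1)

lemma leftInverse_unembed : Function.LeftInverse unembed embed := by
  rintro ⟨x⟩
  cases x with
  | none =>
      simp [embed, unembed, elim, infty]
  | some z =>
      have h1 : (0 : ℝ) < ‖z‖ ^ 2 + 1 := by positivity
      have ht : (‖z‖ ^ 2 - 1) / (‖z‖ ^ 2 + 1) ≠ 1 := by
        intro h
        rw [div_eq_one_iff_eq h1.ne'] at h
        linarith
      simp only [embed, unembed, elim, Option.elim, Equiv.apply_symm_apply, ht, if_false, ofC]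
      congr 2
      rw [smul_smul]
      have h2 : 1 - (‖z‖ ^ 2 - 1) / (‖z‖ ^ 2 + 1) = 2 / (‖z‖ ^ 2 + 1) := by
        field_simp
        ring
      rw [h2]
      rw [inv_mul_cancel₀ (by positivity), one_smul]

lemma embed_injective : Function.Injective embed := leftInverse_unembed.injective

/-- The chordal metric on the Riemann sphere, induced by the stereographic embedding
onto the round unit sphere in Euclidean 3-space. -/
instance : MetricSpace RSphere := MetricSpace.induced embed embed_injective inferInstance

instance : MeasurableSpace RSphere := borel RSphere

instance : BorelSpace RSphere := ⟨rfl⟩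

/-- Reading off a finite point (junk value `0` at `∞`). -/
def toC (x : RSphere) : ℂ := elim x 0 id

/-- The involution `z ↦ 1/z` of the Riemann sphere. -/
def inv (x : RSphere) : RSphere :=
  elim x (ofC 0) fun z => if z = 0 then infty else ofC z⁻¹

end RSphere

/-! ### Basic dynamical notions -/

/-- The norm of the derivative of `g` at `x`, measured in the spherical metric
(for a rational map this is the usual norm of the spherical derivative). -/
def sphDeriv (g : RSphere → RSphere) (x : RSphere) : ℝ :=
  limsup (fun y => dist (g y) (g x) / dist y x) (𝓝[≠] x)

/-- The set of critical points. -/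
def critSet (g : RSphere → RSphere) : Set RSphere := {x | sphDeriv g x = 0}

/-- The Fatou set: points having a neighbourhood on which the family of iterates is
equicontinuous (i.e. normal). -/
def fatouSet (f : RSphere → RSphere) : Set RSphere :=
  {x | ∃ U : Set RSphere, IsOpen U ∧ x ∈ U ∧ EquicontinuousOn (fun n : ℕ => f^[n]) U}

/-- The Julia set. -/
def juliaSet (f : RSphere → RSphere) : Set RSphere := (fatouSet f)ᶜ

/-- `f` is the rational map on the Riemann sphere given by the coprime pair of
polynomials `p`, `q`. -/
structure IsRationalMap (f : RSphere → RSphere) (p q : Polynomial ℂ) : Prop where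
  coprime : IsCoprime p q
  continuous : Continuous f
  eval : ∀ z : ℂ, q.eval z ≠ 0 → f (RSphere.ofC z) = RSphere.ofC (p.eval z / q.eval z)

/-- The degree of the rational map `p/q`. -/
def ratDeg (p q : Polynomial ℂ) : ℕ := max p.natDegree q.natDegree

/-- The lower Lyapunov exponent `χ̲(x) = liminf (1/n) log |(fⁿ)'(x)|`, as an extended real. -/
def lyapLower (f : RSphere → RSphere) (x : RSphere) : EReal :=
  liminf (fun n : ℕ => ((Real.log (sphDeriv (f^[n]) x) / n : ℝ) : EReal)) atTop

/-- The upper Lyapunov exponent `χ̄(x) = limsup (1/n) log |(fⁿ)'(x)|`, as an extended real. -/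
def lyapUpper (f : RSphere → RSphere) (x : RSphere) : EReal :=
  limsup (fun n : ℕ => ((Real.log (sphDeriv (f^[n]) x) / n : ℝ) : EReal)) atTop

/-- The level set `𝓛(a,b)` of points of the Julia set with lower exponent `a` and
upper exponent `b`. -/
def levelSet (f : RSphere → RSphere) (a b : EReal) : Set RSphere :=
  {x | x ∈ juliaSet f ∧ lyapLower f x = a ∧ lyapUpper f x = b}

/-- The set `𝓛̂(α,β)` of points of the Julia set with `χ̲ ≤ β`, `χ̄ ≥ α` and `χ̄ > 0`. -/
def levelHat (f : RSphere → RSphere) (α β : ℝ) : Set RSphere :=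
  {x | x ∈ juliaSet f ∧ lyapLower f x ≤ (β : EReal) ∧ (α : EReal) ≤ lyapUpper f x ∧
    0 < lyapUpper f x}

/-- Birkhoff sum `S_m φ = φ + φ∘g + ⋯ + φ∘g^{m-1}`. -/
def birkhoff (g : RSphere → RSphere) (φ : RSphere → ℝ) (m : ℕ) (x : RSphere) : ℝ :=
  ∑ k ∈ Finset.range m, φ (g^[k] x)

/-- An `(m,ε)`-separated finite subset of `Λ` for the map `g`. -/
def IsSepSet (g : RSphere → RSphere) (Λ : Set RSphere) (m : ℕ) (ε : ℝ)
    (E : Finset RSphere) : Prop :=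
  ↑E ⊆ Λ ∧ ∀ x ∈ E, ∀ y ∈ E, x ≠ y → ∃ k < m, ε ≤ dist (g^[k] x) (g^[k] y)

/-- Topological pressure of the potential `φ` for `g` restricted to `Λ`,
defined à la Bowen via `(m,ε)`-separated sets. -/
def pressureOn (g : RSphere → RSphere) (Λ : Set RSphere) (φ : RSphere → ℝ) : ℝ :=
  ⨆ ε : {ε : ℝ // 0 < ε}, limsup (fun m : ℕ =>
    Real.log (⨆ E : {E : Finset RSphere // IsSepSet g Λ m ε.1 E},
      ∑ x ∈ E.1, Real.exp (birkhoff g φ m x)) / m) atTop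

/-- `g` is uniformly expanding on `Λ`: `|(gᵐ)'(x)| ≥ c λᵐ` for some `c > 0`, `λ > 1`. -/
def ExpandingOn (g : RSphere → RSphere) (Λ : Set RSphere) : Prop :=
  ∃ c > (0 : ℝ), ∃ l : ℝ, 1 < l ∧ ∀ x ∈ Λ, ∀ m : ℕ, 1 ≤ m → c * l ^ m ≤ sphDeriv (g^[m]) x

/-- `Λ` is a repeller for `g`: a compact invariant isolated set. -/
def IsRepeller (g : RSphere → RSphere) (Λ : Set RSphere) : Prop :=
  IsCompact Λ ∧ g '' Λ = Λ ∧
    ∃ U : Set RSphere, IsOpen U ∧ Λ ⊆ U ∧ ∀ x, (∀ m : ℕ, g^[m] x ∈ U) → x ∈ Λ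

/-- Topological transitivity of `g` on `Λ`. -/
def TopTransOn (g : RSphere → RSphere) (Λ : Set RSphere) : Prop :=
  ∀ U V : Set RSphere, IsOpen U → IsOpen V → (U ∩ Λ).Nonempty → (V ∩ Λ).Nonempty →
    ∃ m : ℕ, (g^[m] '' (U ∩ Λ) ∩ V).Nonempty

/-- The topological pressure of `φ` with respect to `f` on its Julia set, given by
the supremum of the pressures on compact invariant uniformly expanding subsets of `J`. -/
def pressureTop (f : RSphere → RSphere) (φ : RSphere → ℝ) : ℝ :=
  ⨆ L : {L : Set RSphere //
      L.Nonempty ∧ L ⊆ juliaSet f ∧ IsCompact L ∧ f '' L = L ∧ ExpandingOn f L},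
    pressureOn f L.1 φ

/-- The pressure function `d ↦ P(φ_d)` where `φ_d = -d log|f'|`. -/
def pressFamily (f : RSphere → RSphere) (d : ℝ) : ℝ :=
  pressureTop f fun x => -d * Real.log (sphDeriv f x)

/-- `F(α) = α⁻¹ inf_d (Q(d) + dα)` associated with a pressure function `Q` (for `α ≠ 0`). -/
def specF (Q : ℝ → ℝ) (α : ℝ) : EReal :=
  ((α⁻¹ : ℝ) : EReal) * ⨅ d : ℝ, ((Q d + d * α : ℝ) : EReal)

/-- `F(0) = lim_{α → 0⁺} F(α)`. -/
def specF0 (Q : ℝ → ℝ) : EReal := limsup (fun α : ℝ => specF Q α) (𝓝[>] (0 : ℝ))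

/-- The full spectrum function `F` associated with a pressure function `Q`. -/
def specFext (Q : ℝ → ℝ) (α : ℝ) : EReal := if α = 0 then specF0 Q else specF Q α

/-- The Lyapunov spectrum function `F` of `f`. -/
def Ffun (f : RSphere → RSphere) (α : ℝ) : EReal := specFext (pressFamily f) α

/-- `α⁻ = lim_{d → +∞} -Q(d)/d` for a pressure function `Q`. -/
def alphaMinusOf (Q : ℝ → ℝ) : ℝ := limsup (fun d : ℝ => -Q d / d) atTop

/-- `α⁺ = lim_{d → -∞} -Q(d)/d` for a pressure function `Q`. -/
def alphaPlusOf (Q : ℝ → ℝ) : ℝ := limsup (fun d : ℝ => -Q d / d) atBot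

/-- `α⁻` for the map `f`. -/
def alphaMinus (f : RSphere → RSphere) : ℝ := alphaMinusOf (pressFamily f)

/-- `α⁺` for the map `f`. -/
def alphaPlus (f : RSphere → RSphere) : ℝ := alphaPlusOf (pressFamily f)

/-- The Lyapunov exponent `χ(μ) = ∫ log|g'| dμ` of a measure. -/
def lyapMeas (g : RSphere → RSphere) (μ : Measure RSphere) : ℝ :=
  ∫ x, Real.log (sphDeriv g x) ∂μ

/-- `α⁻` as the infimum of Lyapunov exponents of invariant probability measures on `J`. -/
def alphaMinusMeas (f : RSphere → RSphere) : ℝ :=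
  sInf {r : ℝ | ∃ μ : Measure RSphere, IsProbabilityMeasure μ ∧ MeasurePreserving f μ μ ∧
    μ (juliaSet f)ᶜ = 0 ∧ r = lyapMeas f μ}

/-- `α⁺` as the supremum of Lyapunov exponents of invariant probability measures on `J`. -/
def alphaPlusMeas (f : RSphere → RSphere) : ℝ :=
  sSup {r : ℝ | ∃ μ : Measure RSphere, IsProbabilityMeasure μ ∧ MeasurePreserving f μ μ ∧
    μ (juliaSet f)ᶜ = 0 ∧ r = lyapMeas f μ}

/-- The maximal distortion `sup_{x,y ∈ Z} |g'(x)|/|g'(y)|` of `g` on `Z`. -/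
def distortionOn (g : RSphere → RSphere) (Z : Set RSphere) : ℝ :=
  sSup {r : ℝ | ∃ x ∈ Z, ∃ y ∈ Z, r = sphDeriv g x / sphDeriv g y}

/-- Conical points. -/
def IsConical (f : RSphere → RSphere) (x : RSphere) : Prop :=
  ∃ r : ℝ, 0 < r ∧ ∃ K : ℝ, ∃ n : ℕ → ℕ, StrictMono n ∧ ∃ U : ℕ → Set RSphere,
    ∀ i, U i ∈ 𝓝 x ∧ ball (f^[n i] x) r ⊆ f^[n i] '' U i ∧ distortionOn (f^[n i]) (U i) ≤ K

/-- A non-immediately postcritical point: there is a backward orbit through it that is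
dense in the Julia set and avoids the critical points. -/
def NonImmPostCrit (f : RSphere → RSphere) (x : RSphere) : Prop :=
  ∃ b : ℕ → RSphere, b 0 = x ∧ (∀ n, f (b (n + 1)) = b n) ∧
    juliaSet f ⊆ closure (Set.range b) ∧ ∀ n, b n ∉ critSet f

/-- `f` is exceptional: there is a finite nonempty set `Σ_f` with `f⁻¹(Σ_f) \ Crit = Σ_f`. -/
def IsExceptional (f : RSphere → RSphere) : Prop :=
  ∃ S : Set RSphere, S.Finite ∧ S.Nonempty ∧ f ⁻¹' S \ critSet f = S

/-- The largest exceptional set `Σ` of `f`. -/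
def maxExceptional (f : RSphere → RSphere) : Set RSphere :=
  ⋃₀ {S : Set RSphere | S.Finite ∧ S.Nonempty ∧ f ⁻¹' S \ critSet f = S}

/-- `0` not being exceptional, or having exceptional set away from the Julia set. -/
def GoodExc (f : RSphere → RSphere) : Prop :=
  ¬ IsExceptional f ∨ maxExceptional f ∩ juliaSet f = ∅

/-- A parabolic periodic point at a finite point `z`: a periodic point whose multiplier
is a root of unity. -/
def IsParabolicFix (g : RSphere → RSphere) (z : ℂ) : Prop :=
  ∃ m : ℕ, 0 < m ∧ g^[m] (RSphere.ofC z) = RSphere.ofC z ∧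
    ∃ lam : ℂ, (∃ k : ℕ, 0 < k ∧ lam ^ k = 1) ∧
      HasDerivAt (fun w => RSphere.toC (g^[m] (RSphere.ofC w))) lam z

/-- A parabolic periodic point of `f` (at a finite point, or at `∞` read in the chart `1/z`). -/
def IsParabolic (f : RSphere → RSphere) (x : RSphere) : Prop :=
  (∃ z : ℂ, x = RSphere.ofC z ∧ IsParabolicFix f z) ∨
  (x = RSphere.infty ∧ IsParabolicFix (fun y => RSphere.inv (f (RSphere.inv y))) 0)

/-- A recurrent point. -/
def IsRecurrentPt (f : RSphere → RSphere) (x : RSphere) : Prop :=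
  ∃ n : ℕ → ℕ, StrictMono n ∧ Tendsto (fun i => f^[n i] x) atTop (𝓝 x)

/-! ### Graph directed systems and expanding Cantor repellers -/

/-- A graph directed system (GDS) satisfying the strong separation condition with
respect to the map `g`. -/
structure GDS (g : RSphere → RSphere) where
  /-- number of vertices -/
  n : ℕ
  npos : 0 < n
  /-- the open domains -/
  U : Fin n → Set RSphere
  /-- the admissible edges -/
  edge : Fin n → Fin n → Prop
  /-- the inverse branches -/
  br : Fin n → Fin n → RSphere → RSphere
  isOpen : ∀ k, IsOpen (U k)
  isConnected : ∀ k, IsConnected (U k)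
  disjClosure : ∀ k l, k ≠ l → closure (U k) ∩ closure (U l) = ∅
  mapsTo : ∀ k l, edge k l → Set.MapsTo (br k l) (closure (U l)) (U k)
  isBranch : ∀ k l, edge k l → ∀ x ∈ closure (U l), g (br k l x) = x
  bddDistortion : ∃ C : ℝ, ∀ k l, edge k l → distortionOn (br k l) (closure (U l)) ≤ C

/-- The cylinder sets of depth `m` of a GDS. -/
def gdsCyl {g : RSphere → RSphere} (G : GDS g) : ℕ → Set RSphere
  | 0 => ⋃ k, G.U k
  | m + 1 => ⋃ (k : Fin G.n) (l : Fin G.n) (_ : G.edge k l),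
      G.br k l '' (gdsCyl G m ∩ G.U l)

/-- The limit set of a GDS. -/
def gdsLimit {g : RSphere → RSphere} (G : GDS g) : Set RSphere := ⋂ m, gdsCyl G m

/-- An expanding Cantor repeller (ECR) for `g`: a uniformly expanding repeller which is
the limit set of a GDS satisfying the strong separation condition, with `g(Λ) = Λ`. -/
def IsECR (g : RSphere → RSphere) (Λ : Set RSphere) : Prop :=
  ExpandingOn g Λ ∧ IsRepeller g Λ ∧ ∃ G : GDS g, gdsLimit G = Λ

/-- A Cantor set: compact, perfect and totally disconnected. -/
def IsCantorSet (s : Set RSphere) : Prop :=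
  IsCompact s ∧ Perfect s ∧ IsTotallyDisconnected s

/-! ### Entropy, equilibrium states and dimensions -/

/-- The entropy of a countable partition (given by the fibers of `p`). -/
def partEntropy {ι : Type} [Countable ι] (μ : Measure RSphere) (p : RSphere → ι) : ℝ :=
  ∑' i : ι, Real.negMulLog (μ (p ⁻¹' {i})).toReal

/-- Measure-theoretic (Kolmogorov–Sinai) entropy of `T` with respect to `μ`:
supremum over finite measurable partitions of the exponential growth rate of the
entropies of the dynamical refinements. -/
def entropyOf (T : RSphere → RSphere) (μ : Measure RSphere) : ℝ :=
  ⨆ p : {p : RSphere → ℕ // Measurable p ∧ (Set.range p).Finite},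
    ⨅ n : {n : ℕ // 0 < n},
      partEntropy μ (fun x => fun k : Fin n.1 => p.1 (T^[(k : ℕ)] x)) / (n.1 : ℝ)

/-- An equilibrium state for the potential `φ` with respect to `g` restricted to `Λ`. -/
def IsEquilibrium (g : RSphere → RSphere) (Λ : Set RSphere) (φ : RSphere → ℝ)
    (μ : Measure RSphere) : Prop :=
  IsProbabilityMeasure μ ∧ μ Λᶜ = 0 ∧ MeasurePreserving g μ μ ∧
    entropyOf g μ + ∫ x, φ x ∂μ = pressureOn g Λ φ

/-- The Hausdorff dimension of a measure: the infimum of the Hausdorff dimensions of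
sets of full measure. -/
def dimHMeasure (μ : Measure RSphere) : ℝ≥0∞ :=
  ⨅ (s : Set RSphere) (_ : μ sᶜ = 0), dimH s

/-- The minimal number of `ε`-balls needed to cover `s`. -/
def coverNum (s : Set RSphere) (ε : ℝ) : ℕ :=
  sInf {n : ℕ | ∃ t : Finset RSphere, t.card = n ∧ s ⊆ ⋃ x ∈ t, ball x ε}

/-- The upper box-counting dimension. -/
def upperBoxDim (s : Set RSphere) : ℝ :=
  limsup (fun n : ℕ => Real.log (coverNum s (1 / n)) / Real.log n) atTop

/-- The packing dimension, via countable covers and upper box dimensions. -/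
def dimP (s : Set RSphere) : ℝ≥0∞ :=
  ⨅ c : {c : ℕ → Set RSphere // s ⊆ ⋃ n, c n},
    ⨆ n : ℕ, ENNReal.ofReal (upperBoxDim (c.1 n))

/-- The connected component of `y` in `g⁻¹(B)`: the pull-back of `B` along the inverse
branch of `g` sending (the image of) `y` to `y`. -/
def invBranchSet (g : RSphere → RSphere) (B : Set RSphere) (y : RSphere) : Set RSphere :=
  connectedComponentIn (g ⁻¹' B) y

end

/-- The normalized pressure function `d ↦ (1/a_m) P_{f^{a_m}|Λ_m}(S_{a_m} φ_d)` of the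
subsystem `(f^{a_m}, Λ_m)`. -/
noncomputable def seqPress (f : RSphere → RSphere) (a : ℕ → ℕ) (Λ : ℕ → Set RSphere)
    (m : ℕ) (d : ℝ) : ℝ :=
  pressureOn (f^[a m]) (Λ m)
    (birkhoff f (fun x => -d * Real.log (sphDeriv f x)) (a m)) / a m

/-! ### Bloch's and Landau's theorems -/

/-- A nonvanishing holomorphic function on a disc has a holomorphic logarithm. -/
lemma exists_log_on_ball {g : ℂ → ℂ} {c : ℂ} {R : ℝ} (hR : 0 < R)
    (hg : DifferentiableOn ℂ g (ball c R)) (h0 : ∀ z ∈ ball c R, g z ≠ 0) :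
    ∃ L : ℂ → ℂ, DifferentiableOn ℂ L (ball c R) ∧ (∀ z ∈ ball c R, Complex.exp (L z) = g z) ∧
      L c = Complex.log (g c) := by
  have hc : c ∈ ball c R := mem_ball_self hR
  have hd : DifferentiableOn ℂ (fun z => deriv g z / g z) (ball c R) :=
    (hg.deriv isOpen_ball).div hg h0
  obtain ⟨L, hLc, hL⟩ := (hd.isExactOn_ball).with_val_at c (Complex.log (g c))
  have hLd : DifferentiableOn ℂ L (ball c R) := fun z hz =>
    (hL z hz).differentiableAt.differentiableWithinAt
  refine ⟨L, hLd, ?_, hLc⟩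
  intro z hz
  have hderiv : ∀ w ∈ ball c R, HasDerivAt (fun w => Complex.exp (-L w) * g w) 0 w := by
    intro w hw
    have h1 := ((hL w hw).neg.cexp).mul
      ((hg.differentiableAt (isOpen_ball.mem_nhds hw)).hasDerivAt)
    convert! h1 using 1
    field_simp [h0 w hw]
    ring
  have hconst := (convex_ball c R).is_const_of_fderivWithin_eq_zero (𝕜 := ℂ)
    (f := fun w => Complex.exp (-L w) * g w)
    (fun w hw => (hderiv w hw).differentiableAt.differentiableWithinAt)
    (fun w hw => by
      rw [fderivWithin_of_isOpen isOpen_ball hw]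
      ext
      simp [(hderiv w hw).deriv]) hz hc
  simp only [hLc, Complex.exp_neg, Complex.exp_log (h0 c hc),
    inv_mul_cancel₀ (h0 c hc)] at hconst
  rw [inv_mul_eq_div, div_eq_one_iff_eq (Complex.exp_ne_zero _)] at hconst
  exact hconst.symm

/-- A holomorphic function on a disc omitting `±1` is the cosine of a holomorphic function. -/
lemma exists_cos_eq_on_ball {f : ℂ → ℂ} {c : ℂ} {R : ℝ} (hR : 0 < R)
    (hf : DifferentiableOn ℂ f (ball c R)) (h1 : ∀ z ∈ ball c R, f z ≠ 1)
    (h2 : ∀ z ∈ ball c R, f z ≠ -1) :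
    ∃ F : ℂ → ℂ, DifferentiableOn ℂ F (ball c R) ∧ (∀ z ∈ ball c R, Complex.cos (F z) = f z) ∧
      ‖F c‖ ≤ Real.pi + 2 * ‖f c‖ := by
  have hc : c ∈ ball c R := mem_ball_self hR
  obtain ⟨L, hLd, hL, -⟩ := exists_log_on_ball (g := fun z => 1 - f z ^ 2) hR
    ((differentiableOn_const _).sub (hf.pow 2)) (fun z hz h => by
      have : (f z - 1) * (f z + 1) = 0 := by linear_combination -h
      rcases mul_eq_zero.1 this with h | h
      · exact h1 z hz (by linear_combination h)
      · exact h2 z hz (by linear_combination h))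
  set g : ℂ → ℂ := fun z => Complex.exp (L z / 2) with hgdef
  have hg2 : ∀ z ∈ ball c R, g z ^ 2 = 1 - f z ^ 2 := by
    intro z hz
    rw [← hL z hz, hgdef, ← Complex.exp_nat_mul]
    congr 1
    push_cast
    ring
  have hgd : DifferentiableOn ℂ g (ball c R) := (hLd.div_const 2).cexp
  have hE : ∀ z ∈ ball c R, (f z + Complex.I * g z) * (f z - Complex.I * g z) = 1 := by
    intro z hz
    have := hg2 z hz
    linear_combination this - g z ^ 2 * Complex.I_sq
  have hE0 : ∀ z ∈ ball c R, f z + Complex.I * g z ≠ 0 := fun z hz h => by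
    have := hE z hz
    rw [h, zero_mul] at this
    exact zero_ne_one this
  obtain ⟨M, hMd, hM, hMc⟩ := exists_log_on_ball (g := fun z => f z + Complex.I * g z) hR
    (hf.add ((differentiableOn_const _).mul hgd)) hE0
  refine ⟨fun z => -Complex.I * M z, (differentiableOn_const _).mul hMd, ?_, ?_⟩
  · intro z hz
    have e1 : -Complex.I * M z * Complex.I = M z := by
      linear_combination (-M z) * Complex.I_sq
    rw [Complex.cos, neg_mul (-Complex.I * M z), e1, Complex.exp_neg, hM z hz,
      inv_eq_of_mul_eq_one_right (hE z hz)]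
    ring
  · have hgn : ‖g c‖ ≤ 1 + ‖f c‖ := by
      have h3 : ‖g c‖ ^ 2 ≤ 1 + ‖f c‖ ^ 2 := by
        rw [← norm_pow, hg2 c hc]
        calc ‖1 - f c ^ 2‖ ≤ ‖(1 : ℂ)‖ + ‖f c ^ 2‖ := norm_sub_le _ _
          _ = 1 + ‖f c‖ ^ 2 := by simp
      nlinarith [norm_nonneg (g c), norm_nonneg (f c)]
    set e := f c + Complex.I * g c with he
    have hen : ‖e‖ ≤ 1 + 2 * ‖f c‖ := by
      calc ‖e‖ ≤ ‖f c‖ + ‖Complex.I * g c‖ := norm_add_le _ _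
        _ = ‖f c‖ + ‖g c‖ := by simp
        _ ≤ _ := by linarith
    have hen' : ‖e‖⁻¹ ≤ 1 + 2 * ‖f c‖ := by
      rw [← norm_inv, inv_eq_of_mul_eq_one_right (hE c hc)]
      calc ‖f c - Complex.I * g c‖ ≤ ‖f c‖ + ‖Complex.I * g c‖ := norm_sub_le _ _
        _ = ‖f c‖ + ‖g c‖ := by simp
        _ ≤ _ := by linarith
    have hepos : 0 < ‖e‖ := norm_pos_iff.2 (hE0 c hc)
    have hlog : |Real.log ‖e‖| ≤ 2 * ‖f c‖ := by
      rw [abs_le]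
      constructor
      · have := Real.log_le_sub_one_of_pos (inv_pos.2 hepos)
        rw [Real.log_inv] at this
        linarith
      · have := Real.log_le_sub_one_of_pos hepos
        linarith
    simp only [hMc, norm_mul, norm_neg, Complex.norm_I, one_mul]
    calc ‖Complex.log e‖ ≤ |(Complex.log e).re| + |(Complex.log e).im| :=
          Complex.norm_le_abs_re_add_abs_im _
      _ ≤ 2 * ‖f c‖ + Real.pi := by
          rw [Complex.log_re, Complex.log_im]
          exact add_le_add hlog (Complex.abs_arg_le_pi _)
      _ = _ := by ring

/-- **Bloch's theorem**. -/
lemma bloch {F : ℂ → ℂ} (hF : DifferentiableOn ℂ F (ball 0 1)) :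
    ∃ w : ℂ, ball w (‖deriv F 0‖ / 96) ⊆ F '' ball 0 1 := by
  by_cases h0 : deriv F 0 = 0
  · exact ⟨0, by simp [h0]⟩
  have hF'd : DifferentiableOn ℂ (deriv F) (ball 0 1) := hF.deriv isOpen_ball
  have hsub : closedBall (0 : ℂ) (1 / 2) ⊆ ball 0 1 := closedBall_subset_ball (by norm_num)
  obtain ⟨a, ha, hmax⟩ := (isCompact_closedBall (0 : ℂ) (1 / 2)).exists_isMaxOn
    ⟨0, by simp⟩ (f := fun z => (1 / 2 - ‖z‖) * ‖deriv F z‖)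
    (((continuous_const.sub continuous_norm).continuousOn).mul
      (hF'd.continuousOn.mono hsub).norm)
  have hm0 : 1 / 2 * ‖deriv F 0‖ ≤ (1 / 2 - ‖a‖) * ‖deriv F a‖ := by
    have := hmax (show (0 : ℂ) ∈ closedBall (0 : ℂ) (1 / 2) by simp)
    simpa using this
  have h0pos : 0 < ‖deriv F 0‖ := norm_pos_iff.2 h0
  have ha' : ‖a‖ ≤ 1 / 2 := by simpa using ha
  have hprod : 0 < (1 / 2 - ‖a‖) * ‖deriv F a‖ := by linarith
  have hρ0 : 0 < 1 / 2 - ‖a‖ := by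
    rcases pos_and_pos_or_neg_and_neg_of_mul_pos hprod with h | h
    · exact h.1
    · linarith
  have hFa : 0 < ‖deriv F a‖ := (pos_iff_pos_of_mul_pos hprod).1 hρ0
  set ρ := (1 / 2 - ‖a‖) / 2 with hρ
  have hρpos : 0 < ρ := by positivity
  have hnorm : ∀ z ∈ ball a ρ, ‖z‖ ≤ 1 / 2 - ρ := by
    intro z hz
    have h1 : ‖z - a‖ < ρ := by simpa [dist_eq_norm] using hz
    have h2 : ‖z‖ ≤ ‖z - a‖ + ‖a‖ := by simpa using norm_add_le (z - a) a
    linarith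
  have hballsub : ball a ρ ⊆ ball 0 1 := fun z hz => by
    have := hnorm z hz
    rw [mem_ball_zero_iff]
    linarith
  have hder : ∀ z ∈ ball a ρ, ‖deriv F z‖ ≤ 2 * ‖deriv F a‖ := by
    intro z hz
    have h1 := hnorm z hz
    have h2 : (1 / 2 - ‖z‖) * ‖deriv F z‖ ≤ (1 / 2 - ‖a‖) * ‖deriv F a‖ :=
      hmax (show z ∈ closedBall (0 : ℂ) (1 / 2) by
        rw [mem_closedBall_zero_iff]; linarith)
    have h3 : ρ * ‖deriv F z‖ ≤ (1 / 2 - ‖z‖) * ‖deriv F z‖ :=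
      mul_le_mul_of_nonneg_right (by linarith) (norm_nonneg _)
    have h4 : ρ * ‖deriv F z‖ ≤ ρ * (2 * ‖deriv F a‖) := by
      calc _ ≤ _ := h3.trans h2
        _ = _ := by rw [hρ]; ring
    exact le_of_mul_le_mul_left h4 hρpos
  have hschwarz : ∀ z ∈ ball a ρ, ‖deriv F z - deriv F a‖ ≤ 3 * ‖deriv F a‖ / ρ * ‖z - a‖ := by
    intro z hz
    have := Complex.dist_le_div_mul_dist_of_mapsTo_ball (f := deriv F) (c := a) (R₁ := ρ)
      (R₂ := 3 * ‖deriv F a‖) (hF'd.mono hballsub) (fun w hw => by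
        rw [mem_closedBall, dist_eq_norm]
        linarith [norm_sub_le (deriv F w) (deriv F a), hder w hw]) hz
    simpa [dist_eq_norm] using this
  have hsmall : closedBall a (ρ / 6) ⊆ ball a ρ := closedBall_subset_ball (by linarith)
  have hmv : ∀ z ∈ closedBall a (ρ / 6),
      ‖F z - F a - deriv F a * (z - a)‖ ≤ ‖deriv F a‖ / 2 * ‖z - a‖ := by
    intro z hz
    have := (convex_closedBall a (ρ / 6)).norm_image_sub_le_of_norm_hasDerivWithin_le
      (f := fun w => F w - deriv F a * w) (f' := fun w => deriv F w - deriv F a)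
      (C := ‖deriv F a‖ / 2) (x := a) (y := z) ?_ ?_ (mem_closedBall_self (by positivity)) hz
    · calc _ = ‖F z - deriv F a * z - (F a - deriv F a * a)‖ := by congr 1; ring
        _ ≤ _ := this
    · intro w hw
      have hw1 := hballsub (hsmall hw)
      have := ((hF.differentiableAt (isOpen_ball.mem_nhds hw1)).hasDerivAt.sub
        ((hasDerivAt_id w).const_mul (deriv F a))).hasDerivWithinAt (s := closedBall a (ρ / 6))
      rw [mul_one] at this
      exact this
    · intro w hw
      have hw1 : ‖w - a‖ ≤ ρ / 6 := by simpa [dist_eq_norm] using hw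
      calc _ ≤ 3 * ‖deriv F a‖ / ρ * ‖w - a‖ := hschwarz w (hsmall hw)
        _ ≤ 3 * ‖deriv F a‖ / ρ * (ρ / 6) := by gcongr
        _ = _ := by field_simp; norm_num
  have hsphere : ∀ z ∈ sphere a (ρ / 6), ‖deriv F a‖ * ρ / 12 ≤ ‖F z - F a‖ := by
    intro z hz
    have h1 := hmv z (sphere_subset_closedBall hz)
    have h2 : ‖z - a‖ = ρ / 6 := by simpa [dist_eq_norm] using hz
    have h3 : ‖deriv F a * (z - a)‖ ≤ ‖F z - F a‖ + ‖F z - F a - deriv F a * (z - a)‖ := by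
      have := norm_sub_le (F z - F a) (F z - F a - deriv F a * (z - a))
      simpa using this
    rw [norm_mul, h2] at h3
    rw [h2] at h1
    linarith
  have hfreq : ∃ᶠ z in 𝓝 a, F z ≠ F a := by
    intro hev
    have hev' : F =ᶠ[𝓝 a] fun _ => F a := hev.mono fun z hz => not_not.1 hz
    have := hev'.deriv_eq
    simp at this
    exact hFa.ne' (by simp [this])
  have hdc : DiffContOnCl ℂ F (ball a (ρ / 6)) :=
    DifferentiableOn.diffContOnCl (hF.mono ((closure_ball_subset_closedBall.trans hsmall).trans
      hballsub))
  have himg := hdc.ball_subset_image_closedBall (by positivity) hsphere hfreq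
  refine ⟨F a, (ball_subset_ball ?_).trans (himg.trans (image_mono (hsmall.trans hballsub)))⟩
  have : ‖deriv F a‖ * ρ = (1 / 2 - ‖a‖) * ‖deriv F a‖ / 2 := by rw [hρ]; ring
  linarith

/-- The points whose cosine is an integer form a net in the plane. -/
lemma exists_cos_eq_int (w : ℂ) : ∃ ζ : ℂ, dist ζ w < 4 ∧ ∃ n : ℤ, Complex.cos ζ = n := by
  obtain ⟨n, hn1, hn2⟩ : ∃ n : ℕ, 1 ≤ n ∧ (n : ℝ) ≤ Real.cosh w.im ∧ Real.cosh w.im < n + 1 :=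
    ⟨⌊Real.cosh w.im⌋₊, Nat.le_floor (by simp [Real.one_le_cosh w.im]),
      Nat.floor_le (by positivity), Nat.lt_floor_add_one _⟩
  have hn1' : (1 : ℝ) ≤ n := by exact_mod_cast hn1
  obtain ⟨t, ht0, ht⟩ : ∃ t : ℝ, 0 ≤ t ∧ Real.cosh t = n :=
    ⟨Real.arcosh n, Real.arcosh_nonneg hn1', Real.cosh_arcosh hn1'⟩
  have hle : t ≤ |w.im| := by
    have : Real.cosh t ≤ Real.cosh w.im := by rw [ht]; exact hn2.1
    rw [Real.cosh_le_cosh, abs_of_nonneg ht0] at this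
    exact this
  have hlt : |w.im| - t < 2 := by
    by_contra hcon
    have h1 : Real.cosh (t + 2) ≤ Real.cosh w.im := by
      rw [Real.cosh_le_cosh, abs_of_nonneg (by linarith)]
      linarith
    rw [Real.cosh_add, ht] at h1
    have h2 : (2 : ℝ) ≤ Real.cosh 2 := by
      have h3 := Real.add_one_le_exp (1 : ℝ)
      have h4 : Real.exp 2 = Real.exp 1 * Real.exp 1 := by rw [← Real.exp_add]; norm_num
      rw [Real.cosh_eq]
      nlinarith [Real.exp_pos (-2)]
    have h3 : 0 ≤ Real.sinh t * Real.sinh 2 :=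
      mul_nonneg (Real.sinh_nonneg_iff.2 ht0) (Real.sinh_nonneg_iff.2 (by norm_num))
    nlinarith [hn2.2]
  obtain ⟨s, hs⟩ : ∃ s : ℝ, |s - w.im| < 2 ∧ Real.cosh s = n := by
    rcases le_total 0 w.im with h | h
    · refine ⟨t, ?_, ht⟩
      rw [abs_of_nonneg h] at hle hlt
      rw [abs_lt]; constructor <;> linarith
    · refine ⟨-t, ?_, by rw [Real.cosh_neg, ht]⟩
      rw [abs_of_nonpos h] at hle hlt
      rw [abs_lt]; constructor <;> linarith
  set k := round (w.re / Real.pi) with hk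
  have hre : |k * Real.pi - w.re| ≤ Real.pi / 2 := by
    have h1 := abs_sub_round (w.re / Real.pi)
    have h2 : k * Real.pi - w.re = -(w.re / Real.pi - k) * Real.pi := by
      field_simp
      ring
    rw [h2, abs_mul, abs_neg, abs_of_pos Real.pi_pos]
    nlinarith [Real.pi_pos]
  refine ⟨⟨k * Real.pi, s⟩, ?_, k.negOnePow * n, ?_⟩
  · rw [dist_eq_norm]
    calc _ ≤ _ := Complex.norm_le_abs_re_add_abs_im _
      _ < 4 := by
        simp only [Complex.sub_re, Complex.sub_im]
        linarith [hs.1, Real.pi_le_four]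
  · rw [Complex.mk_eq_add_mul_I, Complex.cos_add, Complex.cos_mul_I, Complex.sin_mul_I]
    push_cast
    rw [Complex.sin_int_mul_pi, ← Complex.ofReal_cosh, hs.2]
    have : Complex.cos (k * Real.pi) = ((k.negOnePow : ℤ) : ℂ) := by
      rw [← Complex.ofReal_intCast, ← Complex.ofReal_mul, ← Complex.ofReal_cos,
        Real.cos_int_mul_pi, Int.cast_negOnePow]
      push_cast
      rfl
    rw [this]
    simp

lemma norm_sin_le_exp (z : ℂ) : ‖Complex.sin z‖ ≤ Real.exp ‖z‖ := by
  have h1 : ‖Complex.exp (-z * Complex.I)‖ ≤ Real.exp ‖z‖ := by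
    refine (Complex.norm_exp_le_exp_norm _).trans (by simp)
  have h2 : ‖Complex.exp (z * Complex.I)‖ ≤ Real.exp ‖z‖ := by
    refine (Complex.norm_exp_le_exp_norm _).trans (by simp)
  rw [Complex.sin, norm_div, norm_mul, Complex.norm_I, mul_one, Complex.norm_ofNat]
  linarith [norm_sub_le (Complex.exp (-z * Complex.I)) (Complex.exp (z * Complex.I))]

/-- **Landau's theorem**: a bound for the derivative of holomorphic functions on the unit disc
omitting `0` and `1`. -/
lemma landau (M : ℝ) : ∃ C : ℝ, ∀ f : ℂ → ℂ, DifferentiableOn ℂ f (ball 0 1) →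
    (∀ z ∈ ball (0 : ℂ) 1, f z ≠ 0) → (∀ z ∈ ball (0 : ℂ) 1, f z ≠ 1) → ‖f 0‖ ≤ M →
    ‖deriv f 0‖ ≤ C := by
  set B := Real.pi + 2 * (2 * M + 1) with hB
  set B' := Real.pi + 2 * B with hB'
  refine ⟨Real.exp B * (Real.pi * (Real.exp B' * 384)), fun f hf h0 h1 hM => ?_⟩
  have hz : (0 : ℂ) ∈ ball (0 : ℂ) 1 := by simp
  obtain ⟨G, hGd, hG, hGb⟩ := exists_cos_eq_on_ball (f := fun z => 2 * f z - 1) one_pos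
    (((differentiableOn_const _).mul hf).sub_const 1)
    (fun z hz h => h1 z hz (by linear_combination h / 2))
    (fun z hz h => h0 z hz (by linear_combination h / 2))
  have hπ : (Real.pi : ℂ) ≠ 0 := by exact_mod_cast Real.pi_ne_zero
  have hGint : ∀ z ∈ ball (0 : ℂ) 1, ∀ n : ℤ, G z ≠ n * Real.pi := by
    intro z hz n hn
    have h3 := hG z hz
    have h4 : Complex.sin (G z) = 0 := by rw [hn, Complex.sin_int_mul_pi]
    have h5 := Complex.sin_sq_add_cos_sq (G z)
    rw [h3, h4] at h5
    have : f z * (f z - 1) = 0 := by linear_combination h5 / 4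
    rcases mul_eq_zero.1 this with h | h
    · exact h0 z hz h
    · exact h1 z hz (by linear_combination h)
  obtain ⟨H, hHd, hH, hHb⟩ := exists_cos_eq_on_ball (f := fun z => G z / Real.pi) one_pos
    (hGd.div_const _)
    (fun z hz h => hGint z hz 1 (by rw [div_eq_iff hπ] at h; simpa using h))
    (fun z hz h => hGint z hz (-1) (by rw [div_eq_iff hπ] at h; simpa using h))
  have hH384 : ‖deriv H 0‖ ≤ 384 := by
    by_contra hcon
    obtain ⟨w, hw⟩ := bloch hHd
    obtain ⟨ζ, hζ, n, hn⟩ := exists_cos_eq_int w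
    obtain ⟨z, hz, rfl⟩ := hw (show ζ ∈ ball w _ by rw [mem_ball]; linarith)
    have := hH z hz
    rw [hn, eq_div_iff hπ] at this
    exact hGint z hz n this.symm
  have hcomp : (fun z => (1 + Complex.cos (Real.pi * Complex.cos (H z))) / 2) =ᶠ[𝓝 0] f := by
    filter_upwards [isOpen_ball.mem_nhds hz] with z hz
    rw [hH z hz, mul_div_cancel₀ _ hπ, hG z hz]
    ring
  have hHder := (hHd.differentiableAt (isOpen_ball.mem_nhds hz)).hasDerivAt
  have hder := (((hHder.ccos.const_mul (Real.pi : ℂ)).ccos.const_add 1).div_const 2)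
  have hderf : deriv f 0 = _ := (hder.congr_of_eventuallyEq hcomp.symm).deriv
  have hG0 : (Real.pi : ℂ) * Complex.cos (H 0) = G 0 := by
    rw [hH 0 hz, mul_div_cancel₀ _ hπ]
  rw [hG0] at hderf
  have hGB : ‖G 0‖ ≤ B := by
    refine hGb.trans ?_
    have : ‖2 * f 0 - 1‖ ≤ 2 * ‖f 0‖ + 1 := by
      simpa using norm_sub_le (2 * f 0) 1
    rw [hB]; linarith
  have hHB : ‖H 0‖ ≤ B' := by
    refine hHb.trans ?_
    have : ‖G 0 / Real.pi‖ ≤ ‖G 0‖ := by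
      rw [norm_div, Complex.norm_real, Real.norm_of_nonneg Real.pi_pos.le]
      exact div_le_self (norm_nonneg _) (by linarith [Real.pi_gt_three])
    rw [hB']; linarith
  rw [hderf, norm_div, norm_mul, norm_neg, norm_mul, norm_mul, norm_neg, Complex.norm_real,
    Real.norm_of_nonneg Real.pi_pos.le, Complex.norm_ofNat]
  have hs1 : ‖Complex.sin (G 0)‖ ≤ Real.exp B := (norm_sin_le_exp _).trans (Real.exp_le_exp.2 hGB)
  have hs2 : ‖Complex.sin (H 0)‖ ≤ Real.exp B' := (norm_sin_le_exp _).trans (Real.exp_le_exp.2 hHB)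
  have key : ‖Complex.sin (G 0)‖ * (Real.pi * (‖Complex.sin (H 0)‖ * ‖deriv H 0‖)) ≤
      Real.exp B * (Real.pi * (Real.exp B' * 384)) := by
    gcongr
  have hnn : 0 ≤ ‖Complex.sin (G 0)‖ * (Real.pi * (‖Complex.sin (H 0)‖ * ‖deriv H 0‖)) := by
    positivity
  linarith

/-! ### Strict metric derivatives -/

section StrictMetricDeriv

variable {X Y Z : Type*} [MetricSpace X] [MetricSpace Y] [MetricSpace Z]

/-- `g` multiplies distances near `x` by a factor asymptotic to `l`. -/
def HasStrictMetricDerivAt (g : X → Y) (l : ℝ) (x : X) : Prop :=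
  ∀ ε > 0, ∃ U ∈ 𝓝 x, ∀ u ∈ U, ∀ v ∈ U,
    |dist (g u) (g v) - l * dist u v| ≤ ε * dist u v

namespace HasStrictMetricDerivAt

lemma congr {g h : X → Y} {l : ℝ} {x : X} (hg : HasStrictMetricDerivAt g l x)
    (hgh : g =ᶠ[𝓝 x] h) : HasStrictMetricDerivAt h l x := by
  intro ε hε
  obtain ⟨U, hU, H⟩ := hg ε hε
  refine ⟨U ∩ {y | g y = h y}, inter_mem hU hgh, fun u hu v hv => ?_⟩
  rw [← show g u = h u from hu.2, ← show g v = h v from hv.2]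
  exact H u hu.1 v hv.1

lemma exists_lipschitz {g : X → Y} {l K : ℝ} {x : X} (hg : HasStrictMetricDerivAt g l x)
    (hK : l < K) : ∃ U ∈ 𝓝 x, ∀ u ∈ U, ∀ v ∈ U, dist (g u) (g v) ≤ K * dist u v := by
  obtain ⟨U, hU, H⟩ := hg (K - l) (by linarith)
  refine ⟨U, hU, fun u hu v hv => ?_⟩
  have := (abs_le.1 (H u hu v hv)).2
  linarith

lemma exists_antilipschitz {g : X → Y} {l K : ℝ} {x : X} (hg : HasStrictMetricDerivAt g l x)
    (hK : K < l) : ∃ U ∈ 𝓝 x, ∀ u ∈ U, ∀ v ∈ U, K * dist u v ≤ dist (g u) (g v) := by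
  obtain ⟨U, hU, H⟩ := hg (l - K) (by linarith)
  refine ⟨U, hU, fun u hu v hv => ?_⟩
  have := (abs_le.1 (H u hu v hv)).1
  linarith

lemma continuousAt {g : X → Y} {l : ℝ} {x : X} (hg : HasStrictMetricDerivAt g l x) :
    ContinuousAt g x := by
  obtain ⟨U, hU, H⟩ := hg.exists_lipschitz (lt_add_one l)
  rw [ContinuousAt, tendsto_iff_dist_tendsto_zero]
  have h1 : Tendsto (fun y => (l + 1) * dist y x) (𝓝 x) (𝓝 0) := by
    have : Continuous fun y => (l + 1) * dist y x := by fun_prop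
    simpa using this.tendsto x
  refine squeeze_zero' (Eventually.of_forall fun _ => dist_nonneg) ?_ h1
  filter_upwards [hU] with y hy using H y hy x (mem_of_mem_nhds hU)

lemma comp {g : X → Y} {h : Y → Z} {l l' : ℝ} {x : X}
    (hh : HasStrictMetricDerivAt h l' (g x)) (hg : HasStrictMetricDerivAt g l x) :
    HasStrictMetricDerivAt (h ∘ g) (l' * l) x := by
  intro ε hε
  obtain ⟨U, hU, HU⟩ := hg.exists_lipschitz (lt_of_le_of_lt (le_abs_self l) (lt_add_one |l|))
  obtain ⟨V, hV, HV⟩ := hg (ε / (2 * (|l'| + 1))) (by positivity)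
  obtain ⟨W, hW, HW⟩ := hh (ε / (2 * (|l| + 1))) (by positivity)
  refine ⟨U ∩ V ∩ g ⁻¹' W, inter_mem (inter_mem hU hV) (hg.continuousAt hW),
    fun u hu v hv => ?_⟩
  have h1 := HW _ hu.2 _ hv.2
  have h2 := HV _ hu.1.2 _ hv.1.2
  have h3 := HU _ hu.1.1 _ hv.1.1
  have h4 : ε / (2 * (|l| + 1)) * dist (g u) (g v) ≤ ε / 2 * dist u v := by
    calc _ ≤ ε / (2 * (|l| + 1)) * ((|l| + 1) * dist u v) := by gcongr
      _ = _ := by field_simp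
  have h5 : |l'| * (ε / (2 * (|l'| + 1)) * dist u v) ≤ ε / 2 * dist u v := by
    calc _ ≤ (|l'| + 1) * (ε / (2 * (|l'| + 1)) * dist u v) := by gcongr; linarith
      _ = _ := by field_simp
  calc |dist (h (g u)) (h (g v)) - l' * l * dist u v|
      = |(dist (h (g u)) (h (g v)) - l' * dist (g u) (g v)) +
          l' * (dist (g u) (g v) - l * dist u v)| := by congr 1; ring
    _ ≤ _ := abs_add_le _ _
    _ ≤ ε / 2 * dist u v + ε / 2 * dist u v := by
        rw [abs_mul]
        have : |l'| * |dist (g u) (g v) - l * dist u v| ≤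
          |l'| * (ε / (2 * (|l'| + 1)) * dist u v) := by gcongr
        linarith
    _ = ε * dist u v := by ring

lemma of_comp {e : X → Y} {f : Y → Z} {l m : ℝ} {x : X}
    (hf : HasStrictMetricDerivAt (f ∘ e) l x) (he : HasStrictMetricDerivAt e m x) (hm : 0 < m)
    (hopen : 𝓝 (e x) ≤ map e (𝓝 x)) : HasStrictMetricDerivAt f (l / m) (e x) := by
  intro ε hε
  obtain ⟨U, hU, HU⟩ := hf (ε * m / 4) (by positivity)
  obtain ⟨V, hV, HV⟩ := he (ε * m * m / (4 * (|l| + 1))) (by positivity)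
  obtain ⟨W, hW, HW⟩ := he.exists_antilipschitz (half_lt_self hm)
  refine ⟨e '' (U ∩ V ∩ W), hopen (image_mem_map (inter_mem (inter_mem hU hV) hW)), ?_⟩
  rintro _ ⟨u, hu, rfl⟩ _ ⟨v, hv, rfl⟩
  have h1 := HU _ hu.1.1 _ hv.1.1
  have h2 := HV _ hu.1.2 _ hv.1.2
  have h3 := HW _ hu.2 _ hv.2
  have h4 : |l / m| * |dist (e u) (e v) - m * dist u v| ≤ ε * m / 4 * dist u v := by
    rw [abs_div, abs_of_pos hm]
    calc _ ≤ (|l| + 1) / m * (ε * m * m / (4 * (|l| + 1)) * dist u v) := by gcongr; linarith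
      _ = _ := by field_simp
  have h5 : |(l / m) * (dist (e u) (e v) - m * dist u v)| ≤ ε * m / 4 * dist u v := by
    rwa [abs_mul]
  calc |dist (f (e u)) (f (e v)) - l / m * dist (e u) (e v)|
      = |(dist (f (e u)) (f (e v)) - l * dist u v) -
          (l / m) * (dist (e u) (e v) - m * dist u v)| := by congr 1; field_simp; ring
    _ ≤ _ := abs_sub _ _
    _ ≤ ε * m / 4 * dist u v + ε * m / 4 * dist u v := add_le_add h1 h5
    _ = ε * (m / 2 * dist u v) := by ring
    _ ≤ ε * dist (e u) (e v) := by gcongr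

lemma of_isometry {e : X → Y} (he : Isometry e) (x : X) : HasStrictMetricDerivAt e 1 x := by
  intro ε hε
  refine ⟨univ, univ_mem, fun u _ v _ => ?_⟩
  rw [he.dist_eq]
  simp only [one_mul, sub_self, abs_zero]
  positivity

lemma of_hasStrictDerivAt {φ : ℂ → ℂ} {φ' z : ℂ} (h : HasStrictDerivAt φ φ' z) :
    HasStrictMetricDerivAt φ ‖φ'‖ z := by
  intro ε hε
  have h1 := h.isLittleO.def hε
  rw [nhds_prod_eq] at h1
  rw [Filter.Eventually, mem_prod_self_iff] at h1
  obtain ⟨U, hU, H⟩ := h1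
  refine ⟨U, hU, fun u hu v hv => ?_⟩
  have h2 : ‖_‖ ≤ _ := H (mk_mem_prod hu hv)
  rw [dist_eq_norm, dist_eq_norm, ← norm_mul]
  refine (abs_norm_sub_norm_le _ _).trans ?_
  convert! h2 using 3
  simp [mul_comm]

lemma tendsto_ratio {g : X → Y} {l : ℝ} {x : X} (hg : HasStrictMetricDerivAt g l x) :
    Tendsto (fun y => dist (g y) (g x) / dist y x) (𝓝[≠] x) (𝓝 l) := by
  rw [Metric.tendsto_nhds]
  intro ε hε
  obtain ⟨U, hU, H⟩ := hg (ε / 2) (by positivity)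
  filter_upwards [mem_nhdsWithin_of_mem_nhds hU, self_mem_nhdsWithin] with y hy hne
  have h1 : 0 < dist y x := dist_pos.2 hne
  have h2 := H y hy x (mem_of_mem_nhds hU)
  rw [Real.dist_eq]
  calc _ = |dist (g y) (g x) - l * dist y x| / dist y x := by
        rw [← abs_of_pos h1, ← abs_div, abs_of_pos h1]
        congr 1
        field_simp
    _ ≤ ε / 2 := by rwa [div_le_iff₀ h1]
    _ < ε := by linarith

/-- A map with positive strict metric derivative that is open at `v` has a local inverse. -/
lemma exists_local_inverse {F : X → Y} {l C : ℝ} {v : X} (h : HasStrictMetricDerivAt F l v)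
    (hl : 0 < l) (hopen : 𝓝 (F v) ≤ map F (𝓝 v)) (hC : 1 / l < C) {U : Set X} (hU : U ∈ 𝓝 v) :
    ∃ ρ > 0, ∃ g : Y → X, (∀ u ∈ ball (F v) ρ, g u ∈ U ∧ F (g u) = u) ∧
      (∀ u ∈ ball (F v) ρ, ∀ u' ∈ ball (F v) ρ, dist (g u) (g u') ≤ C * dist u u') ∧
      ∀ᶠ v' in 𝓝 v, g (F v') = v' := by
  have hC0 : 0 < C := lt_trans (by positivity) hC
  obtain ⟨W, hW, HW⟩ := h.exists_antilipschitz (K := 1 / C)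
    (by rw [div_lt_comm₀ hC0 hl]; exact hC)
  have hUW := inter_mem hU hW
  obtain ⟨ρ, hρ, hsub⟩ := Metric.mem_nhds_iff.1 (hopen (image_mem_map hUW))
  have hinj : ∀ u ∈ W, ∀ u' ∈ W, dist u u' ≤ C * dist (F u) (F u') := by
    intro u hu u' hu'
    have := HW u hu u' hu'
    rwa [one_div, inv_mul_le_iff₀ hC0] at this
  have hex : ∀ u : Y, ∃ w, u ∈ ball (F v) ρ → w ∈ U ∩ W ∧ F w = u := by
    intro u
    by_cases hu : u ∈ ball (F v) ρ
    · obtain ⟨w, hw, rfl⟩ := hsub hu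
      exact ⟨w, fun _ => ⟨hw, rfl⟩⟩
    · exact ⟨v, fun h => absurd h hu⟩
  choose g hg using hex
  refine ⟨ρ, hρ, g, fun u hu => ⟨(hg u hu).1.1, (hg u hu).2⟩, fun u hu u' hu' => ?_, ?_⟩
  · have := hinj _ (hg u hu).1.2 _ (hg u' hu').1.2
    rwa [(hg u hu).2, (hg u' hu').2] at this
  · filter_upwards [hW, h.continuousAt (ball_mem_nhds _ hρ)] with v' hv' hb
    have := hinj _ (hg _ hb).1.2 _ hv'
    rw [(hg _ hb).2, dist_self, mul_zero] at this
    exact dist_le_zero.1 this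

/-- The derivative of a map having a Lipschitz section is bounded from below. -/
lemma one_div_le_of_section {F : X → Y} {g : Y → X} {l C : ℝ} {D : Set Y} {u : Y}
    (h : HasStrictMetricDerivAt F l (g u)) (hC : 0 < C) (hFg : ∀ v ∈ D, F (g v) = v)
    (hg : ∀ v ∈ D, ∀ w ∈ D, dist (g v) (g w) ≤ C * dist v w) (hu : u ∈ D)
    (hacc : AccPt u (𝓟 D)) : 1 / C ≤ l := by
  by_contra! hcon
  obtain ⟨U, hU, HU⟩ := h.exists_lipschitz (K := (l + 1 / C) / 2) (by linarith)
  obtain ⟨δ, hδ, hball⟩ := Metric.mem_nhds_iff.1 hU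
  rw [accPt_iff_nhds] at hacc
  obtain ⟨v, ⟨hv1, hv2⟩, hvu⟩ := hacc (ball u (δ / C)) (ball_mem_nhds _ (by positivity))
  have h0 : 0 < dist v u := dist_pos.2 hvu
  have h1 := hg v hv2 u hu
  have h2 : g v ∈ U := hball (by
    rw [mem_ball]
    calc _ ≤ C * dist v u := h1
      _ < C * (δ / C) := by gcongr; exact hv1
      _ = δ := by field_simp)
  have h3 := HU _ h2 _ (mem_of_mem_nhds hU)
  rw [hFg v hv2, hFg u hu] at h3
  have h4 : 0 < dist (g v) (g u) := by
    rw [dist_pos]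
    intro h
    have := hFg v hv2
    rw [h, hFg u hu] at this
    exact hvu this.symm
  have h5 : (l + 1 / C) / 2 * dist (g v) (g u) < 1 / C * dist (g v) (g u) := by
    exact mul_lt_mul_of_pos_right (by linarith) h4
  have h6 : 1 / C * dist (g v) (g u) ≤ dist v u := by
    rw [one_div, inv_mul_le_iff₀ hC]; exact h1
  linarith

end HasStrictMetricDerivAt

/-- Uniform contracting inverse branches along a compact set on which the derivative is large. -/
lemma exists_uniform_branch {F : X → X} {D : X → ℝ} {L : Set X} (hL : IsCompact L)
    (hF : ∀ x ∈ L, HasStrictMetricDerivAt F (D x) x) (hD : ∀ x ∈ L, 2 < D x)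
    (hopen : ∀ x ∈ L, 𝓝 (F x) ≤ map F (𝓝 x)) :
    ∃ r > 0, ∀ x ∈ L, ∃ g : X → X, g (F x) = x ∧ (∀ u ∈ ball (F x) r, F (g u) = u) ∧
      ∀ u ∈ ball (F x) r, ∀ v ∈ ball (F x) r, dist (g u) (g v) ≤ 1 / 2 * dist u v := by
  refine hL.induction_on (p := fun s => ∃ r > 0, ∀ x ∈ s, ∃ g : X → X, g (F x) = x ∧
      (∀ u ∈ ball (F x) r, F (g u) = u) ∧
      ∀ u ∈ ball (F x) r, ∀ v ∈ ball (F x) r, dist (g u) (g v) ≤ 1 / 2 * dist u v)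
    ⟨1, one_pos, by simp⟩ ?_ ?_ ?_
  · rintro s t hst ⟨r, hr, H⟩
    exact ⟨r, hr, fun x hx => H x (hst hx)⟩
  · rintro s t ⟨r, hr, H⟩ ⟨r', hr', H'⟩
    refine ⟨min r r', lt_min hr hr', fun x hx => ?_⟩
    rcases hx with hx | hx
    · obtain ⟨g, h1, h2, h3⟩ := H x hx
      have hs := ball_subset_ball (x := F x) (min_le_left r r')
      exact ⟨g, h1, fun u hu => h2 u (hs hu), fun u hu v hv => h3 u (hs hu) v (hs hv)⟩
    · obtain ⟨g, h1, h2, h3⟩ := H' x hx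
      have hs := ball_subset_ball (x := F x) (min_le_right r r')
      exact ⟨g, h1, fun u hu => h2 u (hs hu), fun u hu v hv => h3 u (hs hu) v (hs hv)⟩
  · intro x hx
    obtain ⟨ρ, hρ, g, h1, h2, h3⟩ := (hF x hx).exists_local_inverse (C := 1 / 2)
      (by linarith [hD x hx]) (hopen x hx)
      (one_div_lt_one_div_of_lt (by norm_num) (hD x hx)) univ_mem
    have h4 := (hF x hx).continuousAt (ball_mem_nhds _ (half_pos hρ))
    refine ⟨_, mem_nhdsWithin_of_mem_nhds (inter_mem h3 h4), ρ / 2, half_pos hρ, fun y hy => ?_⟩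
    have hs : ball (F y) (ρ / 2) ⊆ ball (F x) ρ := by
      intro u hu
      have hy2 : dist (F y) (F x) < ρ / 2 := hy.2
      rw [mem_ball] at hu ⊢
      linarith [dist_triangle u (F y) (F x)]
    exact ⟨g, hy.1, fun u hu => (h1 u (hs hu)).2, fun u hu v hv => h2 u (hs hu) v (hs hv)⟩

/-- Iterating uniform contracting inverse branches. -/
lemma exists_iterated_branch {F : X → X} {L : Set X} (hFL : MapsTo F L L) {r : ℝ}
    (H : ∀ x ∈ L, ∃ g : X → X, g (F x) = x ∧ (∀ u ∈ ball (F x) r, F (g u) = u) ∧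
      ∀ u ∈ ball (F x) r, ∀ v ∈ ball (F x) r, dist (g u) (g v) ≤ 1 / 2 * dist u v) (k : ℕ) :
    ∀ x ∈ L, ∃ h : X → X, h (F^[k] x) = x ∧ (∀ u ∈ ball (F^[k] x) r, F^[k] (h u) = u) ∧
      (∀ u ∈ ball (F^[k] x) r, ∀ v ∈ ball (F^[k] x) r,
        dist (h u) (h v) ≤ (1 / 2) ^ k * dist u v) ∧
      ∀ u ∈ ball (F^[k] x) r, ∀ i ≤ k,
        dist (F^[i] (h u)) (F^[i] x) ≤ (1 / 2) ^ (k - i) * dist u (F^[k] x) := by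
  induction k with
  | zero =>
    intro x _
    exact ⟨id, rfl, fun _ _ => rfl, by simp, by simp⟩
  | succ k ih =>
    intro x hx
    obtain ⟨h, h1, h2, h3, h4⟩ := ih (F x) (hFL hx)
    obtain ⟨g, g1, g2, g3⟩ := H x hx
    rw [Function.iterate_succ_apply]
    have hb : ∀ u ∈ ball (F^[k] (F x)) r, h u ∈ ball (F x) r := by
      intro u hu
      rw [mem_ball]
      have h5 : (1 / 2 : ℝ) ^ k ≤ 1 := pow_le_one₀ (by norm_num) (by norm_num)
      have h6 := h4 u hu 0 (Nat.zero_le _)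
      simp only [Function.iterate_zero, id, Nat.sub_zero] at h6
      calc _ ≤ (1 / 2) ^ k * dist u (F^[k] (F x)) := h6
        _ ≤ 1 * dist u (F^[k] (F x)) := by gcongr
        _ < r := by simpa using hu
    refine ⟨g ∘ h, by simp [h1, g1], fun u hu => ?_, fun u hu v hv => ?_, fun u hu i hi => ?_⟩
    · rw [Function.comp, Function.iterate_succ_apply, g2 _ (hb u hu), h2 u hu]
    · calc _ ≤ 1 / 2 * dist (h u) (h v) := g3 _ (hb u hu) _ (hb v hv)
        _ ≤ 1 / 2 * ((1 / 2) ^ k * dist u v) := by gcongr; exact h3 u hu v hv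
        _ = _ := by ring
    · rcases i with _ | i
      · have hr : 0 < r := lt_of_le_of_lt dist_nonneg hu
        have h6 := h4 u hu 0 (Nat.zero_le _)
        simp only [Function.iterate_zero, id, Nat.sub_zero] at h6
        have h7 := g3 _ (hb u hu) (F x) (mem_ball_self hr)
        rw [g1] at h7
        simp only [Function.iterate_zero, id, Nat.sub_zero, Function.comp]
        calc _ ≤ 1 / 2 * dist (h u) (F x) := h7
          _ ≤ 1 / 2 * ((1 / 2) ^ k * dist u (F^[k] (F x))) := by gcongr
          _ = _ := by ring
      · rw [Function.comp, Function.iterate_succ_apply, Function.iterate_succ_apply,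
          g2 _ (hb u hu), Nat.add_sub_add_right]
        exact h4 u hu i (by omega)

end StrictMetricDeriv

/-! ### Geometry of the Riemann sphere -/

namespace RSphere

lemma ofC_or_infty (x : RSphere) : x = infty ∨ ∃ z, x = ofC z := by
  rcases x with ⟨_ | z⟩
  · exact Or.inl rfl
  · exact Or.inr ⟨z, rfl⟩

lemma ofC_injective : Function.Injective ofC := fun z w h => by
  simpa [ofC] using h

lemma ofC_ne_infty (z : ℂ) : ofC z ≠ infty := by simp [ofC, infty]

@[simp] lemma toC_ofC (z : ℂ) : toC (ofC z) = z := rfl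

@[simp] lemma inv_infty : inv infty = ofC 0 := rfl

@[simp] lemma inv_zero : inv (ofC 0) = infty := by simp [inv, elim, ofC]

lemma inv_ofC {z : ℂ} (hz : z ≠ 0) : inv (ofC z) = ofC z⁻¹ := by simp [inv, elim, ofC, hz]

@[simp] lemma inv_inv (x : RSphere) : inv (inv x) = x := by
  rcases ofC_or_infty x with rfl | ⟨z, rfl⟩
  · simp
  · rcases eq_or_ne z 0 with rfl | hz
    · simp
    · rw [inv_ofC hz, inv_ofC (inv_ne_zero hz), _root_.inv_inv]

lemma dist_sq_eq (x y : RSphere) : dist x y ^ 2 =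
    ‖(embed x).fst - (embed y).fst‖ ^ 2 + ((embed x).snd - (embed y).snd) ^ 2 := by
  rw [show dist x y = dist (embed x) (embed y) from rfl, WithLp.prod_dist_eq_of_L2,
    Real.sq_sqrt (by positivity), dist_eq_norm, Real.dist_eq, sq_abs]

lemma embed_ofC_fst (z : ℂ) : (embed (ofC z)).fst = ((2 / (‖z‖ ^ 2 + 1) : ℝ)) • z := rfl
lemma embed_ofC_snd (z : ℂ) : (embed (ofC z)).snd = (‖z‖ ^ 2 - 1) / (‖z‖ ^ 2 + 1) := rfl
lemma embed_infty_fst : (embed infty).fst = 0 := rfl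
lemma embed_infty_snd : (embed infty).snd = 1 := rfl

lemma dist_ofC_sq (z w : ℂ) : dist (ofC z) (ofC w) ^ 2 =
    4 * ‖z - w‖ ^ 2 / ((‖z‖ ^ 2 + 1) * (‖w‖ ^ 2 + 1)) := by
  rw [dist_sq_eq, embed_ofC_fst, embed_ofC_fst, embed_ofC_snd, embed_ofC_snd]
  have h1 : (0 : ℝ) < ‖z‖ ^ 2 + 1 := by positivity
  have h2 : (0 : ℝ) < ‖w‖ ^ 2 + 1 := by positivity
  simp only [Complex.sq_norm, Complex.normSq_apply, Complex.sub_re, Complex.sub_im,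
    Complex.real_smul, Complex.re_ofReal_mul, Complex.im_ofReal_mul] at *
  field_simp
  ring

lemma dist_infty_sq (w : ℂ) : dist infty (ofC w) ^ 2 = 4 / (‖w‖ ^ 2 + 1) := by
  rw [dist_sq_eq, embed_ofC_fst, embed_ofC_snd, embed_infty_fst, embed_infty_snd]
  have h2 : (0 : ℝ) < ‖w‖ ^ 2 + 1 := by positivity
  simp only [Complex.sq_norm, Complex.normSq_apply, Complex.sub_re, Complex.sub_im,
    Complex.real_smul, Complex.re_ofReal_mul, Complex.im_ofReal_mul, Complex.zero_re,
    Complex.zero_im] at *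
  field_simp
  ring

lemma dist_ofC (z w : ℂ) : dist (ofC z) (ofC w) =
    2 / (√(‖z‖ ^ 2 + 1) * √(‖w‖ ^ 2 + 1)) * dist z w := by
  refine (sq_eq_sq₀ dist_nonneg (by positivity)).1 ?_
  rw [dist_ofC_sq, mul_pow, div_pow, mul_pow, Real.sq_sqrt (by positivity),
    Real.sq_sqrt (by positivity), dist_eq_norm]
  ring

lemma inv_isometry : Isometry inv := by
  refine Isometry.of_dist_eq fun x y => (sq_eq_sq₀ dist_nonneg dist_nonneg).1 ?_
  have key : ∀ w, dist (inv infty) (inv (ofC w)) ^ 2 = dist infty (ofC w) ^ 2 := by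
    intro w
    rcases eq_or_ne w 0 with rfl | hw
    · rw [inv_infty, inv_zero, dist_comm]
    · rw [inv_ofC hw, inv_infty, dist_ofC_sq, dist_infty_sq]
      have : ‖w‖ ≠ 0 := norm_ne_zero_iff.2 hw
      simp only [zero_sub, norm_neg, norm_inv, norm_zero]
      field_simp
      ring
  rcases ofC_or_infty x with rfl | ⟨z, rfl⟩ <;> rcases ofC_or_infty y with rfl | ⟨w, rfl⟩
  · simp
  · exact key w
  · rw [dist_comm, key, dist_comm]
  · rcases eq_or_ne z 0 with rfl | hz
    · rcases eq_or_ne w 0 with rfl | hw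
      · simp
      · rw [inv_zero, inv_ofC hw, ← key, inv_infty, inv_ofC (inv_ne_zero hw), _root_.inv_inv]
    · rcases eq_or_ne w 0 with rfl | hw
      · rw [inv_ofC hz, inv_zero, dist_comm, ← key, inv_infty, inv_ofC (inv_ne_zero hz),
          _root_.inv_inv, dist_comm]
      · rw [inv_ofC hz, inv_ofC hw, dist_ofC_sq, dist_ofC_sq, inv_sub_inv hz hw]
        have h1 : ‖w‖ ≠ 0 := norm_ne_zero_iff.2 hw
        have h2 : ‖z‖ ≠ 0 := norm_ne_zero_iff.2 hz
        rw [norm_div, norm_mul, norm_sub_rev w z, norm_inv, norm_inv]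
        field_simp
        ring

lemma hasStrictMetricDerivAt_ofC (z : ℂ) :
    HasStrictMetricDerivAt ofC (2 / (‖z‖ ^ 2 + 1)) z := by
  intro ε hε
  have hc : Continuous fun p : ℂ × ℂ => 2 / (√(‖p.1‖ ^ 2 + 1) * √(‖p.2‖ ^ 2 + 1)) := by
    refine continuous_const.div (by fun_prop) fun p => ?_
    positivity
  have h1 := (hc.tendsto (z, z)).eventually (closedBall_mem_nhds _ hε)
  rw [nhds_prod_eq, Filter.Eventually, mem_prod_self_iff] at h1
  obtain ⟨U, hU, H⟩ := h1
  refine ⟨U, hU, fun u hu v hv => ?_⟩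
  have h2 : _ ∈ closedBall _ _ := H (mk_mem_prod hu hv)
  rw [mem_closedBall, Real.dist_eq, Real.mul_self_sqrt (by positivity)] at h2
  rw [dist_ofC, ← sub_mul, abs_mul, abs_of_nonneg (dist_nonneg (x := u))]
  gcongr

lemma toC_eq (x : RSphere) : toC x = (1 - (embed x).snd)⁻¹ • (embed x).fst := by
  rcases ofC_or_infty x with rfl | ⟨z, rfl⟩
  · simp [embed_infty_fst]
    rfl
  · rw [toC_ofC, embed_ofC_fst, embed_ofC_snd, smul_smul]
    have h1 : (0 : ℝ) < ‖z‖ ^ 2 + 1 := by positivity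
    have h2 : 1 - (‖z‖ ^ 2 - 1) / (‖z‖ ^ 2 + 1) = 2 / (‖z‖ ^ 2 + 1) := by
      field_simp
      ring
    rw [h2, inv_mul_cancel₀ (by positivity), one_smul]

lemma continuous_embed : Continuous embed := by
  have : Isometry embed := fun _ _ => rfl
  exact this.continuous

lemma continuousAt_toC (z : ℂ) : ContinuousAt toC (ofC z) := by
  have h : toC = fun x => (1 - (embed x).snd)⁻¹ • (embed x).fst := funext toC_eq
  have h1 : Continuous fun x : RSphere => (embed x).snd :=
    (WithLp.prod_continuous_ofLp 2 ℂ ℝ).snd.comp continuous_embed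
  have h2 : Continuous fun x : RSphere => (embed x).fst :=
    (WithLp.prod_continuous_ofLp 2 ℂ ℝ).fst.comp continuous_embed
  rw [h]
  refine ContinuousAt.smul (ContinuousAt.inv₀ (continuous_const.sub h1).continuousAt ?_)
    h2.continuousAt
  change 1 - (embed (ofC z)).snd ≠ 0
  rw [embed_ofC_snd]
  intro h3
  have h4 : (0 : ℝ) < ‖z‖ ^ 2 + 1 := by positivity
  field_simp at h3
  linarith

lemma nhds_ofC_le (z : ℂ) : 𝓝 (ofC z) ≤ map ofC (𝓝 z) := by
  intro s hs
  have h1 := (continuousAt_toC z).preimage_mem_nhds (show ofC ⁻¹' s ∈ 𝓝 (toC (ofC z)) from hs)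
  filter_upwards [h1, isOpen_ne.mem_nhds (ofC_ne_infty z)] with x hx hne
  rcases ofC_or_infty x with rfl | ⟨w, rfl⟩
  · exact absurd rfl hne
  · exact hx

/-- The two standard charts of the sphere. -/
noncomputable def chart (b : Bool) (z : ℂ) : RSphere := if b then inv (ofC z) else ofC z

lemma chart_injective (b : Bool) : Function.Injective (chart b) := by
  cases b
  · exact ofC_injective
  · exact inv_isometry.injective.comp ofC_injective

lemma hasStrictMetricDerivAt_chart (b : Bool) (z : ℂ) :
    HasStrictMetricDerivAt (chart b) (2 / (‖z‖ ^ 2 + 1)) z := by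
  cases b
  · exact hasStrictMetricDerivAt_ofC z
  · have := (HasStrictMetricDerivAt.of_isometry inv_isometry (ofC z)).comp
      (hasStrictMetricDerivAt_ofC z)
    rwa [one_mul] at this

lemma continuous_chart (b : Bool) : Continuous (chart b) :=
  continuous_iff_continuousAt.2 fun z => (hasStrictMetricDerivAt_chart b z).continuousAt

lemma nhds_inv_le (x : RSphere) : 𝓝 (inv x) ≤ map inv (𝓝 x) := by
  intro s hs
  have h1 : inv ⁻¹' (inv ⁻¹' s) ∈ 𝓝 (inv x) := by
    refine inv_isometry.continuous.continuousAt.preimage_mem_nhds ?_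
    rw [inv_inv]
    exact hs
  simpa [preimage_preimage] using h1

lemma nhds_chart_le (b : Bool) (z : ℂ) : 𝓝 (chart b z) ≤ map (chart b) (𝓝 z) := by
  cases b
  · exact nhds_ofC_le z
  · exact (nhds_inv_le _).trans (map_mono (nhds_ofC_le z))

lemma exists_chart (x : RSphere) : ∃ b, ∃ z ∈ closedBall (0 : ℂ) 1, chart b z = x := by
  rcases ofC_or_infty x with rfl | ⟨z, rfl⟩
  · exact ⟨true, 0, by simp, inv_zero⟩
  · rcases le_total ‖z‖ 1 with hz | hz
    · exact ⟨false, z, by simpa using hz, rfl⟩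
    · have h0 : z ≠ 0 := by
        rintro rfl
        norm_num at hz
      refine ⟨true, z⁻¹, ?_, ?_⟩
      · simpa using inv_le_one_of_one_le₀ hz
      · simp [chart, inv_ofC (inv_ne_zero h0)]

instance : CompactSpace RSphere := by
  refine ⟨?_⟩
  have : (univ : Set RSphere) =
      chart false '' closedBall 0 1 ∪ chart true '' closedBall 0 1 := by
    refine (eq_univ_of_forall fun x => ?_).symm
    obtain ⟨b, z, hz, rfl⟩ := exists_chart x
    cases b
    · exact Or.inl (mem_image_of_mem _ hz)
    · exact Or.inr (mem_image_of_mem _ hz)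
  rw [this]
  exact ((isCompact_closedBall _ _).image (continuous_chart _)).union
    ((isCompact_closedBall _ _).image (continuous_chart _))

instance nhdsNE_neBot (x : RSphere) : NeBot (𝓝[≠] x) := by
  obtain ⟨b, z, -, rfl⟩ := exists_chart x
  have h : Tendsto (chart b) (𝓝[≠] z) (𝓝[≠] (chart b z)) :=
    tendsto_nhdsWithin_iff.2 ⟨((continuous_chart b).tendsto z).mono_left nhdsWithin_le_nhds,
      eventually_nhdsWithin_of_forall fun w hw => (chart_injective b).ne hw⟩
  exact h.neBot

lemma accPt_of_mem_nhds {x : RSphere} {s : Set RSphere} (hs : s ∈ 𝓝 x) : AccPt x (𝓟 s) := by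
  rw [accPt_iff_nhds]
  intro U hU
  have h1 : U ∩ s ∈ 𝓝[≠] x := mem_nhdsWithin_of_mem_nhds (inter_mem hU hs)
  obtain ⟨y, hy, hne⟩ := NeBot.nonempty_of_mem (nhdsNE_neBot x)
    (inter_mem h1 self_mem_nhdsWithin)
  exact ⟨y, hy, hne⟩

/-- Small compact connected neighbourhoods. -/
lemma exists_compact_connected_nhd {x : RSphere} {U : Set RSphere} (hU : U ∈ 𝓝 x) :
    ∃ K ∈ 𝓝 x, K ⊆ U ∧ IsCompact K ∧ IsPreconnected K := by
  obtain ⟨b, z, -, rfl⟩ := exists_chart x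
  obtain ⟨s, hs, hsub⟩ := Metric.nhds_basis_closedBall.mem_iff.1
    ((continuous_chart b).continuousAt.preimage_mem_nhds hU)
  exact ⟨chart b '' closedBall z s,
    nhds_chart_le b z (image_mem_map (closedBall_mem_nhds z hs)), image_subset_iff.2 hsub,
    (isCompact_closedBall z s).image (continuous_chart b),
    (convex_closedBall z s).isPreconnected.image _ (continuous_chart b).continuousOn⟩

lemma dist_le_two (x y : RSphere) : dist x y ≤ 2 := by
  have key : ∀ w, dist infty (ofC w) ≤ 2 := by
    intro w
    refine (sq_le_sq₀ dist_nonneg (by norm_num)).1 ?_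
    rw [dist_infty_sq, div_le_iff₀ (by positivity)]
    nlinarith [sq_nonneg ‖w‖]
  rcases ofC_or_infty x with rfl | ⟨z, rfl⟩ <;> rcases ofC_or_infty y with rfl | ⟨w, rfl⟩
  · simp
  · exact key w
  · rw [dist_comm]
    exact key z
  · refine (sq_le_sq₀ dist_nonneg (by norm_num)).1 ?_
    rw [dist_ofC_sq, div_le_iff₀ (by positivity)]
    have h1 : ‖z - w‖ ≤ ‖z‖ + ‖w‖ := norm_sub_le z w
    have h2 : ‖z - w‖ ^ 2 ≤ (‖z‖ + ‖w‖) ^ 2 := by gcongr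
    nlinarith [sq_nonneg (‖z‖ * ‖w‖ - 1)]

lemma abs_embed_le (x : RSphere) :
    |(embed x).fst.re| ≤ 1 ∧ |(embed x).fst.im| ≤ 1 ∧ |(embed x).snd| ≤ 1 := by
  have h : (embed x).fst.re ^ 2 + (embed x).fst.im ^ 2 + (embed x).snd ^ 2 = 1 := by
    rcases ofC_or_infty x with rfl | ⟨z, rfl⟩
    · simp [embed_infty_fst, embed_infty_snd]
    · rw [embed_ofC_fst, embed_ofC_snd, Complex.real_smul, Complex.re_ofReal_mul,
        Complex.im_ofReal_mul]
      have h1 : (0 : ℝ) < ‖z‖ ^ 2 + 1 := by positivity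
      simp only [Complex.sq_norm, Complex.normSq_apply] at *
      field_simp
      ring
  refine ⟨?_, ?_, ?_⟩ <;> rw [← sq_le_one_iff_abs_le_one] <;>
    nlinarith [sq_nonneg (embed x).fst.re, sq_nonneg (embed x).fst.im, sq_nonneg (embed x).snd]

lemma card_le_of_separated {δ : ℝ} (hδ : 0 < δ) (hδ1 : δ ≤ 1) (E : Finset RSphere)
    (hE : ∀ x ∈ E, ∀ y ∈ E, x ≠ y → δ ≤ dist x y) : (E.card : ℝ) ≤ (7 / δ) ^ 3 := by
  set n : ℤ := ⌈2 / δ⌉ with hn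
  have hn0 : 0 ≤ n := Int.ceil_nonneg (by positivity)
  set G : RSphere → ℤ × ℤ × ℤ := fun x => (⌊(embed x).fst.re * (2 / δ)⌋,
    ⌊(embed x).fst.im * (2 / δ)⌋, ⌊(embed x).snd * (2 / δ)⌋) with hG
  have hb : ∀ t : ℝ, |t| ≤ 1 → ⌊t * (2 / δ)⌋ ∈ Finset.Icc (-n) n := by
    intro t ht
    rw [abs_le] at ht
    have h0 : 0 < 2 / δ := by positivity
    have h1 : 2 / δ ≤ n := Int.le_ceil _
    rw [Finset.mem_Icc]
    constructor
    · rw [Int.le_floor]; push_cast; nlinarith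
    · have : ⌊t * (2 / δ)⌋ ≤ ⌊(n : ℝ)⌋ := Int.floor_mono (by nlinarith)
      simpa using this
  have hmaps : ∀ x ∈ E, G x ∈ Finset.Icc (-n) n ×ˢ Finset.Icc (-n) n ×ˢ Finset.Icc (-n) n := by
    intro x _
    obtain ⟨h1, h2, h3⟩ := abs_embed_le x
    simp only [hG, Finset.mem_product]
    exact ⟨hb _ h1, hb _ h2, hb _ h3⟩
  have hf : ∀ s t : ℝ, ⌊s * (2 / δ)⌋ = ⌊t * (2 / δ)⌋ → (s - t) ^ 2 ≤ δ ^ 2 / 4 := by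
    intro s t h
    have h1 := Int.abs_sub_lt_one_of_floor_eq_floor h
    rw [← sub_mul, abs_mul, abs_of_pos (by positivity : 0 < 2 / δ)] at h1
    have h2 : |s - t| ≤ δ / 2 := by
      have : |s - t| = |s - t| * (2 / δ) * (δ / 2) := by field_simp
      rw [this]
      nlinarith
    rw [← sq_abs]
    nlinarith [abs_nonneg (s - t)]
  have hinj : Set.InjOn G E := by
    intro x hx y hy hxy
    by_contra hne
    have h0 := hE x hx y hy hne
    simp only [hG, Prod.mk.injEq] at hxy
    have h1 := hf _ _ hxy.1
    have h2 := hf _ _ hxy.2.1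
    have h3 := hf _ _ hxy.2.2
    have h4 := dist_sq_eq x y
    rw [Complex.sq_norm, Complex.normSq_apply, Complex.sub_re, Complex.sub_im] at h4
    nlinarith
  have hcard := Finset.card_le_card_of_injOn G hmaps hinj
  rw [Finset.card_product, Finset.card_product, Int.card_Icc] at hcard
  have h5 : (((n + 1 - -n).toNat : ℕ) : ℝ) ≤ 7 / δ := by
    have h6 : ((n + 1 - -n).toNat : ℤ) = 2 * n + 1 := by omega
    have h7 : (((n + 1 - -n).toNat : ℕ) : ℝ) = 2 * n + 1 := by exact_mod_cast h6
    rw [h7]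
    have h8 : (n : ℝ) < 2 / δ + 1 := Int.ceil_lt_add_one _
    have h9 : 1 ≤ 1 / δ := by rwa [one_le_div hδ]
    have h10 : 7 / δ = 2 * (2 / δ) + 3 * (1 / δ) := by ring
    linarith
  calc (E.card : ℝ) ≤ (((n + 1 - -n).toNat : ℕ) : ℝ) * ((((n + 1 - -n).toNat : ℕ) : ℝ) *
        (((n + 1 - -n).toNat : ℕ) : ℝ)) := by exact_mod_cast hcard
    _ ≤ (7 / δ) * ((7 / δ) * (7 / δ)) := by gcongr
    _ = (7 / δ) ^ 3 := by ring

end RSphere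

lemma HasStrictMetricDerivAt.sphDeriv_eq {g : RSphere → RSphere} {l : ℝ} {x : RSphere}
    (h : HasStrictMetricDerivAt g l x) : sphDeriv g x = l :=
  h.tendsto_ratio.limsup_eq

lemma HasStrictMetricDerivAt.nonneg {g : RSphere → RSphere} {l : ℝ} {x : RSphere}
    (h : HasStrictMetricDerivAt g l x) : 0 ≤ l :=
  ge_of_tendsto h.tendsto_ratio (Eventually.of_forall fun _ => by positivity)

/-! ### Sphere-valued analytic maps and the local form of rational maps -/

open RSphere

lemma RSphere.chart_true_eq {w : ℂ} (hw : w ≠ 0) : chart true w = chart false w⁻¹ := by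
  simp [chart, inv_ofC hw]

/-- A sphere-valued function which is analytic in a chart at `z`. -/
def SphAnalyticAt (ψ : ℂ → RSphere) (z : ℂ) : Prop :=
  ∃ (b : Bool) (φ : ℂ → ℂ), AnalyticAt ℂ φ z ∧ ψ =ᶠ[𝓝 z] fun w => chart b (φ w)

namespace SphAnalyticAt

lemma of_nhdsNE {ψ : ℂ → RSphere} {z : ℂ} {b : Bool} {φ : ℂ → ℂ} (hψ : ContinuousAt ψ z)
    (hφ : AnalyticAt ℂ φ z) (h : ψ =ᶠ[𝓝[≠] z] fun w => chart b (φ w)) :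
    ψ =ᶠ[𝓝 z] fun w => chart b (φ w) :=
  (hψ.eventuallyEq_nhds_iff_eventuallyEq_nhdsNE
    ((continuous_chart b).continuousAt.comp hφ.continuousAt)).1 h

lemma comp {ψ : ℂ → RSphere} {f : RSphere → RSphere} {z : ℂ} (h : SphAnalyticAt ψ z)
    (hf : ∀ b z, SphAnalyticAt (fun w => f (chart b w)) z) : SphAnalyticAt (fun w => f (ψ w)) z := by
  obtain ⟨b, φ, hφ, heq⟩ := h
  obtain ⟨b', φ', hφ', heq'⟩ := hf b (φ z)
  refine ⟨b', fun w => φ' (φ w), hφ'.comp hφ, ?_⟩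
  filter_upwards [heq, hφ.continuousAt.eventually heq'] with w hw hw'
  rw [hw, hw']

lemma comp_analyticAt {ψ : ℂ → RSphere} {g : ℂ → ℂ} {z : ℂ} (h : SphAnalyticAt ψ (g z))
    (hg : AnalyticAt ℂ g z) : SphAnalyticAt (fun w => ψ (g w)) z := by
  obtain ⟨b, φ, hφ, heq⟩ := h
  exact ⟨b, fun w => φ (g w), hφ.comp hg, hg.continuousAt.eventually heq⟩

lemma hasStrictMetricDerivAt {ψ : ℂ → RSphere} {z : ℂ} {b : Bool} {φ : ℂ → ℂ}
    (hφ : AnalyticAt ℂ φ z) (heq : ψ =ᶠ[𝓝 z] fun w => chart b (φ w)) :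
    HasStrictMetricDerivAt ψ (2 / (‖φ z‖ ^ 2 + 1) * ‖deriv φ z‖) z :=
  ((hasStrictMetricDerivAt_chart b (φ z)).comp
    (HasStrictMetricDerivAt.of_hasStrictDerivAt hφ.hasStrictDerivAt)).congr heq.symm

end SphAnalyticAt

/-- The Möbius coordinate `1 / (w - b)`, vanishing at infinity. -/
noncomputable def poleCoord (b : ℂ) (x : RSphere) : ℂ := x.elim 0 fun w => (w - b)⁻¹

lemma poleCoord_ofC (b w : ℂ) : poleCoord b (ofC w) = (w - b)⁻¹ := rfl

lemma poleCoord_infty (b : ℂ) : poleCoord b infty = 0 := rfl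

lemma norm_sub_sq_le (w b : ℂ) : ‖w - b‖ ^ 2 ≤ (‖w‖ ^ 2 + 1) * (‖b‖ ^ 2 + 1) := by
  have h1 : ‖w - b‖ ≤ ‖w‖ + ‖b‖ := norm_sub_le w b
  have h2 : ‖w - b‖ ^ 2 ≤ (‖w‖ + ‖b‖) ^ 2 := by gcongr
  nlinarith [sq_nonneg (‖w‖ * ‖b‖ - 1)]

lemma dist_le_poleCoord {b : ℂ} {x y : RSphere} (hx : x ≠ ofC b) (hy : y ≠ ofC b) :
    dist x y ≤ 2 * (‖b‖ ^ 2 + 1) * ‖poleCoord b x - poleCoord b y‖ := by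
  have hb : (0 : ℝ) < ‖b‖ ^ 2 + 1 := by positivity
  have key : ∀ w : ℂ, ofC w ≠ ofC b →
      dist infty (ofC w) ≤ 2 * (‖b‖ ^ 2 + 1) * ‖poleCoord b (ofC w)‖ := by
    intro w hw
    have hw0 : 0 < ‖w - b‖ := by
      rw [norm_pos_iff, sub_ne_zero]
      rintro rfl
      exact hw rfl
    refine (sq_le_sq₀ dist_nonneg (by positivity)).1 ?_
    rw [dist_infty_sq, poleCoord_ofC, norm_inv, mul_pow, mul_pow, inv_pow,
      div_le_iff₀ (by positivity)]
    have h1 := norm_sub_sq_le w b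
    have h2 : 0 < ‖w - b‖ ^ 2 := by positivity
    have h3 : 2 ^ 2 * (‖b‖ ^ 2 + 1) ^ 2 * (‖w - b‖ ^ 2)⁻¹ * (‖w‖ ^ 2 + 1) =
        4 * (‖b‖ ^ 2 + 1) * (((‖w‖ ^ 2 + 1) * (‖b‖ ^ 2 + 1)) / ‖w - b‖ ^ 2) := by
      field_simp; norm_num
    rw [h3]
    have h4 : 1 ≤ ((‖w‖ ^ 2 + 1) * (‖b‖ ^ 2 + 1)) / ‖w - b‖ ^ 2 := by rwa [one_le_div h2]
    nlinarith [sq_nonneg ‖b‖]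
  rcases ofC_or_infty x with rfl | ⟨z, rfl⟩ <;> rcases ofC_or_infty y with rfl | ⟨w, rfl⟩
  · simp
  · rw [poleCoord_infty, zero_sub, norm_neg]
    exact key w hy
  · rw [poleCoord_infty, sub_zero, dist_comm]
    exact key z hx
  · have hz0 : z - b ≠ 0 := fun h => hx (by rw [sub_eq_zero.1 h])
    have hw0 : w - b ≠ 0 := fun h => hy (by rw [sub_eq_zero.1 h])
    refine (sq_le_sq₀ dist_nonneg (by positivity)).1 ?_
    rw [dist_ofC_sq, poleCoord_ofC, poleCoord_ofC, inv_sub_inv hz0 hw0, norm_div, norm_mul,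
      show w - b - (z - b) = -(z - w) by ring, norm_neg]
    have h1 := norm_sub_sq_le w b
    have h2 := norm_sub_sq_le z b
    have h3 : 0 < ‖w - b‖ := norm_pos_iff.2 hw0
    have h4 : 0 < ‖z - b‖ := norm_pos_iff.2 hz0
    have h5 : ‖z - b‖ ^ 2 * ‖w - b‖ ^ 2 ≤
        (‖z‖ ^ 2 + 1) * (‖b‖ ^ 2 + 1) * ((‖w‖ ^ 2 + 1) * (‖b‖ ^ 2 + 1)) := by gcongr
    rw [mul_pow, div_pow, mul_pow, mul_pow, div_le_iff₀ (by positivity)]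
    have h6 : 2 ^ 2 * (‖b‖ ^ 2 + 1) ^ 2 * (‖z - w‖ ^ 2 / (‖z - b‖ ^ 2 * ‖w - b‖ ^ 2)) *
        ((‖z‖ ^ 2 + 1) * (‖w‖ ^ 2 + 1)) = 4 * ‖z - w‖ ^ 2 *
        (((‖z‖ ^ 2 + 1) * (‖b‖ ^ 2 + 1) * ((‖w‖ ^ 2 + 1) * (‖b‖ ^ 2 + 1))) /
          (‖z - b‖ ^ 2 * ‖w - b‖ ^ 2)) := by field_simp; ring
    rw [h6]
    exact le_mul_of_one_le_right (by positivity) (by rwa [one_le_div (by positivity)])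

lemma norm_poleCoord_le {b : ℂ} {x : RSphere} {r : ℝ} (hr : 0 < r) (h : r ≤ dist x (ofC b)) :
    ‖poleCoord b x‖ ≤ 2 / r := by
  rcases ofC_or_infty x with rfl | ⟨z, rfl⟩
  · rw [poleCoord_infty, norm_zero]
    positivity
  · rw [dist_ofC] at h
    have h1 : 1 ≤ √(‖z‖ ^ 2 + 1) * √(‖b‖ ^ 2 + 1) := by
      refine one_le_mul_of_one_le_of_one_le ?_ ?_ <;> rw [Real.one_le_sqrt] <;>
        linarith [sq_nonneg ‖z‖, sq_nonneg ‖b‖]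
    have h2 : r ≤ 2 * ‖z - b‖ := by
      rw [← dist_eq_norm]
      refine h.trans ?_
      gcongr
      exact div_le_self (by norm_num) h1
    have h3 : 0 < ‖z - b‖ := by linarith
    rw [poleCoord_ofC, norm_inv, inv_eq_one_div, div_le_div_iff₀ h3 hr]
    linarith

lemma SphAnalyticAt.analyticAt_poleCoord {b : ℂ} {ψ : ℂ → RSphere} {z : ℂ}
    (h : SphAnalyticAt ψ z) (hb : ψ z ≠ ofC b) : AnalyticAt ℂ (fun w => poleCoord b (ψ w)) z := by
  obtain ⟨c, φ, hφ, heq⟩ := h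
  have h0 : ψ z = chart c (φ z) := heq.self_of_nhds
  cases c
  · have h1 : φ z - b ≠ 0 := by
      intro h
      rw [h0, sub_eq_zero.1 h] at hb
      exact hb rfl
    refine ((hφ.sub analyticAt_const).inv h1).congr ?_
    filter_upwards [heq] with w hw
    rw [hw]
    rfl
  · have h1 : 1 - b * φ z ≠ 0 := by
      intro h
      have h2 : φ z ≠ 0 := by
        intro h3
        simp [h3] at h
      rw [h0, chart_true_eq h2] at hb
      apply hb
      change ofC _ = ofC _
      congr 1
      exact inv_eq_of_mul_eq_one_left (sub_eq_zero.1 h).symm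
    refine (hφ.div (analyticAt_const.sub (analyticAt_const.mul hφ)) h1).congr ?_
    have h2 : ContinuousAt (fun w => 1 - b * φ w) z :=
      continuousAt_const.sub (continuousAt_const.mul hφ.continuousAt)
    filter_upwards [heq, h2.eventually_ne h1] with w hw hne
    rw [hw]
    rcases eq_or_ne (φ w) 0 with h3 | h3
    · have h4 : chart true (φ w) = infty := by simp [chart, h3]
      rw [h4, poleCoord_infty]
      simp [h3]
    · rw [chart_true_eq h3]
      change _ = ((φ w)⁻¹ - b)⁻¹
      simp only [Pi.div_apply, Pi.sub_apply, Pi.mul_apply]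
      field_simp

/-- A bound for the derivative of spherically analytic maps omitting three points. -/
lemma sphAnalytic_landau {b₁ b₂ b₃ : ℂ} (h12 : b₁ ≠ b₂) (h13 : b₁ ≠ b₃) (h23 : b₂ ≠ b₃)
    {r : ℝ} (hr : 0 < r) : ∃ C : ℝ, ∀ (ψ : ℂ → RSphere) (l : ℝ),
      (∀ z ∈ ball (0 : ℂ) 1, SphAnalyticAt ψ z) →
      (∀ z ∈ ball (0 : ℂ) 1, ψ z ≠ ofC b₁ ∧ ψ z ≠ ofC b₂ ∧ ψ z ≠ ofC b₃) →
      r ≤ dist (ψ 0) (ofC b₃) → HasStrictMetricDerivAt ψ l 0 → l ≤ C := by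
  set k := (b₂ - b₃) / (b₂ - b₁) with hk
  have h21' : b₂ - b₁ ≠ 0 := sub_ne_zero.2 h12.symm
  have h13' : b₁ - b₃ ≠ 0 := sub_ne_zero.2 h13
  have h23' : b₂ - b₃ ≠ 0 := sub_ne_zero.2 h23
  have hk0 : k ≠ 0 := div_ne_zero h23' h21'
  have hk3 : k * (b₃ - b₁) ≠ 0 := mul_ne_zero hk0 (sub_ne_zero.2 h13.symm)
  obtain ⟨C, hC⟩ := landau (‖k‖ + ‖k * (b₃ - b₁)‖ * (2 / r))
  refine ⟨2 * (‖b₃‖ ^ 2 + 1) / ‖k * (b₃ - b₁)‖ * C, fun ψ l hψ hom hdist hl => ?_⟩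
  have hz0 : (0 : ℂ) ∈ ball (0 : ℂ) 1 := by simp
  set a : ℂ → ℂ := fun z => k + k * (b₃ - b₁) * poleCoord b₃ (ψ z) with ha
  have haa : ∀ z ∈ ball (0 : ℂ) 1, AnalyticAt ℂ a z := fun z hz =>
    analyticAt_const.add (analyticAt_const.mul ((hψ z hz).analyticAt_poleCoord (hom z hz).2.2))
  have hval : ∀ w : ℂ, w ≠ b₃ →
      k + k * (b₃ - b₁) * poleCoord b₃ (ofC w) = k * (w - b₁) / (w - b₃) := by
    intro w hw
    have : w - b₃ ≠ 0 := sub_ne_zero.2 hw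
    rw [poleCoord_ofC]
    field_simp
    ring
  have hval' : ∀ z ∈ ball (0 : ℂ) 1, a z ≠ 0 ∧ a z ≠ 1 := by
    intro z hz
    obtain ⟨h1, h2, h3⟩ := hom z hz
    rcases ofC_or_infty (ψ z) with h | ⟨w, h⟩
    · simp only [ha, h, poleCoord_infty, mul_zero, add_zero]
      refine ⟨hk0, fun h1 => h13 ?_⟩
      rw [hk, div_eq_one_iff_eq h21'] at h1
      linear_combination h1
    · simp only [ha, h]
      rw [h] at h1 h2 h3
      have hw1 : w ≠ b₁ := fun h => h1 (by rw [h])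
      have hw2 : w ≠ b₂ := fun h => h2 (by rw [h])
      have hw3 : w ≠ b₃ := fun h => h3 (by rw [h])
      rw [hval w hw3]
      have h5 : w - b₃ ≠ 0 := sub_ne_zero.2 hw3
      refine ⟨div_ne_zero (mul_ne_zero hk0 (sub_ne_zero.2 hw1)) h5, fun h6 => hw2 ?_⟩
      rw [div_eq_one_iff_eq h5, hk, div_mul_eq_mul_div, div_eq_iff h21'] at h6
      have h7 : (b₁ - b₃) * (w - b₂) = 0 := by linear_combination h6
      rcases mul_eq_zero.1 h7 with h8 | h8
      · exact absurd h8 h13'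
      · exact sub_eq_zero.1 h8
  have hda : ‖deriv a 0‖ ≤ C := by
    refine hC a (fun z hz => (haa z hz).differentiableAt.differentiableWithinAt)
      (fun z hz => (hval' z hz).1) (fun z hz => (hval' z hz).2) ?_
    refine (norm_add_le _ _).trans ?_
    rw [norm_mul]
    gcongr
    exact norm_poleCoord_le hr hdist
  have h1 := (HasStrictMetricDerivAt.of_hasStrictDerivAt
    (haa 0 hz0).hasStrictDerivAt).tendsto_ratio.const_mul (2 * (‖b₃‖ ^ 2 + 1) / ‖k * (b₃ - b₁)‖)
  have h2 : l ≤ 2 * (‖b₃‖ ^ 2 + 1) / ‖k * (b₃ - b₁)‖ * ‖deriv a 0‖ := by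
    refine le_of_tendsto_of_tendsto hl.tendsto_ratio h1 ?_
    filter_upwards [mem_nhdsWithin_of_mem_nhds (isOpen_ball.mem_nhds hz0)] with z hz
    rw [← mul_div_assoc]
    gcongr
    refine (dist_le_poleCoord (hom z hz).2.2 (hom 0 hz0).2.2).trans (le_of_eq ?_)
    have h3 : a z - a 0 = k * (b₃ - b₁) * (poleCoord b₃ (ψ z) - poleCoord b₃ (ψ 0)) := by
      simp only [ha]
      ring
    rw [dist_eq_norm, h3, norm_mul (k * (b₃ - b₁))]
    have : ‖k * (b₃ - b₁)‖ ≠ 0 := norm_ne_zero_iff.2 hk3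
    generalize ‖k * (b₃ - b₁)‖ = m at this
    field_simp
  refine h2.trans ?_
  gcongr

/-! ### Rational maps -/

lemma sphAnalyticAt_of_quotient {ψ : ℂ → RSphere} {z : ℂ} {P Q : Polynomial ℂ}
    (hψ : ContinuousAt ψ z) (hPQ : P.eval z ≠ 0 ∨ Q.eval z ≠ 0) (hQ : Q ≠ 0)
    (h : ∀ᶠ w in 𝓝[≠] z, Q.eval w ≠ 0 → ψ w = ofC (P.eval w / Q.eval w)) :
    SphAnalyticAt ψ z := by
  have hP' := P.differentiable.analyticAt z
  have hQ' := Q.differentiable.analyticAt z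
  by_cases h0 : Q.eval z = 0
  · have hP0 : P.eval z ≠ 0 := hPQ.resolve_right (not_not.2 h0)
    refine ⟨true, fun w => Q.eval w / P.eval w, hQ'.div hP' hP0,
      SphAnalyticAt.of_nhdsNE hψ (hQ'.div hP' hP0) ?_⟩
    have hfin : {w | Q.eval w = 0}.Finite := Polynomial.finite_setOfPred_isRoot hQ
    have h1 : ∀ᶠ w in 𝓝[≠] z, Q.eval w ≠ 0 := nhdsNE_le_cofinite z hfin.compl_mem_cofinite
    filter_upwards [h, h1,
      mem_nhdsWithin_of_mem_nhds (hP'.continuousAt.eventually_ne hP0)] with w hw hq hp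
    rw [hw hq, chart_true_eq (div_ne_zero hq hp), inv_div]
    rfl
  · refine ⟨false, fun w => P.eval w / Q.eval w, hP'.div hQ' h0,
      SphAnalyticAt.of_nhdsNE hψ (hP'.div hQ' h0) ?_⟩
    filter_upwards [h,
      mem_nhdsWithin_of_mem_nhds (hQ'.continuousAt.eventually_ne h0)] with w hw hq
    exact hw hq

namespace IsRationalMap

variable {f : RSphere → RSphere} {p q : Polynomial ℂ}

lemma den_ne_zero (hf : IsRationalMap f p q) (hdeg : 2 ≤ ratDeg p q) : q ≠ 0 := by
  rintro rfl
  have h1 := hf.coprime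
  rw [isCoprime_zero_right, Polynomial.isUnit_iff] at h1
  obtain ⟨c, -, rfl⟩ := h1
  simp [ratDeg] at hdeg

lemma eval_ne_zero_or (hf : IsRationalMap f p q) (z : ℂ) : p.eval z ≠ 0 ∨ q.eval z ≠ 0 := by
  by_contra! h
  obtain ⟨a, b, hab⟩ := hf.coprime
  have := congrArg (Polynomial.eval z) hab
  simp [h.1, h.2] at this

lemma reflect_eval {D : ℕ} {P : Polynomial ℂ} (h : P.natDegree ≤ D) {z : ℂ} (hz : z ≠ 0) :
    (Polynomial.reflect D P).eval z = P.eval z⁻¹ * z ^ D := by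
  let _ : Invertible z⁻¹ := invertibleOfNonzero (inv_ne_zero hz)
  have h1 := Polynomial.eval₂_reflect_mul_pow (RingHom.id ℂ) z⁻¹ D P h
  rw [invOf_eq_inv, _root_.inv_inv] at h1
  change (Polynomial.reflect D P).eval z * _ = P.eval _ at h1
  rw [← h1, mul_assoc, ← mul_pow, inv_mul_cancel₀ hz, one_pow, mul_one]

lemma sphAnalyticAt (hf : IsRationalMap f p q) (hdeg : 2 ≤ ratDeg p q) (b : Bool) (z : ℂ) :
    SphAnalyticAt (fun w => f (chart b w)) z := by
  have hq := hf.den_ne_zero hdeg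
  have hc : ContinuousAt (fun w => f (chart b w)) z :=
    (hf.continuous.comp (continuous_chart b)).continuousAt
  cases b
  · exact sphAnalyticAt_of_quotient hc (hf.eval_ne_zero_or z) hq
      (Eventually.of_forall fun w hw => hf.eval w hw)
  · set D := ratDeg p q with hD
    have hpD : p.natDegree ≤ D := le_max_left _ _
    have hqD : q.natDegree ≤ D := le_max_right _ _
    refine sphAnalyticAt_of_quotient (P := Polynomial.reflect D p) (Q := Polynomial.reflect D q)
      hc ?_ (by rwa [Ne, Polynomial.reflect_eq_zero_iff]) ?_
    · rcases eq_or_ne z 0 with rfl | hz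
      · rw [← Polynomial.coeff_zero_eq_eval_zero, ← Polynomial.coeff_zero_eq_eval_zero,
          Polynomial.coeff_reflect, Polynomial.coeff_reflect,
          Polynomial.revAt_le (Nat.zero_le D), Nat.sub_zero]
        rcases max_choice p.natDegree q.natDegree with h | h
        · left
          have h1 : D = p.natDegree := h
          rw [h1]
          refine Polynomial.leadingCoeff_ne_zero.2 ?_
          rintro rfl
          simp at h1
          omega
        · right
          have h1 : D = q.natDegree := h
          rw [h1]
          exact Polynomial.leadingCoeff_ne_zero.2 hq
      · rw [reflect_eval hpD hz, reflect_eval hqD hz]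
        have h0 := pow_ne_zero D hz
        exact (hf.eval_ne_zero_or z⁻¹).imp (fun h => mul_ne_zero h h0)
          (fun h => mul_ne_zero h h0)
    · filter_upwards [nhdsNE_le_cofinite z (finite_singleton (0 : ℂ)).compl_mem_cofinite]
        with w hw hQ
      replace hw : w ≠ 0 := hw
      rw [reflect_eval hqD hw] at hQ ⊢
      rw [reflect_eval hpD hw, chart_true_eq hw, mul_div_mul_right _ _ (pow_ne_zero D hw)]
      exact hf.eval _ (left_ne_zero_of_mul hQ)

lemma hasStrictMetricDerivAt (hf : IsRationalMap f p q) (hdeg : 2 ≤ ratDeg p q) (x : RSphere) :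
    HasStrictMetricDerivAt f (sphDeriv f x) x := by
  obtain ⟨b, z, -, rfl⟩ := exists_chart x
  obtain ⟨b', φ, hφ, heq⟩ := hf.sphAnalyticAt hdeg b z
  have h1 := (SphAnalyticAt.hasStrictMetricDerivAt hφ heq).of_comp
    (hasStrictMetricDerivAt_chart b z) (by positivity) (nhds_chart_le b z)
  rwa [h1.sphDeriv_eq]

lemma nhds_le_map (hf : IsRationalMap f p q) (hdeg : 2 ≤ ratDeg p q) {x : RSphere}
    (hx : sphDeriv f x ≠ 0) : 𝓝 (f x) ≤ map f (𝓝 x) := by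
  obtain ⟨b, z, -, rfl⟩ := exists_chart x
  obtain ⟨b', φ, hφ, heq⟩ := hf.sphAnalyticAt hdeg b z
  have h1 := (SphAnalyticAt.hasStrictMetricDerivAt hφ heq).of_comp
    (hasStrictMetricDerivAt_chart b z) (by positivity) (nhds_chart_le b z)
  have hφ' : deriv φ z ≠ 0 := by
    intro h
    apply hx
    rw [h1.sphDeriv_eq, h, norm_zero, mul_zero, zero_div]
  have h0 : f (chart b z) = chart b' (φ z) := heq.self_of_nhds
  calc 𝓝 (f (chart b z)) ≤ map (chart b') (𝓝 (φ z)) := by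
        rw [h0]
        exact nhds_chart_le b' _
    _ = map (fun w => chart b' (φ w)) (𝓝 z) := by
        rw [← hφ.hasStrictDerivAt.map_nhds_eq hφ', Filter.map_map]
        rfl
    _ = map f (map (chart b) (𝓝 z)) := by
        rw [Filter.map_map, ← Filter.map_congr heq]
        rfl
    _ ≤ map f (𝓝 (chart b z)) := map_mono (continuous_chart b).continuousAt

lemma finite_of_subset_roots {s : Set RSphere} {P : Polynomial ℂ} (hP : P ≠ 0)
    (h : ∀ z, ofC z ∈ s → P.eval z = 0) : s.Finite := by
  have h1 : {z | P.eval z = 0}.Finite := Polynomial.finite_setOfPred_isRoot hP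
  refine ((h1.image ofC).union (finite_singleton infty)).subset fun x hx => ?_
  rcases ofC_or_infty x with rfl | ⟨z, rfl⟩
  · exact Or.inr rfl
  · exact Or.inl (mem_image_of_mem _ (h z hx))

lemma finite_fiber (hf : IsRationalMap f p q) (hdeg : 2 ≤ ratDeg p q) (y : RSphere) :
    (f ⁻¹' {y}).Finite := by
  have hq := hf.den_ne_zero hdeg
  rcases ofC_or_infty y with rfl | ⟨w, rfl⟩
  · refine finite_of_subset_roots hq fun z hz => ?_
    by_contra h
    have h1 : f (ofC z) = infty := hz
    rw [hf.eval z h] at h1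
    exact ofC_ne_infty _ h1
  · have hne : p - Polynomial.C w * q ≠ 0 := by
      intro h
      have hp : p = Polynomial.C w * q := sub_eq_zero.1 h
      have hu : IsUnit q := by
        obtain ⟨a, b, hab⟩ := hf.coprime
        rw [hp] at hab
        exact IsUnit.of_mul_eq_one_right (a * Polynomial.C w + b) (by rw [← hab]; ring)
      obtain ⟨c, -, rfl⟩ := Polynomial.isUnit_iff.1 hu
      rw [← Polynomial.C_mul] at hp
      rw [ratDeg, hp, Polynomial.natDegree_C, Polynomial.natDegree_C] at hdeg
      omega
    refine finite_of_subset_roots (mul_ne_zero hq hne) fun z hz => ?_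
    by_cases h : q.eval z = 0
    · simp [h]
    · have h1 : f (ofC z) = ofC w := hz
      rw [hf.eval z h] at h1
      have h2 := ofC_injective h1
      rw [div_eq_iff h] at h2
      simp [h2]

lemma finite_critSet (hf : IsRationalMap f p q) (hdeg : 2 ≤ ratDeg p q) :
    (critSet f).Finite := by
  have hq := hf.den_ne_zero hdeg
  have hW : Polynomial.wronskian p q ≠ 0 := by
    rw [Ne, hf.coprime.wronskian_eq_zero_iff, Polynomial.derivative_eq_zero,
      Polynomial.derivative_eq_zero]
    rintro ⟨h1, h2⟩
    simp [ratDeg, h1, h2] at hdeg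
  refine finite_of_subset_roots (mul_ne_zero hq hW) fun z hz => ?_
  by_cases h : q.eval z = 0
  · simp [h]
  · have hd : HasDerivAt (fun w => p.eval w / q.eval w)
        ((p.derivative.eval z * q.eval z - p.eval z * q.derivative.eval z) / q.eval z ^ 2) z :=
      (p.hasDerivAt z).div (q.hasDerivAt z) h
    have heq : (fun w => f (chart false w)) =ᶠ[𝓝 z] fun w => chart false (p.eval w / q.eval w) := by
      filter_upwards [q.continuous.continuousAt.eventually_ne h] with w hw using hf.eval w hw
    have h1 := (SphAnalyticAt.hasStrictMetricDerivAt
      ((p.differentiable.analyticAt z).div (q.differentiable.analyticAt z) h) heq).of_comp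
      (hasStrictMetricDerivAt_chart false z) (by positivity) (nhds_chart_le false z)
    have h2 : sphDeriv f (chart false z) = 0 := hz
    rw [h1.sphDeriv_eq] at h2
    have h3 : ‖deriv (fun w => p.eval w / q.eval w) z‖ = 0 := by
      rw [div_eq_zero_iff, mul_eq_zero] at h2
      rcases h2 with (h2 | h2) | h2
      · exact absurd h2 (by positivity)
      · exact h2
      · exact absurd h2 (by positivity)
    rw [norm_eq_zero, hd.deriv, div_eq_zero_iff] at h3
    have h4 := h3.resolve_right (pow_ne_zero 2 h)
    simp only [Polynomial.wronskian, Polynomial.eval_mul, Polynomial.eval_sub]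
    linear_combination -(q.eval z) * h4

end IsRationalMap

/-! ### Separated sets and pressure -/

/-- Bounds on the map and on the Birkhoff sums which make the pressure well behaved. -/
structure PressureBounds (g : RSphere → RSphere) (Λ : Set RSphere) (φ : RSphere → ℝ)
    (K A B B' : ℝ) : Prop where
  one_le : 1 ≤ K
  lipschitz : ∀ x y, dist (g x) (g y) ≤ K * dist x y
  A_nonneg : 0 ≤ A
  B_nonneg : 0 ≤ B
  B'_nonneg : 0 ≤ B'
  upper : ∀ x ∈ Λ, ∀ m, birkhoff g φ m x ≤ A + B * m
  lower : ∀ x ∈ Λ, ∀ m, -(A + B' * m) ≤ birkhoff g φ m x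

/-- The supremum of the exponential sums over separated sets. -/
noncomputable def sepSum (g : RSphere → RSphere) (Λ : Set RSphere) (φ : RSphere → ℝ) (m : ℕ)
    (ε : ℝ) : ℝ :=
  ⨆ E : {E : Finset RSphere // IsSepSet g Λ m ε E}, ∑ x ∈ E.1, Real.exp (birkhoff g φ m x)

lemma isSepSet_empty (g : RSphere → RSphere) (Λ : Set RSphere) (m : ℕ) (ε : ℝ) :
    IsSepSet g Λ m ε ∅ := by simp [IsSepSet]

lemma dist_iterate_le {g : RSphere → RSphere} {K : ℝ} (hK : 1 ≤ K)
    (hg : ∀ x y, dist (g x) (g y) ≤ K * dist x y) (n : ℕ) (x y : RSphere) :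
    dist (g^[n] x) (g^[n] y) ≤ K ^ n * dist x y := by
  induction n with
  | zero => simp
  | succ n ih =>
    rw [Function.iterate_succ_apply', Function.iterate_succ_apply', pow_succ', mul_assoc]
    exact (hg _ _).trans (by gcongr)

namespace PressureBounds

variable {g : RSphere → RSphere} {Λ : Set RSphere} {φ : RSphere → ℝ} {K A B B' : ℝ}

lemma sum_le (h : PressureBounds g Λ φ K A B B') {ε : ℝ} (hε : 0 < ε) (m : ℕ)
    {E : Finset RSphere} (hE : IsSepSet g Λ m ε E) :
    ∑ x ∈ E, Real.exp (birkhoff g φ m x) ≤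
      Real.exp ((3 * Real.log (7 / min ε 1) + A) + (3 * Real.log K + B) * m) := by
  have hK := h.one_le
  have hK0 : 0 < K := by linarith
  set e := min ε 1 with he
  have he0 : 0 < e := lt_min hε one_pos
  have hcard : (E.card : ℝ) ≤ (7 / (e / K ^ m)) ^ 3 := by
    refine card_le_of_separated (by positivity) ?_ E fun x hx y hy hne => ?_
    · rw [div_le_one (by positivity)]
      exact (min_le_right _ _).trans (one_le_pow₀ hK)
    · obtain ⟨k, hk, hd⟩ := hE.2 x hx y hy hne
      rw [div_le_iff₀ (by positivity), mul_comm]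
      calc e ≤ ε := min_le_left _ _
        _ ≤ _ := hd
        _ ≤ K ^ k * dist x y := dist_iterate_le hK h.lipschitz k x y
        _ ≤ K ^ m * dist x y := by gcongr
  calc ∑ x ∈ E, Real.exp (birkhoff g φ m x) ≤ ∑ x ∈ E, Real.exp (A + B * m) :=
        Finset.sum_le_sum fun x hx => Real.exp_le_exp.2 (h.upper x (hE.1 hx) m)
    _ = E.card * Real.exp (A + B * m) := by rw [Finset.sum_const, nsmul_eq_mul]
    _ ≤ (7 / (e / K ^ m)) ^ 3 * Real.exp (A + B * m) := by gcongr
    _ = _ := by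
        have h1 : (7 / (e / K ^ m)) ^ 3 =
            Real.exp (3 * Real.log (7 / e) + 3 * Real.log K * m) := by
          have h2 : 3 * Real.log (7 / e) + 3 * Real.log K * m =
              Real.log (7 / (e / K ^ m)) * 3 := by
            rw [show 7 / (e / K ^ m) = 7 / e * K ^ m by field_simp,
              Real.log_mul (by positivity) (by positivity), Real.log_pow]
            ring
          rw [h2, Real.exp_mul, Real.exp_log (by positivity)]
          norm_cast
        rw [h1, ← Real.exp_add]
        congr 1
        ring

lemma bddAbove (h : PressureBounds g Λ φ K A B B') {ε : ℝ} (hε : 0 < ε) (m : ℕ) :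
    BddAbove (range fun E : {E : Finset RSphere // IsSepSet g Λ m ε E} =>
      ∑ x ∈ E.1, Real.exp (birkhoff g φ m x)) :=
  ⟨_, by rintro _ ⟨E, rfl⟩; exact h.sum_le hε m E.2⟩

lemma le_sepSum (h : PressureBounds g Λ φ K A B B') {ε : ℝ} (hε : 0 < ε) (m : ℕ)
    {E : Finset RSphere} (hE : IsSepSet g Λ m ε E) :
    ∑ x ∈ E, Real.exp (birkhoff g φ m x) ≤ sepSum g Λ φ m ε :=
  le_ciSup (h.bddAbove hε m) ⟨E, hE⟩

lemma sepSum_nonneg (h : PressureBounds g Λ φ K A B B') {ε : ℝ} (hε : 0 < ε) (m : ℕ) :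
    0 ≤ sepSum g Λ φ m ε := by
  simpa using h.le_sepSum hε m (isSepSet_empty g Λ m ε)

lemma le_sepSum_of_nonempty (h : PressureBounds g Λ φ K A B B') (hΛ : Λ.Nonempty) {ε : ℝ}
    (hε : 0 < ε) (m : ℕ) : Real.exp (-(A + B' * m)) ≤ sepSum g Λ φ m ε := by
  obtain ⟨x, hx⟩ := hΛ
  have h1 : IsSepSet g Λ m ε {x} := by
    constructor
    · simpa using hx
    · simp
  refine le_trans ?_ (h.le_sepSum hε m h1)
  rw [Finset.sum_singleton]
  exact Real.exp_le_exp.2 (h.lower x hx m)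

lemma sepSum_of_empty (hΛ : Λ = ∅) (m : ℕ) (ε : ℝ) : sepSum g Λ φ m ε = 0 := by
  have : ∀ E : {E : Finset RSphere // IsSepSet g Λ m ε E},
      ∑ x ∈ E.1, Real.exp (birkhoff g φ m x) = 0 := by
    rintro ⟨E, hE⟩
    have h1 := hE.1
    rw [hΛ, subset_empty_iff, Finset.coe_eq_empty] at h1
    simp [h1]
  rw [sepSum]
  simp only [this]
  exact Real.iSup_const_zero

lemma log_sepSum_le (h : PressureBounds g Λ φ K A B B') {ε : ℝ} (hε : 0 < ε) (m : ℕ) :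
    Real.log (sepSum g Λ φ m ε) ≤
      (3 * Real.log (7 / min ε 1) + A) + (3 * Real.log K + B) * m := by
  have h0 : 0 ≤ Real.log (7 / min ε 1) := by
    refine Real.log_nonneg ?_
    rw [one_le_div (lt_min hε one_pos)]
    exact (min_le_right _ _).trans (by norm_num)
  have h1 := Real.log_nonneg h.one_le
  have h2 := h.A_nonneg
  have h3 := h.B_nonneg
  rcases (h.sepSum_nonneg hε m).eq_or_lt with h4 | h4
  · rw [← h4, Real.log_zero]
    positivity
  · rw [Real.log_le_iff_le_exp h4]
    have : Nonempty {E : Finset RSphere // IsSepSet g Λ m ε E} := ⟨⟨∅, isSepSet_empty g Λ m ε⟩⟩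
    exact ciSup_le fun E => h.sum_le hε m E.2

lemma le_log_sepSum (h : PressureBounds g Λ φ K A B B') {ε : ℝ} (hε : 0 < ε) (m : ℕ) :
    -(A + B' * m) ≤ Real.log (sepSum g Λ φ m ε) := by
  rcases Λ.eq_empty_or_nonempty with hΛ | hΛ
  · rw [sepSum_of_empty hΛ, Real.log_zero]
    have h2 := h.A_nonneg
    have h3 := h.B'_nonneg
    have : 0 ≤ A + B' * m := by positivity
    linarith
  · have h1 := h.le_sepSum_of_nonempty hΛ hε m
    rw [Real.le_log_iff_exp_le (lt_of_lt_of_le (Real.exp_pos _) h1)]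
    exact h1

/-- The exponential growth rate of the separated sums at scale `ε`. -/
noncomputable def _root_.sepRate (g : RSphere → RSphere) (Λ : Set RSphere) (φ : RSphere → ℝ)
    (ε : ℝ) : ℝ :=
  limsup (fun m : ℕ => Real.log (sepSum g Λ φ m ε) / m) atTop

lemma _root_.pressureOn_eq_iSup (g : RSphere → RSphere) (Λ : Set RSphere) (φ : RSphere → ℝ) :
    pressureOn g Λ φ = ⨆ ε : {ε : ℝ // 0 < ε}, sepRate g Λ φ ε.1 := rfl

lemma rate_le_of_affine {u : ℕ → ℝ} {C D : ℝ} (hu : ∀ m, u m ≤ C + D * m) {η : ℝ}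
    (hη : 0 < η) : ∀ᶠ m : ℕ in atTop, u m / m ≤ D + η := by
  obtain ⟨N, hN⟩ := exists_nat_gt (C / η)
  filter_upwards [eventually_ge_atTop N, eventually_gt_atTop 0] with m hm hm0
  have hm0' : (0 : ℝ) < m := by exact_mod_cast hm0
  rw [div_le_iff₀ hm0']
  have h1 : C / η < m := hN.trans_le (by exact_mod_cast hm)
  rw [div_lt_iff₀ hη] at h1
  linarith [hu m]

lemma le_rate_of_affine {u : ℕ → ℝ} {C D : ℝ} (hu : ∀ m, -(C + D * m) ≤ u m) {η : ℝ}
    (hη : 0 < η) : ∀ᶠ m : ℕ in atTop, -(D + η) ≤ u m / m := by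
  filter_upwards [rate_le_of_affine (u := fun m => -u m) (C := C) (D := D) (fun m => by linarith [hu m]) hη]
    with m hm
  rw [neg_div] at hm
  linarith

lemma isBoundedUnder (h : PressureBounds g Λ φ K A B B') {ε : ℝ} (hε : 0 < ε) :
    IsBoundedUnder (· ≤ ·) atTop fun m : ℕ => Real.log (sepSum g Λ φ m ε) / m :=
  ⟨_, rate_le_of_affine (fun m => h.log_sepSum_le hε m) one_pos⟩

lemma isCoboundedUnder (h : PressureBounds g Λ φ K A B B') {ε : ℝ} (hε : 0 < ε) :
    IsCoboundedUnder (· ≤ ·) atTop fun m : ℕ => Real.log (sepSum g Λ φ m ε) / m :=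
  IsBoundedUnder.isCoboundedUnder_le
    ⟨_, le_rate_of_affine (fun m => h.le_log_sepSum hε m) one_pos⟩

lemma sepRate_le (h : PressureBounds g Λ φ K A B B') {ε : ℝ} (hε : 0 < ε) :
    sepRate g Λ φ ε ≤ 3 * Real.log K + B :=
  le_of_forall_pos_le_add fun _ hη => limsup_le_of_le (h.isCoboundedUnder hε)
    (rate_le_of_affine (fun m => h.log_sepSum_le hε m) hη)

lemma bddAbove_sepRate (h : PressureBounds g Λ φ K A B B') :
    BddAbove (range fun ε : {ε : ℝ // 0 < ε} => sepRate g Λ φ ε.1) :=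
  ⟨_, by rintro _ ⟨ε, rfl⟩; exact h.sepRate_le ε.2⟩

lemma pressureOn_le (h : PressureBounds g Λ φ K A B B') :
    pressureOn g Λ φ ≤ 3 * Real.log K + B := by
  have : Nonempty {ε : ℝ // 0 < ε} := ⟨⟨1, one_pos⟩⟩
  exact ciSup_le fun ε => h.sepRate_le ε.2

lemma eventually_sum_le (h : PressureBounds g Λ φ K A B B') {p : ℝ}
    (hp : pressureOn g Λ φ < p) {ε : ℝ} (hε : 0 < ε) :
    ∀ᶠ m : ℕ in atTop, ∀ E, IsSepSet g Λ m ε E →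
      ∑ x ∈ E, Real.exp (birkhoff g φ m x) ≤ Real.exp (m * p) := by
  have h1 : sepRate g Λ φ ε < p :=
    lt_of_le_of_lt (le_ciSup h.bddAbove_sepRate ⟨ε, hε⟩) hp
  filter_upwards [eventually_lt_of_limsup_lt h1 (h.isBoundedUnder hε), eventually_gt_atTop 0]
    with m hm hm0 E hE
  have hm0' : (0 : ℝ) < m := by exact_mod_cast hm0
  refine (h.le_sepSum hε m hE).trans ?_
  rcases (h.sepSum_nonneg hε m).eq_or_lt with h4 | h4
  · rw [← h4]
    positivity
  · rw [← Real.log_le_iff_le_exp h4]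
    rw [div_lt_iff₀ hm0'] at hm
    linarith

lemma frequently_lt_sum (h : PressureBounds g Λ φ K A B B') (hΛ : Λ.Nonempty) {p : ℝ}
    (hp : p < pressureOn g Λ φ) : ∃ ε > 0, ∃ᶠ m : ℕ in atTop, ∃ E, IsSepSet g Λ m ε E ∧
      Real.exp (m * p) < ∑ x ∈ E, Real.exp (birkhoff g φ m x) := by
  have : Nonempty {ε : ℝ // 0 < ε} := ⟨⟨1, one_pos⟩⟩
  obtain ⟨⟨ε, hε⟩, h1⟩ := exists_lt_of_lt_ciSup hp
  refine ⟨ε, hε, ?_⟩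
  refine ((frequently_lt_of_lt_limsup (h.isCoboundedUnder hε) h1).and_eventually
    (eventually_gt_atTop 0)).mono fun m ⟨hm, hm0⟩ => ?_
  have hm0' : (0 : ℝ) < m := by exact_mod_cast hm0
  have h2 : 0 < sepSum g Λ φ m ε :=
    lt_of_lt_of_le (Real.exp_pos _) (h.le_sepSum_of_nonempty hΛ hε m)
  have h3 : Real.exp (m * p) < sepSum g Λ φ m ε := by
    rw [← Real.lt_log_iff_exp_lt h2]
    rw [lt_div_iff₀ hm0'] at hm
    linarith
  have : Nonempty {E : Finset RSphere // IsSepSet g Λ m ε E} := ⟨⟨∅, isSepSet_empty g Λ m ε⟩⟩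
  obtain ⟨⟨E, hE⟩, h4⟩ := exists_lt_of_lt_ciSup h3
  exact ⟨E, hE, h4⟩

/-- A lower bound for the pressure from exponential sums along a sequence of times. -/
lemma le_pressureOn_of_frequently (h : PressureBounds g Λ φ K A B B') {ε : ℝ} (hε : 0 < ε)
    {p C : ℝ} (hp : ∃ᶠ m : ℕ in atTop, ∃ E, IsSepSet g Λ m ε E ∧
      Real.exp (m * p + C) ≤ ∑ x ∈ E, Real.exp (birkhoff g φ m x)) : p ≤ pressureOn g Λ φ := by
  by_contra! hcon
  set p' := (pressureOn g Λ φ + p) / 2 with hp'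
  have h1 := h.eventually_sum_le (p := p') (by linarith) hε
  obtain ⟨N, hN⟩ := exists_nat_gt (-C / (p - p'))
  obtain ⟨m, ⟨E, hE, h2⟩, h3, h4⟩ := (hp.and_eventually (h1.and (eventually_ge_atTop N))).exists
  have h5 := Real.exp_le_exp.1 (h2.trans (h3 E hE))
  have h6 : -C / (p - p') < m := hN.trans_le (by exact_mod_cast h4)
  rw [div_lt_iff₀ (by linarith)] at h6
  linarith

end PressureBounds

lemma pressureOn_empty (g : RSphere → RSphere) (φ : RSphere → ℝ) : pressureOn g ∅ φ = 0 := by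
  rw [pressureOn_eq_iSup]
  simp [sepRate, PressureBounds.sepSum_of_empty]

/-! ### Conformal self-maps of the sphere -/

/-- The properties of rational maps which are used below; they are stable under iteration. -/
structure ConformalMap (f : RSphere → RSphere) : Prop where
  analytic : ∀ b z, SphAnalyticAt (fun w => f (chart b w)) z
  smd : ∀ x, HasStrictMetricDerivAt f (sphDeriv f x) x
  nhds_le : ∀ x, sphDeriv f x ≠ 0 → 𝓝 (f x) ≤ map f (𝓝 x)
  finite_fiber : ∀ y, (f ⁻¹' {y}).Finite
  finite_crit : (critSet f).Finite

lemma IsRationalMap.conformalMap {f : RSphere → RSphere} {p q : Polynomial ℂ}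
    (hf : IsRationalMap f p q) (hdeg : 2 ≤ ratDeg p q) : ConformalMap f where
  analytic := hf.sphAnalyticAt hdeg
  smd := hf.hasStrictMetricDerivAt hdeg
  nhds_le _ hx := hf.nhds_le_map hdeg hx
  finite_fiber := hf.finite_fiber hdeg
  finite_crit := hf.finite_critSet hdeg

lemma hasStrictMetricDerivAt_id (x : RSphere) : HasStrictMetricDerivAt id 1 x :=
  fun ε hε => ⟨univ, univ_mem, fun u _ v _ => by simp; positivity⟩

lemma sphDeriv_id (x : RSphere) : sphDeriv id x = 1 := (hasStrictMetricDerivAt_id x).sphDeriv_eq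

namespace ConformalMap

variable {f g : RSphere → RSphere}

lemma continuous (hf : ConformalMap f) : Continuous f :=
  continuous_iff_continuousAt.2 fun x => (hf.smd x).continuousAt

lemma sphDeriv_nonneg (hf : ConformalMap f) (x : RSphere) : 0 ≤ sphDeriv f x :=
  (hf.smd x).nonneg

lemma sphDeriv_comp (hg : ConformalMap g) (hf : ConformalMap f) (x : RSphere) :
    sphDeriv (g ∘ f) x = sphDeriv g (f x) * sphDeriv f x :=
  ((hg.smd (f x)).comp (hf.smd x)).sphDeriv_eq

lemma _root_.conformalMap_id : ConformalMap id where
  analytic b z := ⟨b, fun w => w, analyticAt_id, EventuallyEq.rfl⟩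
  smd x := by
    rw [sphDeriv_id]
    exact hasStrictMetricDerivAt_id x
  nhds_le x _ := by rw [map_id, id_eq]
  finite_fiber y := by simp
  finite_crit := by
    convert finite_empty
    ext x
    simp [critSet, sphDeriv_id]

lemma comp (hg : ConformalMap g) (hf : ConformalMap f) : ConformalMap (g ∘ f) where
  analytic b z := (hf.analytic b z).comp hg.analytic
  smd x := by
    rw [hg.sphDeriv_comp hf]
    exact (hg.smd (f x)).comp (hf.smd x)
  nhds_le x hx := by
    rw [hg.sphDeriv_comp hf] at hx
    rw [← Filter.map_map]
    exact (hg.nhds_le _ (left_ne_zero_of_mul hx)).trans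
      (map_mono (hf.nhds_le _ (right_ne_zero_of_mul hx)))
  finite_fiber y := by
    rw [preimage_comp]
    exact (hg.finite_fiber y).preimage' fun z _ => hf.finite_fiber z
  finite_crit := by
    refine (hf.finite_crit.union (hg.finite_crit.preimage' fun z _ => hf.finite_fiber z)).subset
      fun x hx => ?_
    rw [critSet, mem_ofPred_eq, hg.sphDeriv_comp hf, mul_eq_zero] at hx
    exact hx.symm

lemma iterate (hf : ConformalMap f) (n : ℕ) : ConformalMap f^[n] := by
  induction n with
  | zero => exact conformalMap_id
  | succ n ih => exact ih.comp hf

lemma sphDeriv_iterate_add (hf : ConformalMap f) (m n : ℕ) (x : RSphere) :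
    sphDeriv f^[m + n] x = sphDeriv f^[m] (f^[n] x) * sphDeriv f^[n] x := by
  rw [Function.iterate_add]
  exact (hf.iterate m).sphDeriv_comp (hf.iterate n) x

lemma sphDeriv_iterate_succ (hf : ConformalMap f) (n : ℕ) (x : RSphere) :
    sphDeriv f^[n + 1] x = sphDeriv f (f^[n] x) * sphDeriv f^[n] x := by
  rw [add_comm, hf.sphDeriv_iterate_add, Function.iterate_one]

lemma sphDeriv_iterate_zero (x : RSphere) : sphDeriv f^[0] x = 1 :=
  sphDeriv_id x

lemma sphDeriv_iterate_ne_zero (hf : ConformalMap f) {n : ℕ} {x : RSphere} :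
    sphDeriv f^[n] x ≠ 0 ↔ ∀ k < n, f^[k] x ∉ critSet f := by
  induction n with
  | zero => simp [sphDeriv_id]
  | succ n ih =>
    rw [hf.sphDeriv_iterate_succ, mul_ne_zero_iff, ih, Nat.forall_lt_succ_right, and_comm]
    rfl

lemma log_sphDeriv_iterate (hf : ConformalMap f) {n : ℕ} {x : RSphere}
    (h : sphDeriv f^[n] x ≠ 0) :
    Real.log (sphDeriv f^[n] x) = ∑ k ∈ Finset.range n, Real.log (sphDeriv f (f^[k] x)) := by
  induction n with
  | zero => simp [sphDeriv_id]
  | succ n ih =>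
    rw [hf.sphDeriv_iterate_succ] at h
    rw [hf.sphDeriv_iterate_succ, Real.log_mul (left_ne_zero_of_mul h) (right_ne_zero_of_mul h),
      ih (right_ne_zero_of_mul h), Finset.sum_range_succ, add_comm]

lemma continuous_sphDeriv (hf : ConformalMap f) : Continuous (sphDeriv f) := by
  rw [continuous_iff_continuousAt]
  intro x
  rw [ContinuousAt, Metric.tendsto_nhds]
  intro ε hε
  obtain ⟨U, hU, H⟩ := hf.smd x (ε / 2) (by positivity)
  filter_upwards [eventually_mem_nhds_iff.2 hU] with u hu
  have h1 : ∀ᶠ y in 𝓝[≠] u, |dist (f y) (f u) / dist y u - sphDeriv f x| ≤ ε / 2 := by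
    filter_upwards [mem_nhdsWithin_of_mem_nhds hu, self_mem_nhdsWithin] with y hy hne
    have h2 : 0 < dist y u := dist_pos.2 hne
    have h3 := H y hy u (mem_of_mem_nhds hu)
    rw [show dist (f y) (f u) / dist y u - sphDeriv f x =
      (dist (f y) (f u) - sphDeriv f x * dist y u) / dist y u by field_simp, abs_div,
      abs_of_pos h2, div_le_iff₀ h2]
    exact h3
  have h4 := ((hf.smd u).tendsto_ratio.sub_const (sphDeriv f x)).abs
  have h5 := le_of_tendsto h4 h1
  rw [Real.dist_eq]
  linarith

lemma exists_lipschitz (hf : ConformalMap f) :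
    ∃ K : ℝ, 1 ≤ K ∧ ∀ x y, dist (f x) (f y) ≤ K * dist x y := by
  have h1 : LocallyLipschitzOn univ f := by
    intro x _
    obtain ⟨U, hU, H⟩ := (hf.smd x).exists_lipschitz (K := sphDeriv f x + 1) (by linarith)
    refine ⟨⟨sphDeriv f x + 1, by linarith [hf.sphDeriv_nonneg x]⟩, U,
      mem_nhdsWithin_of_mem_nhds hU, LipschitzOnWith.of_dist_le_mul fun u hu v hv => H u hu v hv⟩
  obtain ⟨K, hK⟩ := h1.exists_lipschitzOnWith_of_compact isCompact_univ
  refine ⟨max K 1, le_max_right _ _, fun x y => ?_⟩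
  refine (hK.dist_le_mul x trivial y trivial).trans ?_
  gcongr
  exact le_max_left _ _

lemma sphDeriv_le (hf : ConformalMap f) {K : ℝ} {x : RSphere} {U : Set RSphere} (hU : U ∈ 𝓝 x)
    (hK : ∀ u ∈ U, ∀ v ∈ U, dist (f u) (f v) ≤ K * dist u v) : sphDeriv f x ≤ K := by
  refine le_of_tendsto (hf.smd x).tendsto_ratio ?_
  filter_upwards [mem_nhdsWithin_of_mem_nhds hU, self_mem_nhdsWithin] with y hy hne
  rw [div_le_iff₀ (dist_pos.2 hne)]
  exact hK y hy x (mem_of_mem_nhds hU)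

lemma sphDeriv_iterate_le (hf : ConformalMap f) {K : ℝ} (hK1 : 1 ≤ K)
    (hK : ∀ x y, dist (f x) (f y) ≤ K * dist x y) (n : ℕ) (x : RSphere) :
    sphDeriv f^[n] x ≤ K ^ n :=
  (hf.iterate n).sphDeriv_le univ_mem fun u _ v _ => dist_iterate_le hK1 hK n u v

end ConformalMap

/-! ### The geometric potentials -/

/-- The geometric potential `-d log |f'|`. -/
noncomputable abbrev geomPot (f : RSphere → RSphere) (d : ℝ) : RSphere → ℝ :=
  fun x => -d * Real.log (sphDeriv f x)

/-- The normalized pressure of the geometric potential on an `f^a`-invariant set. -/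
noncomputable def normPress (f : RSphere → RSphere) (a : ℕ) (Λ : Set RSphere) (d : ℝ) : ℝ :=
  pressureOn f^[a] Λ (birkhoff f (geomPot f d) a) / a

lemma birkhoff_birkhoff (f : RSphere → RSphere) (φ : RSphere → ℝ) (a m : ℕ) (x : RSphere) :
    birkhoff f^[a] (birkhoff f φ a) m x = birkhoff f φ (a * m) x := by
  induction m with
  | zero => simp [birkhoff]
  | succ m ih =>
    rw [Nat.mul_succ, birkhoff, Finset.sum_range_succ]
    change birkhoff f^[a] (birkhoff f φ a) m x + _ = _
    rw [ih, birkhoff, birkhoff, birkhoff, Finset.sum_range_add, ← Function.iterate_mul]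
    simp only [add_comm (a * m), Function.iterate_add_apply]

lemma normPress_one (f : RSphere → RSphere) (Λ : Set RSphere) (d : ℝ) :
    normPress f 1 Λ d = pressureOn f Λ (geomPot f d) := by
  have : birkhoff f (geomPot f d) 1 = geomPot f d := by
    ext x
    simp [birkhoff]
  rw [normPress, this, Function.iterate_one, Nat.cast_one, div_one]

lemma normPress_empty (f : RSphere → RSphere) (a : ℕ) (d : ℝ) : normPress f a ∅ d = 0 := by
  rw [normPress, pressureOn_empty, zero_div]

lemma ExpandingOn.exists_forall {g : RSphere → RSphere} {Λ : Set RSphere}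
    (h : ExpandingOn g Λ) : ∃ c : ℝ, 0 < c ∧ ∃ l : ℝ, 1 < l ∧
      ∀ x ∈ Λ, ∀ m : ℕ, c * l ^ m ≤ sphDeriv g^[m] x := by
  obtain ⟨c, hc, l, hl, H⟩ := h
  refine ⟨min c 1, lt_min hc one_pos, l, hl, fun x hx m => ?_⟩
  rcases Nat.eq_zero_or_pos m with rfl | hm
  · rw [pow_zero, mul_one, ConformalMap.sphDeriv_iterate_zero]
    exact min_le_right _ _
  · refine le_trans ?_ (H x hx m hm)
    gcongr
    exact min_le_left _ _

namespace ConformalMap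

variable {f : RSphere → RSphere} {K : ℝ} {a : ℕ} {Λ : Set RSphere}

lemma birkhoff_geomPot (hf : ConformalMap f) (d : ℝ) {n : ℕ} {x : RSphere}
    (h : sphDeriv f^[n] x ≠ 0) :
    birkhoff f (geomPot f d) n x = -d * Real.log (sphDeriv f^[n] x) := by
  rw [hf.log_sphDeriv_iterate h, birkhoff, Finset.mul_sum]

/-- On an expanding set, the Birkhoff sums are multiples of a function bounded below. -/
lemma exists_log_bounds (hf : ConformalMap f) (hK1 : 1 ≤ K)
    (hK : ∀ x y, dist (f x) (f y) ≤ K * dist x y) (hΛ : ExpandingOn f^[a] Λ) :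
    ∃ A : ℝ, 0 ≤ A ∧ ∃ w : ℕ → RSphere → ℝ, ∀ x ∈ Λ, ∀ m, -A ≤ w m x ∧
      w m x ≤ a * Real.log K * m ∧
      ∀ d, birkhoff f^[a] (birkhoff f (geomPot f d) a) m x = -d * w m x := by
  obtain ⟨c, hc, l, hl, H⟩ := hΛ.exists_forall
  refine ⟨|Real.log c|, abs_nonneg _, fun m x => Real.log (sphDeriv f^[a * m] x),
    fun x hx m => ?_⟩
  have h1 := H x hx m
  rw [← Function.iterate_mul] at h1
  have h2 : c ≤ sphDeriv f^[a * m] x :=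
    le_trans (le_mul_of_one_le_right hc.le (one_le_pow₀ hl.le)) h1
  refine ⟨(neg_abs_le _).trans (Real.log_le_log hc h2), ?_, fun d => ?_⟩
  · refine (Real.log_le_log (hc.trans_le h2) (hf.sphDeriv_iterate_le hK1 hK _ _)).trans ?_
    rw [Real.log_pow]
    push_cast
    linarith
  · rw [birkhoff_birkhoff, hf.birkhoff_geomPot d (hc.trans_le h2).ne']

lemma pressureBounds (hf : ConformalMap f) (hK1 : 1 ≤ K)
    (hK : ∀ x y, dist (f x) (f y) ≤ K * dist x y) (hΛ : ExpandingOn f^[a] Λ) (d : ℝ) :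
    ∃ A, PressureBounds f^[a] Λ (birkhoff f (geomPot f d) a) (K ^ a) A
      (max 0 (-d) * (a * Real.log K)) (max 0 d * (a * Real.log K)) := by
  obtain ⟨A, hA, w, hw⟩ := hf.exists_log_bounds hK1 hK hΛ
  have hlog := Real.log_nonneg hK1
  refine ⟨|d| * A, one_le_pow₀ hK1, fun x y => dist_iterate_le hK1 hK a x y, by positivity,
    by positivity, by positivity, fun x hx m => ?_, fun x hx m => ?_⟩
  all_goals
    obtain ⟨h1, h2, h3⟩ := hw x hx m
    have h4 : 0 ≤ a * Real.log K * m := by positivity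
    rw [h3 d]
    rcases le_total 0 d with hd | hd
  · rw [max_eq_left (by linarith), abs_of_nonneg hd]
    nlinarith
  · rw [max_eq_right (by linarith), abs_of_nonpos hd]
    nlinarith
  · rw [max_eq_right (by linarith), abs_of_nonneg hd]
    nlinarith
  · rw [max_eq_left (by linarith), abs_of_nonpos hd]
    nlinarith

lemma normPress_le (hf : ConformalMap f) (hK1 : 1 ≤ K)
    (hK : ∀ x y, dist (f x) (f y) ≤ K * dist x y) (ha : 0 < a) (hΛ : ExpandingOn f^[a] Λ)
    (d : ℝ) : normPress f a Λ d ≤ (3 + max 0 (-d)) * Real.log K := by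
  obtain ⟨A, h⟩ := hf.pressureBounds hK1 hK hΛ d
  have ha' : (0 : ℝ) < a := by exact_mod_cast ha
  rw [normPress, div_le_iff₀ ha']
  refine h.pressureOn_le.trans (le_of_eq ?_)
  rw [Real.log_pow]
  ring

lemma antitone_normPress (hf : ConformalMap f) (hΛ : ExpandingOn f^[a] Λ) :
    Antitone (normPress f a Λ) := by
  intro d d' hd
  rw [normPress, normPress]
  gcongr
  rcases Λ.eq_empty_or_nonempty with rfl | hne
  · rw [pressureOn_empty, pressureOn_empty]
  obtain ⟨K, hK1, hK⟩ := hf.exists_lipschitz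
  obtain ⟨_, h⟩ := hf.pressureBounds hK1 hK hΛ d
  obtain ⟨_, h'⟩ := hf.pressureBounds hK1 hK hΛ d'
  obtain ⟨A, hA, w, hw⟩ := hf.exists_log_bounds hK1 hK hΛ
  refine le_of_forall_lt fun p hp => ?_
  obtain ⟨p', hpp', hp'⟩ := exists_between hp
  refine hpp'.trans_le ?_
  obtain ⟨ε, hε, hfreq⟩ := h'.frequently_lt_sum hne hp'
  refine h.le_pressureOn_of_frequently hε (C := -((d' - d) * A)) (hfreq.mono ?_)
  rintro m ⟨E, hE, hsum⟩
  refine ⟨E, hE, ?_⟩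
  rw [Real.exp_add, mul_comm]
  refine (mul_le_mul_of_nonneg_left hsum.le (Real.exp_pos _).le).trans ?_
  rw [Finset.mul_sum]
  refine Finset.sum_le_sum fun x hx => ?_
  rw [← Real.exp_add, Real.exp_le_exp]
  obtain ⟨h1, h2, h3⟩ := hw x (hE.1 hx) m
  rw [h3, h3]
  nlinarith

lemma convexOn_normPress (hf : ConformalMap f) (ha : 0 < a) (hΛ : ExpandingOn f^[a] Λ) :
    ConvexOn ℝ univ (normPress f a Λ) := by
  rcases Λ.eq_empty_or_nonempty with rfl | hne
  · have : normPress f a ∅ = fun _ => 0 := funext (normPress_empty f a)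
    rw [this]
    exact convexOn_const 0 convex_univ
  obtain ⟨K, hK1, hK⟩ := hf.exists_lipschitz
  obtain ⟨A, hA, w, hw⟩ := hf.exists_log_bounds hK1 hK hΛ
  refine ⟨convex_univ, fun d _ d' _ s t hs ht hst => ?_⟩
  have ha' : (0 : ℝ) < a := by exact_mod_cast ha
  simp only [normPress, smul_eq_mul]
  rw [← mul_div_assoc, ← mul_div_assoc, ← add_div]
  gcongr
  obtain ⟨_, h⟩ := hf.pressureBounds hK1 hK hΛ d
  obtain ⟨_, h'⟩ := hf.pressureBounds hK1 hK hΛ d'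
  obtain ⟨_, h''⟩ := hf.pressureBounds hK1 hK hΛ (s * d + t * d')
  refine le_of_forall_pos_le_add fun η hη => ?_
  refine le_of_forall_lt fun p hp => ?_
  obtain ⟨ε, hε, hfreq⟩ := h''.frequently_lt_sum hne hp
  set p₁ := pressureOn f^[a] Λ (birkhoff f (geomPot f d) a) with hp₁
  set p₂ := pressureOn f^[a] Λ (birkhoff f (geomPot f d') a) with hp₂
  obtain ⟨m, ⟨E, hE, hsum⟩, h1, h2, hm⟩ := (hfreq.and_eventually
    ((h.eventually_sum_le (p := p₁ + η) (by linarith) hε).and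
      ((h'.eventually_sum_le (p := p₂ + η) (by linarith) hε).and (eventually_gt_atTop 0)))).exists
  have hm' : (0 : ℝ) < m := by exact_mod_cast hm
  have key : ∑ x ∈ E, Real.exp (birkhoff f^[a] (birkhoff f (geomPot f (s * d + t * d')) a) m x -
      m * (s * p₁ + t * p₂ + η)) ≤ 1 := by
    have hsplit : ∀ {u : ℝ} {v : RSphere → ℝ}, ∑ x ∈ E, Real.exp (v x) ≤ Real.exp (m * u) →
        ∑ x ∈ E, Real.exp (v x - m * u) ≤ 1 := by
      intro u v huv
      simp only [Real.exp_sub, ← Finset.sum_div]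
      exact div_le_one_of_le₀ huv (Real.exp_pos _).le
    have h1' := hsplit (h1 E hE)
    have h2' := hsplit (h2 E hE)
    calc _ ≤ ∑ x ∈ E, (s * Real.exp (birkhoff f^[a] (birkhoff f (geomPot f d) a) m x -
            m * (p₁ + η)) + t * Real.exp (birkhoff f^[a] (birkhoff f (geomPot f d') a) m x -
            m * (p₂ + η))) := by
          refine Finset.sum_le_sum fun x hx => ?_
          have h5 := convexOn_exp.2 (mem_univ (birkhoff f^[a] (birkhoff f (geomPot f d) a) m x -
            m * (p₁ + η))) (mem_univ (birkhoff f^[a] (birkhoff f (geomPot f d') a) m x -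
            m * (p₂ + η))) hs ht hst
          simp only [smul_eq_mul] at h5
          refine le_trans (le_of_eq ?_) h5
          obtain ⟨-, -, h3⟩ := hw x (hE.1 hx) m
          rw [h3, h3, h3]
          congr 1
          linear_combination (m * η) * hst
      _ ≤ s * 1 + t * 1 := by
          rw [Finset.sum_add_distrib, ← Finset.mul_sum, ← Finset.mul_sum]
          gcongr
      _ = 1 := by linarith
  simp only [Real.exp_sub, ← Finset.sum_div] at key
  rw [div_le_one (Real.exp_pos _)] at key
  have h6 := Real.exp_lt_exp.1 (hsum.trans_le key)
  exact lt_of_mul_lt_mul_left h6 hm'.le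

end ConformalMap

/-! ### Expanding sets -/

namespace ConformalMap

variable {f : RSphere → RSphere} {a : ℕ} {Λ L : Set RSphere}

/-- Uniformly contracting inverse branches along an expanding set. -/
lemma exists_branches (hf : ConformalMap f) (hL : IsCompact L) (hfL : MapsTo f L L)
    (hexp : ExpandingOn f L) : ∃ N > 0, ∃ r > 0, (∀ x ∈ L, 2 < sphDeriv f^[N] x) ∧
      ∀ k, ∀ x ∈ L, ∃ h : RSphere → RSphere, h (f^[N * k] x) = x ∧
      (∀ u ∈ ball (f^[N * k] x) r, f^[N * k] (h u) = u) ∧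
      (∀ u ∈ ball (f^[N * k] x) r, ∀ v ∈ ball (f^[N * k] x) r,
        dist (h u) (h v) ≤ (1 / 2) ^ k * dist u v) ∧
      ∀ u ∈ ball (f^[N * k] x) r, ∀ i ≤ k,
        dist (f^[N * i] (h u)) (f^[N * i] x) ≤ (1 / 2) ^ (k - i) * dist u (f^[N * k] x) := by
  obtain ⟨c, hc, l, hl, H⟩ := hexp
  obtain ⟨N, hN1, hN⟩ : ∃ N, 0 < N ∧ 2 / c < l ^ N :=
    ((eventually_gt_atTop 0).and
      ((tendsto_pow_atTop_atTop_of_one_lt hl).eventually_gt_atTop _)).exists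
  have hD : ∀ x ∈ L, 2 < sphDeriv f^[N] x := fun x hx => by
    rw [div_lt_iff₀ hc] at hN
    linarith [H x hx N hN1]
  obtain ⟨r, hr, Hr⟩ := exists_uniform_branch hL (fun x _ => (hf.iterate N).smd x) hD
    fun x hx => (hf.iterate N).nhds_le x (by linarith [hD x hx])
  refine ⟨N, hN1, r, hr, hD, fun k => ?_⟩
  have := exists_iterated_branch (hfL.iterate N) Hr k
  simpa only [← Function.iterate_mul] using this

/-- Compact expanding invariant sets lie in the Julia set. -/
lemma subset_juliaSet (hf : ConformalMap f) (hL : IsCompact L) (hfL : MapsTo f L L)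
    (hexp : ExpandingOn f L) : L ⊆ juliaSet f := by
  rintro x hx ⟨U, hU, hxU, heq⟩
  obtain ⟨N, hN, r, hr, -, H⟩ := hf.exists_branches hL hfL hexp
  obtain ⟨y, -, φ, hφ, hlim⟩ :=
    (isCompact_univ (X := RSphere)).tendsto_subseq (x := fun k => f^[N * k] x) fun _ => trivial
  obtain ⟨y', hy', hne⟩ : ∃ y' ∈ ball y (r / 2), y' ≠ y := by
    have h1 : ∀ᶠ z in 𝓝[≠] y, z ∈ ball y (r / 2) ∧ z ≠ y :=
      Filter.Eventually.and (mem_nhdsWithin_of_mem_nhds (ball_mem_nhds y (by positivity)))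
        self_mem_nhdsWithin
    exact h1.exists
  have hd : 0 < dist y' y := dist_pos.2 hne
  have h2 := heq x hxU _ (Metric.dist_mem_uniformity (half_pos hd))
  rw [hU.nhdsWithin_eq hxU, Metric.eventually_nhds_iff] at h2
  obtain ⟨δ, hδ, h3⟩ := h2
  have hlim0 : Tendsto (fun j => (1 / 2 : ℝ) ^ φ j * r) atTop (𝓝 0) := by
    simpa using (((tendsto_pow_atTop_nhds_zero_of_lt_one (by norm_num : (0 : ℝ) ≤ 1 / 2)
      (by norm_num)).comp hφ.tendsto_atTop).mul_const r)
  obtain ⟨j, hj1, hj2⟩ := ((hlim0.eventually_lt_const hδ).and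
    (hlim.eventually (ball_mem_nhds y (half_pos hr)))).exists
  obtain ⟨h, hh1, hh2, hh3, -⟩ := H (φ j) x hx
  have hj2' : dist (f^[N * φ j] x) y < r / 2 := hj2
  have hclose : ∀ z ∈ ball y (r / 2), dist (f^[N * φ j] x) z < dist y' y / 2 := by
    intro z hz
    have hz' : z ∈ ball (f^[N * φ j] x) r := by
      rw [mem_ball] at hz ⊢
      rw [dist_comm] at hj2'
      linarith [dist_triangle z y (f^[N * φ j] x)]
    have h4 := hh3 z hz' _ (mem_ball_self hr)
    rw [hh1] at h4
    have h5 : dist (h z) x < δ := by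
      refine lt_of_le_of_lt (h4.trans ?_) hj1
      gcongr
      exact (mem_ball.1 hz').le
    have h6 := h3 h5 (N * φ j)
    change dist (f^[N * φ j] x) (f^[N * φ j] (h z)) < _ at h6
    rwa [hh2 z hz'] at h6
  have h7 := hclose y' hy'
  have h8 := hclose y (mem_ball_self (by positivity))
  rw [dist_comm] at h7
  linarith [dist_triangle y' (f^[N * φ j] x) y]

/-- The `f`-invariant set generated by an `f^a`-invariant set. -/
def _root_.saturation (f : RSphere → RSphere) (a : ℕ) (Λ : Set RSphere) : Set RSphere :=
  ⋃ k ∈ Finset.range a, f^[k] '' Λ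

lemma _root_.subset_saturation (ha : 0 < a) : Λ ⊆ saturation f a Λ := fun x hx =>
  mem_biUnion (Finset.mem_coe.2 (Finset.mem_range.2 ha)) ⟨x, hx, rfl⟩

lemma isCompact_saturation (hf : ConformalMap f) (hΛ : IsCompact Λ) :
    IsCompact (saturation f a Λ) :=
  (Finset.range a).isCompact_biUnion fun k _ => hΛ.image (hf.iterate k).continuous

lemma _root_.image_saturation (ha : 0 < a) (h : f^[a] '' Λ = Λ) :
    f '' saturation f a Λ = saturation f a Λ := by
  apply Subset.antisymm
  · rintro _ ⟨_, hx, rfl⟩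
    simp only [saturation, mem_iUnion, Finset.mem_range] at hx ⊢
    obtain ⟨k, hk, x, hx, rfl⟩ := hx
    rcases Nat.lt_or_ge (k + 1) a with h1 | h1
    · exact ⟨k + 1, h1, x, hx, Function.iterate_succ_apply' _ _ _⟩
    · refine ⟨0, ha, f^[a] x, h ▸ mem_image_of_mem _ hx, ?_⟩
      rw [show a = k + 1 by omega, Function.iterate_succ_apply']
      rfl
  · intro y hy
    simp only [saturation, mem_iUnion, Finset.mem_range] at hy
    obtain ⟨k, hk, x, hx, rfl⟩ := hy
    rcases Nat.eq_zero_or_pos k with rfl | hk0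
    · rw [← h] at hx
      obtain ⟨z, hz, rfl⟩ := hx
      refine ⟨f^[a - 1] z, mem_biUnion (Finset.mem_coe.2 (Finset.mem_range.2 (by omega)))
        ⟨z, hz, rfl⟩, ?_⟩
      rw [← Function.iterate_succ_apply' f, Nat.succ_eq_add_one, Nat.sub_add_cancel ha]
      rfl
    · refine ⟨f^[k - 1] x, mem_biUnion (Finset.mem_coe.2 (Finset.mem_range.2 (by omega)))
        ⟨x, hx, rfl⟩, ?_⟩
      rw [← Function.iterate_succ_apply' f, Nat.succ_eq_add_one, Nat.sub_add_cancel hk0]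

lemma expandingOn_saturation (hf : ConformalMap f) (ha : 0 < a) (hΛ : ExpandingOn f^[a] Λ) :
    ExpandingOn f (saturation f a Λ) := by
  obtain ⟨c, hc, l, hl, H⟩ := hΛ.exists_forall
  obtain ⟨K, hK1, hK⟩ := hf.exists_lipschitz
  have hK0 : 0 < K := by linarith
  have hl0 : 0 < l := by linarith
  have ha' : (a : ℝ) ≠ 0 := by exact_mod_cast ha.ne'
  set l' := l ^ (1 / a : ℝ) with hl'
  have hl'1 : 1 < l' := Real.one_lt_rpow hl (by positivity)
  have hpow : l' ^ a = l := by
    rw [hl', ← Real.rpow_natCast, ← Real.rpow_mul hl0.le, one_div_mul_cancel ha', Real.rpow_one]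
  refine ⟨c / K ^ (2 * a), by positivity, l', hl'1, fun x hx n hn => ?_⟩
  simp only [saturation, mem_iUnion, Finset.mem_range] at hx
  obtain ⟨k, hk, y, hy, rfl⟩ := hx
  set q := (n + k) / a + 1 with hq
  have hqa : n + k ≤ a * q ∧ a * q ≤ n + k + a := by
    have h1 := Nat.div_add_mod (n + k) a
    have h2 := Nat.mod_lt (n + k) ha
    constructor <;> rw [hq, Nat.mul_succ] <;> omega
  have h1 := H y hy q
  rw [← Function.iterate_mul, show a * q = (a * q - (n + k)) + (n + k) by omega,
    hf.sphDeriv_iterate_add, hf.sphDeriv_iterate_add] at h1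
  have h2 := hf.sphDeriv_iterate_le hK1 hK (a * q - (n + k)) (f^[n + k] y)
  have h3 := hf.sphDeriv_iterate_le hK1 hK k y
  have h4 := (hf.iterate n).sphDeriv_nonneg (f^[k] y)
  have h5 : c * l' ^ n ≤ K ^ (2 * a) * sphDeriv f^[n] (f^[k] y) := by
    calc c * l' ^ n ≤ c * l' ^ (a * q) := by
          gcongr
          · exact hl'1.le
          · omega
      _ = c * l ^ q := by rw [pow_mul, hpow]
      _ ≤ _ := h1
      _ ≤ K ^ (a * q - (n + k)) * (sphDeriv f^[n] (f^[k] y) * K ^ k) := by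
          refine mul_le_mul h2 ?_ (mul_nonneg h4 ((hf.iterate k).sphDeriv_nonneg _)) (by positivity)
          gcongr
      _ = K ^ (a * q - (n + k) + k) * sphDeriv f^[n] (f^[k] y) := by ring
      _ ≤ _ := by
          refine mul_le_mul_of_nonneg_right (pow_le_pow_right₀ hK1 ?_) h4
          omega
  rw [div_mul_eq_mul_div, div_le_iff₀ (by positivity)]
  linarith

/-- The compact invariant expanding sets over which the pressure is a supremum. -/
def _root_.IsExpandingSet (f : RSphere → RSphere) (L : Set RSphere) : Prop :=
  L.Nonempty ∧ L ⊆ juliaSet f ∧ IsCompact L ∧ f '' L = L ∧ ExpandingOn f L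

lemma isExpandingSet_saturation (hf : ConformalMap f) (ha : 0 < a) (hne : Λ.Nonempty)
    (hc : IsCompact Λ) (him : f^[a] '' Λ = Λ) (hΛ : ExpandingOn f^[a] Λ) :
    IsExpandingSet f (saturation f a Λ) := by
  have h1 := image_saturation ha him
  have h2 := hf.isCompact_saturation (a := a) hc
  have h3 := hf.expandingOn_saturation ha hΛ
  exact ⟨hne.mono (subset_saturation ha), hf.subset_juliaSet h2 (mapsTo_iff_image_subset.2 h1.subset) h3,
    h2, h1, h3⟩

lemma normPress_le_saturation (hf : ConformalMap f) (ha : 0 < a) (hne : Λ.Nonempty)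
    (hΛ : ExpandingOn f^[a] Λ) (d : ℝ) :
    normPress f a Λ d ≤ normPress f 1 (saturation f a Λ) d := by
  obtain ⟨K, hK1, hK⟩ := hf.exists_lipschitz
  obtain ⟨_, h⟩ := hf.pressureBounds hK1 hK hΛ d
  have h3 := hf.expandingOn_saturation ha hΛ
  rw [← Function.iterate_one f] at h3
  obtain ⟨_, h'⟩ := hf.pressureBounds hK1 hK h3 d
  have ha' : (0 : ℝ) < a := by exact_mod_cast ha
  refine le_of_forall_lt fun p hp => ?_
  obtain ⟨p', hpp', hp'⟩ := exists_between hp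
  refine hpp'.trans_le ?_
  rw [normPress, lt_div_iff₀ ha'] at hp'
  rw [normPress, Nat.cast_one, div_one]
  obtain ⟨ε, hε, hfreq⟩ := h.frequently_lt_sum hne hp'
  refine h'.le_pressureOn_of_frequently hε (C := 0)
    (Tendsto.frequently (f := fun m => a * m) (tendsto_id.const_mul_atTop' ha) (hfreq.mono ?_))
  rintro m ⟨E, hE, hsum⟩
  refine ⟨E, ⟨hE.1.trans (subset_saturation ha), fun x hx y hy hne => ?_⟩, ?_⟩
  · obtain ⟨k, hk, hd⟩ := hE.2 x hx y hy hne
    refine ⟨a * k, Nat.mul_lt_mul_of_pos_left hk ha, ?_⟩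
    rwa [Function.iterate_one, Function.iterate_mul]
  · simp only [birkhoff_birkhoff, one_mul] at hsum ⊢
    refine le_trans (le_of_eq ?_) hsum.le
    push_cast
    ring_nf

lemma _root_.pressFamily_eq_iSup (f : RSphere → RSphere) (d : ℝ) :
    pressFamily f d = ⨆ L : {L : Set RSphere // IsExpandingSet f L}, normPress f 1 L.1 d := by
  simp only [normPress_one]
  rfl

lemma pressFamily_le (hf : ConformalMap f) {K : ℝ} (hK1 : 1 ≤ K)
    (hK : ∀ x y, dist (f x) (f y) ≤ K * dist x y) (hL : IsExpandingSet f L) (d : ℝ) :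
    pressFamily f d ≤ (3 + max 0 (-d)) * Real.log K := by
  have : Nonempty {L : Set RSphere // IsExpandingSet f L} := ⟨⟨L, hL⟩⟩
  rw [pressFamily_eq_iSup]
  exact ciSup_le fun L => hf.normPress_le hK1 hK one_pos L.2.2.2.2.2 d

lemma normPress_one_le_pressFamily (hf : ConformalMap f) (hL : IsExpandingSet f L) (d : ℝ) :
    normPress f 1 L d ≤ pressFamily f d := by
  obtain ⟨K, hK1, hK⟩ := hf.exists_lipschitz
  rw [pressFamily_eq_iSup]
  exact le_ciSup (f := fun L : {L : Set RSphere // IsExpandingSet f L} => normPress f 1 L.1 d)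
    ⟨_, by rintro _ ⟨L, rfl⟩; exact hf.normPress_le hK1 hK one_pos L.2.2.2.2.2 d⟩ ⟨L, hL⟩

lemma normPress_le_pressFamily (hf : ConformalMap f) (ha : 0 < a) (hne : Λ.Nonempty)
    (hc : IsCompact Λ) (him : f^[a] '' Λ = Λ) (hΛ : ExpandingOn f^[a] Λ) (d : ℝ) :
    normPress f a Λ d ≤ pressFamily f d :=
  (hf.normPress_le_saturation ha hne hΛ d).trans
    (hf.normPress_one_le_pressFamily (hf.isExpandingSet_saturation ha hne hc him hΛ) d)

end ConformalMap

/-! ### Backward orbits -/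

/-- The points with an iterate equal to `x`, along an orbit without critical points. -/
def backTree (f : RSphere → RSphere) (x : RSphere) : Set RSphere :=
  {y | ∃ n, f^[n] y = x ∧ sphDeriv f^[n] y ≠ 0}

namespace ConformalMap

variable {f : RSphere → RSphere} {L L' : Set RSphere} {x y z w : RSphere}

lemma _root_.self_mem_backTree : x ∈ backTree f x :=
  ⟨0, rfl, by simp [sphDeriv_id]⟩

lemma backTree_trans (hf : ConformalMap f) (hz : z ∈ backTree f y) (hy : y ∈ backTree f x) :
    z ∈ backTree f x := by
  obtain ⟨n, rfl, hn⟩ := hz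
  obtain ⟨m, rfl, hm⟩ := hy
  refine ⟨m + n, Function.iterate_add_apply _ _ _ _, ?_⟩
  rw [hf.sphDeriv_iterate_add]
  exact mul_ne_zero hm hn

lemma mem_backTree_of_apply (hf : ConformalMap f) (h : f y ∈ backTree f x)
    (hy : y ∉ critSet f) : y ∈ backTree f x :=
  hf.backTree_trans ⟨1, rfl, by rwa [Function.iterate_one]⟩ h

lemma mem_backTree_cases (hf : ConformalMap f) (h : y ∈ backTree f x) :
    y = x ∨ f y ∈ backTree f x ∧ y ∉ critSet f := by
  obtain ⟨n, hn, hd⟩ := h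
  cases n with
  | zero => exact Or.inl hn
  | succ n =>
    rw [hf.sphDeriv_iterate_add, Function.iterate_one, mul_ne_zero_iff] at hd
    exact Or.inr ⟨⟨n, hn, hd.1⟩, hd.2⟩

lemma not_mem_critSet (hexp : ExpandingOn f L) (hx : x ∈ L) : x ∉ critSet f := by
  obtain ⟨c, hc, l, hl, H⟩ := hexp
  have h1 := H x hx 1 le_rfl
  rw [Function.iterate_one] at h1
  intro h2
  rw [critSet, mem_ofPred_eq] at h2
  rw [h2] at h1
  have : 0 < c * l ^ 1 := by positivity
  linarith

lemma infinite_backTree (hf : ConformalMap f)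
    (hexc : ¬ IsExceptional f ∨ maxExceptional f ∩ juliaSet f = ∅) (hL : IsExpandingSet f L)
    (hx : x ∈ L) : (backTree f x).Infinite := by
  intro hfin
  have hcrit := fun z (hz : z ∈ L) => not_mem_critSet hL.2.2.2.2 hz
  have hsub : ∀ n, ∃ y ∈ L, f^[n] y = x := by
    intro n
    have h1 : f^[n] '' L = L := by
      induction n with
      | zero => simp
      | succ n ih => rw [Function.iterate_succ, image_comp, hL.2.2.2.1, ih]
    rw [← h1] at hx
    obtain ⟨y, hy, hyx⟩ := hx
    exact ⟨y, hy, hyx⟩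
  have hper : ∃ p, f^[p] x ∈ backTree f x ∧ 0 < p ∧ f^[p] x = x := by
    choose y hyL hy using hsub
    have hyS : ∀ n, y n ∈ backTree f x := fun n =>
      ⟨n, hy n, hf.sphDeriv_iterate_ne_zero.2 fun k _ => hcrit _
        ((mapsTo_iff_image_subset.2 hL.2.2.2.1.subset).iterate k (hyL n))⟩
    obtain ⟨m, -, n, -, hmn, heq⟩ := infinite_univ.exists_lt_map_eq_of_mapsTo
      (f := y) (t := backTree f x) (fun n _ => hyS n) hfin
    have h2 : f^[n - m] x = x := by
      have h3 := hy n
      rw [← heq, show n = (n - m) + m by omega, Function.iterate_add_apply, hy m] at h3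
      exact h3
    exact ⟨n - m, h2.symm ▸ self_mem_backTree, by omega, h2⟩
  obtain ⟨p, -, hp, hpx⟩ := hper
  have hfx : f x ∈ backTree f x := by
    refine ⟨p - 1, ?_, hf.sphDeriv_iterate_ne_zero.2 fun k _ => hcrit _ ?_⟩
    · rw [← Function.iterate_succ_apply, Nat.succ_eq_add_one, Nat.sub_add_cancel hp, hpx]
    · exact (mapsTo_iff_image_subset.2 hL.2.2.2.1.subset).iterate k
        (hL.2.2.2.1 ▸ mem_image_of_mem f hx)
  have hS : f ⁻¹' backTree f x \ critSet f = backTree f x := by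
    apply Subset.antisymm
    · exact fun y hy => hf.mem_backTree_of_apply hy.1 hy.2
    · intro y hy
      rcases hf.mem_backTree_cases hy with rfl | h
      · exact ⟨hfx, hcrit _ hx⟩
      · exact h
  have hne : (backTree f x).Nonempty := ⟨x, self_mem_backTree⟩
  rcases hexc with h | h
  · exact h ⟨_, hfin, hne, hS⟩
  · have : x ∈ maxExceptional f ∩ juliaSet f :=
      ⟨mem_sUnion.2 ⟨_, ⟨hfin, hne, hS⟩, self_mem_backTree⟩, hL.2.1 hx⟩
    rw [h] at this
    exact this

lemma exists_infinite_backTree_preimage (hf : ConformalMap f) (h : (backTree f w).Infinite) :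
    ∃ y, f y = w ∧ y ∉ critSet f ∧ (backTree f y).Infinite := by
  by_contra! hcon
  refine h (((finite_singleton w).union ((hf.finite_fiber w).sdiff (t := critSet f) |>.biUnion
    fun y hy => hcon y hy.1 hy.2)).subset ?_)
  rintro z ⟨n, hn, hd⟩
  cases n with
  | zero => exact Or.inl hn
  | succ n =>
    rw [hf.sphDeriv_iterate_succ, mul_ne_zero_iff] at hd
    rw [Function.iterate_succ_apply'] at hn
    exact Or.inr (mem_biUnion ⟨hn, hd.1⟩ ⟨n, rfl, hd.2⟩)

lemma mem_periodicPts_of_postcritical (hf : ConformalMap f)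
    (hT : ∀ w ∈ backTree f x, (backTree f w).Infinite → ∃ c ∈ critSet f, ∃ n, f^[n] c = w)
    (hw : w ∈ backTree f x) (hinf : (backTree f w).Infinite) : w ∈ Function.periodicPts f := by
  have hstep : ∀ v : {v // v ∈ backTree f x ∧ (backTree f v).Infinite},
      ∃ v' : {v // v ∈ backTree f x ∧ (backTree f v).Infinite}, f v'.1 = v.1 := by
    rintro ⟨v, hv, hvi⟩
    obtain ⟨y, hy, hyc, hyi⟩ := hf.exists_infinite_backTree_preimage hvi
    exact ⟨⟨y, hf.mem_backTree_of_apply (hy.symm ▸ hv) hyc, hyi⟩, hy⟩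
  choose s hs using hstep
  set b : ℕ → RSphere := fun k => (s^[k] ⟨w, hw, hinf⟩).1 with hb
  have hb1 : ∀ k i, f^[i] (b (k + i)) = b k := by
    intro k i
    induction i with
    | zero => rfl
    | succ i ih =>
      rw [Function.iterate_succ_apply, ← add_assoc]
      simp only [hb] at ih ⊢
      rw [Function.iterate_succ_apply', hs, ih]
  choose c hc n hn using fun k => hT (b k) (s^[k] ⟨w, hw, hinf⟩).2.1 (s^[k] ⟨w, hw, hinf⟩).2.2
  have : Finite (critSet f) := hf.finite_crit
  obtain ⟨⟨c₀, hc₀⟩, hinf₀⟩ := Finite.exists_infinite_fiber fun k => (⟨c k, hc k⟩ : critSet f)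
  rw [infinite_coe_iff] at hinf₀
  obtain ⟨k, hk⟩ := hinf₀.nonempty
  obtain ⟨j, hj, hjk⟩ := hinf₀.exists_gt (k + n k)
  have hk' : c k = c₀ := congrArg Subtype.val hk
  have hj' : c j = c₀ := congrArg Subtype.val hj
  have h1 : b k ∈ Function.periodicPts f := by
    refine ⟨n j + (j - k) - n k, by omega, ?_⟩
    change f^[_] (b k) = b k
    have h2 := hb1 k (j - k)
    rw [show k + (j - k) = j by omega, ← hn j, hj', ← Function.iterate_add_apply] at h2
    nth_rewrite 1 [← hn k]
    rw [hk', ← Function.iterate_add_apply, ← h2,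
      show n j + (j - k) - n k + n k = j - k + n j by omega]
  obtain ⟨p, hp, hper⟩ := h1
  have h3 := hb1 0 k
  rw [zero_add] at h3
  change f^[k] (b k) = w at h3
  rw [← h3]
  exact ⟨p, hp, hper.apply_iterate k⟩

/-- A point of the backward tree, with infinite backward tree, outside the postcritical set. -/
lemma exists_nonpostcritical (hf : ConformalMap f) (hx : (backTree f x).Infinite) :
    ∃ w ∈ backTree f x, (backTree f w).Infinite ∧ ∀ c ∈ critSet f, ∀ n, f^[n] c ≠ w := by
  by_contra! hcon
  have hper := fun w (hw : w ∈ backTree f x) hi => hf.mem_periodicPts_of_postcritical hcon hw hi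
  set T := {w | w ∈ backTree f x ∧ (backTree f w).Infinite} with hTdef
  have hxT : x ∈ T := ⟨self_mem_backTree, hx⟩
  have hTfin : T.Finite := by
    refine ((finite_Iio (Function.minimalPeriod f x)).image fun i => f^[i] x).subset ?_
    rintro t ⟨ht, hti⟩
    obtain ⟨p, hp, hpt⟩ := hper t ht hti
    obtain ⟨n, hn, -⟩ := ht
    have hxp := hper x self_mem_backTree hx
    have h1 : f^[p * n - n] x = t := by
      rw [← hn, ← Function.iterate_add_apply, Nat.sub_add_cancel (Nat.le_mul_of_pos_left n hp)]
      exact (hpt.mul_const n)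
    refine ⟨(p * n - n) % Function.minimalPeriod f x,
      Nat.mod_lt _ (Function.minimalPeriod_pos_of_mem_periodicPts hxp), ?_⟩
    simp only [Function.iterate_mod_minimalPeriod_eq, h1]
  have hRfin : (T ∪ ⋃ w ∈ T, ⋃ y ∈ f ⁻¹' {w} ∩ {y | ¬ (backTree f y).Infinite},
      backTree f y).Finite := by
    refine hTfin.union (hTfin.biUnion fun w _ => ?_)
    exact ((hf.finite_fiber w).inter_of_left _).biUnion fun y hy => not_infinite.1 hy.2
  refine hx (hRfin.subset ?_)
  rintro z ⟨n, hn, hd⟩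
  induction n generalizing z with
  | zero => exact Or.inl ((show z = x from hn) ▸ hxT)
  | succ n ih =>
    have hz : z ∈ backTree f x := ⟨n + 1, hn, hd⟩
    rw [hf.sphDeriv_iterate_add, Function.iterate_one, mul_ne_zero_iff] at hd
    rcases ih hn hd.1 with h | h
    · by_cases hzi : (backTree f z).Infinite
      · exact Or.inl ⟨hz, hzi⟩
      · exact Or.inr (mem_biUnion h (mem_biUnion ⟨rfl, hzi⟩ self_mem_backTree))
    · simp only [mem_iUnion] at h
      obtain ⟨w, hw, y, hy, h⟩ := h
      exact Or.inr (mem_biUnion hw (mem_biUnion hy (hf.mem_backTree_of_apply h hd.2)))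

/-- Backward orbits of points of expanding sets come close to all points of expanding sets. -/
lemma exists_bridge (hf : ConformalMap f)
    (hexc : ¬ IsExceptional f ∨ maxExceptional f ∩ juliaSet f = ∅) (hL : IsExpandingSet f L)
    (hL' : IsExpandingSet f L') (hx : x ∈ L) (hy : y ∈ L') {U : Set RSphere} (hU : U ∈ 𝓝 y) :
    ∃ v ∈ U, ∃ t, f^[t] v = x ∧ sphDeriv f^[t] v ≠ 0 := by
  by_contra! hcon
  obtain ⟨w, ⟨t, rfl, ht⟩, hinf, hpc⟩ := hf.exists_nonpostcritical
    (hf.infinite_backTree hexc hL hx)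
  have homit : ∀ n, ∀ v ∈ U, f^[n] v ∉ backTree f w := by
    rintro n v hv ⟨s, hs, -⟩
    have h1 := hcon v hv (t + (s + n)) (by
      rw [Function.iterate_add_apply, Function.iterate_add_apply f s, hs])
    rw [hf.sphDeriv_iterate_add, mul_eq_zero, Function.iterate_add_apply f s, hs] at h1
    refine hf.sphDeriv_iterate_ne_zero.2 (fun k hk hc => ?_) (h1.resolve_left ht)
    refine hpc _ hc (s + n - k) ?_
    rw [← Function.iterate_add_apply, Nat.sub_add_cancel hk.le, Function.iterate_add_apply, hs]
  obtain ⟨b₁, b₂, b₃, h12, h13, h23, hb₁, hb₂, hb₃⟩ : ∃ b₁ b₂ b₃ : ℂ, b₁ ≠ b₂ ∧ b₁ ≠ b₃ ∧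
      b₂ ≠ b₃ ∧ ofC b₁ ∈ backTree f w ∧ ofC b₂ ∈ backTree f w ∧ ofC b₃ ∈ backTree f w := by
    have h1 : (ofC ⁻¹' backTree f w).Infinite := by
      intro hfin
      refine hinf (((hfin.image ofC).union (finite_singleton infty)).subset fun z hz => ?_)
      rcases ofC_or_infty z with rfl | ⟨b, rfl⟩
      · exact Or.inr rfl
      · exact Or.inl ⟨b, hz, rfl⟩
    obtain ⟨E, hE, hcard⟩ := h1.exists_subset_card_eq 3
    obtain ⟨b₁, b₂, b₃, h12, h13, h23, rfl⟩ := Finset.card_eq_three.1 hcard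
    exact ⟨b₁, b₂, b₃, h12, h13, h23, hE (by simp), hE (by simp), hE (by simp)⟩
  obtain ⟨N, hN, r, hr, -, H⟩ := hf.exists_branches hL'.2.2.1
    (mapsTo_iff_image_subset.2 hL'.2.2.2.1.subset) hL'.2.2.2.2
  obtain ⟨C, hC⟩ := sphAnalytic_landau h12 h13 h23 hr
  obtain ⟨b, z, -, rfl⟩ := exists_chart y
  obtain ⟨ρ, hρ, hρU⟩ := Metric.mem_nhds_iff.1 ((continuous_chart b).continuousAt hU)
  have hpow : Tendsto (fun k : ℕ => (1 / 2 : ℝ) ^ k * r) atTop (𝓝 0) := by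
    simpa using (tendsto_pow_atTop_nhds_zero_of_lt_one (by norm_num : (0 : ℝ) ≤ 1 / 2)
      (by norm_num)).mul_const r
  obtain ⟨δ, hδ, hδU⟩ := Metric.mem_nhds_iff.1 hU
  obtain ⟨c, hc, l, hl, hexp⟩ := hL'.2.2.2.2.exists_forall
  have hgrow : Tendsto (fun k : ℕ => c * (l ^ N) ^ k * (2 / (‖z‖ ^ 2 + 1) * ρ)) atTop atTop :=
    ((tendsto_pow_atTop_atTop_of_one_lt (one_lt_pow₀ hl hN.ne')).const_mul_atTop hc).atTop_mul_const
      (by positivity)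
  obtain ⟨k, hk1, hk2⟩ := ((hpow.eventually_lt_const hδ).and (hgrow.eventually_gt_atTop C)).exists
  have hfar : r ≤ dist (f^[N * k] (chart b z)) (ofC b₃) := by
    by_contra! hlt
    obtain ⟨h, hh1, hh2, hh3, -⟩ := H k _ hy
    have h1 : ofC b₃ ∈ ball (f^[N * k] (chart b z)) r := by rwa [mem_ball, dist_comm]
    have h2 := hh3 _ h1 _ (mem_ball_self hr)
    rw [hh1] at h2
    refine homit (N * k) (h (ofC b₃)) (hδU ?_) (by rwa [hh2 _ h1])
    rw [mem_ball]
    refine lt_of_le_of_lt (h2.trans ?_) hk1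
    gcongr
    exact (mem_ball.1 h1).le
  have hmap : ∀ ζ ∈ ball (0 : ℂ) 1, chart b (z + ρ * ζ) ∈ U := by
    intro ζ hζ
    refine hρU ?_
    rw [mem_ball, dist_eq_norm, add_sub_cancel_left, norm_mul, Complex.norm_real,
      Real.norm_of_nonneg hρ.le]
    rw [mem_ball_zero_iff] at hζ
    nlinarith
  have haff : ∀ ζ : ℂ, HasStrictDerivAt (fun ζ : ℂ => z + ρ * ζ) (ρ : ℂ) ζ := fun ζ => by
    simpa using ((hasStrictDerivAt_id ζ).const_mul (ρ : ℂ)).const_add z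
  have hlan := hC (fun ζ => f^[N * k] (chart b (z + ρ * ζ)))
    (sphDeriv f^[N * k] (chart b z) * (2 / (‖z‖ ^ 2 + 1) * ρ))
    (fun ζ _ => ((hf.iterate (N * k)).analytic b _).comp_analyticAt (by fun_prop))
    (fun ζ hζ => ⟨fun h => homit (N * k) _ (hmap ζ hζ) (h ▸ hb₁),
      fun h => homit (N * k) _ (hmap ζ hζ) (h ▸ hb₂),
      fun h => homit (N * k) _ (hmap ζ hζ) (h ▸ hb₃)⟩)
    (by simpa using hfar)
    (by
      have h1 := HasStrictMetricDerivAt.of_hasStrictDerivAt (haff 0)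
      rw [Complex.norm_real, Real.norm_of_nonneg hρ.le] at h1
      have h2 := hasStrictMetricDerivAt_chart b z
      have h3 := (hf.iterate (N * k)).smd (chart b z)
      have hz : z = z + ρ * 0 := by simp
      rw [hz] at h2 h3
      have h4 : HasStrictMetricDerivAt (fun ζ : ℂ => chart b (z + ρ * ζ)) _ 0 :=
        HasStrictMetricDerivAt.comp (g := fun ζ : ℂ => z + ρ * ζ) h2 h1
      simpa [Function.comp_def] using HasStrictMetricDerivAt.comp
        (g := fun ζ : ℂ => chart b (z + ρ * ζ)) h3 h4)
  have h5 := hexp _ hy (N * k)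
  rw [pow_mul] at h5
  have h6 : c * (l ^ N) ^ k * (2 / (‖z‖ ^ 2 + 1) * ρ) ≤
      sphDeriv f^[N * k] (chart b z) * (2 / (‖z‖ ^ 2 + 1) * ρ) := by
    gcongr
  linarith

end ConformalMap

/-! ### Full-branch induced systems -/

/-- A contracting inverse branch of `f^a` defined on `D` and with values in `D`. -/
structure IsReturnBranch (f : RSphere → RSphere) (D : Set RSphere) (a : ℕ)
    (h : RSphere → RSphere) : Prop where
  mapsTo : MapsTo h D D
  right_inv : ∀ u ∈ D, f^[a] (h u) = u
  contracting : ∀ u ∈ D, ∀ v ∈ D, dist (h u) (h v) ≤ 1 / 2 * dist u v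

/-- Compact connected domains on which branches are considered. -/
structure IsBranchDomain (D : Set RSphere) : Prop where
  isCompact : IsCompact D
  isPreconnected : IsPreconnected D
  nontrivial : D.Nontrivial

/-- The union of the images of the return branches of `f^a`. -/
def returnSet (f : RSphere → RSphere) (D : Set RSphere) (a : ℕ) : Set RSphere :=
  ⋃₀ {S | ∃ h, IsReturnBranch f D a h ∧ S = h '' D}

/-- The maximal `f^a`-invariant set of the system of return branches of `f^a`. -/
def returnLimit (f : RSphere → RSphere) (D : Set RSphere) (a : ℕ) : Set RSphere :=
  {x | ∀ n, (f^[a])^[n] x ∈ returnSet f D a}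

section ReturnLimit

variable {f : RSphere → RSphere} {D : Set RSphere} {a b n : ℕ} {g h : RSphere → RSphere}
  {x u : RSphere}

lemma IsBranchDomain.accPt (hD : IsBranchDomain D) (hu : u ∈ D) : AccPt u (𝓟 D) :=
  hD.isPreconnected.preperfect_of_nontrivial hD.nontrivial u hu

lemma continuousOn_of_dist_le {C : ℝ} (hC : 0 < C)
    (h' : ∀ u ∈ D, ∀ v ∈ D, dist (h u) (h v) ≤ C * dist u v) : ContinuousOn h D := by
  rw [Metric.continuousOn_iff]
  intro v hv ε hε
  refine ⟨ε / C, by positivity, fun w hw hwv => (h' w hw v hv).trans_lt ?_⟩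
  rwa [lt_div_iff₀' hC] at hwv

namespace IsReturnBranch

lemma continuousOn (hh : IsReturnBranch f D a h) : ContinuousOn h D :=
  continuousOn_of_dist_le (by norm_num) hh.contracting

lemma two_le (hf : ConformalMap f) (hD : IsBranchDomain D) (hh : IsReturnBranch f D a h)
    (hu : u ∈ D) : 2 ≤ sphDeriv f^[a] (h u) := by
  have := ((hf.iterate a).smd (h u)).one_div_le_of_section (C := 1 / 2) (by norm_num)
    hh.right_inv hh.contracting hu (hD.accPt hu)
  norm_num at this
  exact this

lemma eqOn (hf : ConformalMap f) (hD : IsBranchDomain D) (hg : IsReturnBranch f D a g)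
    (hh : IsReturnBranch f D a h) (hu : u ∈ D) (he : g u = h u) : EqOn g h D := by
  have : PreconnectedSpace D := isPreconnected_iff_preconnectedSpace.1 hD.isPreconnected
  have hgc : Continuous fun w : D => g w := continuousOn_iff_continuous_domRestrict.1 hg.continuousOn
  have hhc : Continuous fun w : D => h w := continuousOn_iff_continuous_domRestrict.1 hh.continuousOn
  have hclopen : IsClopen {w : D | g w = h w} := by
    refine ⟨isClosed_eq hgc hhc, isOpen_iff_mem_nhds.2 fun w hw => ?_⟩
    have hw' : g w = h w := hw
    obtain ⟨U, hU, HU⟩ := ((hf.iterate a).smd (g w)).exists_antilipschitz (K := 1)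
      (by linarith [hg.two_le hf hD w.2])
    filter_upwards [hgc.continuousAt hU, hhc.continuousAt (by rwa [← hw'])] with v hv1 hv2
    have h1 := HU _ hv1 _ hv2
    rw [hg.right_inv _ v.2, hh.right_inv _ v.2, dist_self, one_mul] at h1
    exact dist_le_zero.1 h1
  have := hclopen.eq_univ ⟨⟨u, hu⟩, he⟩
  intro w hw
  exact this.symm.subset (mem_univ (⟨w, hw⟩ : D))

end IsReturnBranch

lemma finite_returnImages (hf : ConformalMap f) (hD : IsBranchDomain D) (a : ℕ) :
    {S | ∃ h, IsReturnBranch f D a h ∧ S = h '' D}.Finite := by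
  obtain ⟨u, hu⟩ := hD.nontrivial.nonempty
  refine (((hf.iterate a).finite_fiber u).image
    fun y => ⋃ (h) (_ : IsReturnBranch f D a h) (_ : h u = y), h '' D).subset ?_
  rintro _ ⟨h, hh, rfl⟩
  refine ⟨h u, hh.right_inv u hu, ?_⟩
  refine subset_antisymm ?_ ?_
  · simp only [iUnion_subset_iff]
    intro g hg hgu
    exact ((hg.eqOn hf hD hh hu hgu).image_eq).subset
  · exact subset_iUnion₂_of_subset h hh (subset_iUnion_of_subset rfl subset_rfl)

lemma isCompact_returnSet (hf : ConformalMap f) (hD : IsBranchDomain D) (a : ℕ) :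
    IsCompact (returnSet f D a) := by
  refine (finite_returnImages hf hD a).isCompact_sUnion ?_
  rintro _ ⟨h, hh, rfl⟩
  exact hD.isCompact.image_of_continuousOn hh.continuousOn

lemma isCompact_returnLimit (hf : ConformalMap f) (hD : IsBranchDomain D) (a : ℕ) :
    IsCompact (returnLimit f D a) := by
  refine IsClosed.isCompact ?_
  rw [returnLimit, ofPred_forall]
  exact isClosed_iInter fun n =>
    (isCompact_returnSet hf hD a).isClosed.preimage ((hf.iterate a).continuous.iterate n)

lemma returnLimit_subset : returnLimit f D a ⊆ D := by
  intro x hx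
  obtain ⟨_, ⟨h, hh, rfl⟩, u, hu, rfl⟩ := hx 0
  exact hh.mapsTo hu

lemma mapsTo_returnLimit : MapsTo f^[a] (returnLimit f D a) (returnLimit f D a) := by
  intro x hx n
  rw [← Function.iterate_succ_apply]
  exact hx (n + 1)

lemma IsReturnBranch.mapsTo_returnLimit (hh : IsReturnBranch f D a h) :
    MapsTo h (returnLimit f D a) (returnLimit f D a) := by
  intro x hx n
  have hxD := returnLimit_subset hx
  cases n with
  | zero => exact ⟨_, ⟨h, hh, rfl⟩, x, hxD, rfl⟩
  | succ n =>
    rw [Function.iterate_succ_apply, hh.right_inv x hxD]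
    exact hx n

lemma exists_branch_of_mem_returnLimit (hx : x ∈ returnLimit f D a) :
    ∃ h, IsReturnBranch f D a h ∧ h (f^[a] x) = x := by
  obtain ⟨_, ⟨h, hh, rfl⟩, u, hu, rfl⟩ := hx 0
  exact ⟨h, hh, by simp only [hh.right_inv u hu]⟩

lemma image_returnLimit : f^[a] '' returnLimit f D a = returnLimit f D a := by
  refine subset_antisymm (mapsTo_iff_image_subset.1 mapsTo_returnLimit) fun x hx => ?_
  obtain ⟨h, hh, -⟩ := exists_branch_of_mem_returnLimit hx
  exact ⟨h x, hh.mapsTo_returnLimit hx, hh.right_inv x (returnLimit_subset hx)⟩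

lemma expandingOn_returnLimit (hf : ConformalMap f) (hD : IsBranchDomain D) (a : ℕ) :
    ExpandingOn f^[a] (returnLimit f D a) := by
  refine ⟨1, one_pos, 2, by norm_num, fun x hx m _ => ?_⟩
  rw [one_mul]
  clear * - hx hf hD
  induction m generalizing x with
  | zero => rw [ConformalMap.sphDeriv_iterate_zero, pow_zero]
  | succ m ih =>
    obtain ⟨h, hh, hhx⟩ := exists_branch_of_mem_returnLimit hx
    have h1 := hh.two_le hf hD (returnLimit_subset (mapsTo_returnLimit hx))
    rw [hhx] at h1
    have h2 := ih _ (mapsTo_returnLimit hx)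
    rw [(hf.iterate a).sphDeriv_iterate_add m 1 x, pow_succ, Function.iterate_one]
    exact mul_le_mul h2 h1 (by norm_num) ((hf.iterate a).iterate m |>.sphDeriv_nonneg _)

lemma exists_iterated_return (hx : x ∈ returnLimit f D a) (n : ℕ) :
    ∃ h, MapsTo h D D ∧ MapsTo h (returnLimit f D a) (returnLimit f D a) ∧
      (∀ u ∈ D, (f^[a])^[n] (h u) = u) ∧
      (∀ u ∈ D, ∀ v ∈ D, dist (h u) (h v) ≤ (1 / 2) ^ n * dist u v) ∧
      h ((f^[a])^[n] x) = x := by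
  induction n generalizing x with
  | zero => exact ⟨id, mapsTo_id _, mapsTo_id _, fun _ _ => rfl, fun _ _ _ _ => by simp, rfl⟩
  | succ n ih =>
    obtain ⟨g, h1, h2, h3, h4, h5⟩ := ih (mapsTo_returnLimit hx)
    obtain ⟨h, hh, hhx⟩ := exists_branch_of_mem_returnLimit hx
    refine ⟨h ∘ g, hh.mapsTo.comp h1, hh.mapsTo_returnLimit.comp h2, fun u hu => ?_,
      fun u hu v hv => ?_, ?_⟩
    · rw [Function.iterate_succ_apply, Function.comp_apply, hh.right_inv _ (h1 hu), h3 u hu]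
    · refine (hh.contracting _ (h1 hu) _ (h1 hv)).trans ?_
      rw [pow_succ', mul_assoc]
      have := h4 u hu v hv
      gcongr
    · rw [Function.iterate_succ_apply, Function.comp_apply, h5, hhx]

lemma topTransOn_returnLimit (D : Set RSphere) (a : ℕ) :
    TopTransOn f^[a] (returnLimit f D a) := by
  rintro U V hU - ⟨x, hxU, hx⟩ ⟨y, hyV, hy⟩
  obtain ⟨ε, hε, hball⟩ := Metric.isOpen_iff.1 hU x hxU
  obtain ⟨n, hn⟩ := exists_pow_lt_of_lt_one (half_pos hε) (by norm_num : (1 / 2 : ℝ) < 1)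
  obtain ⟨h, h1, h2, h3, h4, h5⟩ := exists_iterated_return hx n
  have hyD := returnLimit_subset hy
  have hxn : (f^[a])^[n] x ∈ D := returnLimit_subset (mapsTo_returnLimit.iterate n hx)
  refine ⟨n, y, ⟨h y, ⟨hball ?_, h2 hy⟩, h3 y hyD⟩, hyV⟩
  rw [mem_ball]
  calc dist (h y) x = dist (h y) (h ((f^[a])^[n] x)) := by rw [h5]
    _ ≤ (1 / 2) ^ n * dist y ((f^[a])^[n] x) := h4 _ hyD _ hxn
    _ ≤ (1 / 2) ^ n * 2 := by gcongr; exact dist_le_two _ _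
    _ < ε := by linarith

lemma IsReturnBranch.nonempty_returnLimit (hD : IsBranchDomain D)
    (hh : IsReturnBranch f D a h) : (returnLimit f D a).Nonempty := by
  obtain ⟨x, hx, hmin⟩ := hD.isCompact.exists_isMinOn hD.nontrivial.nonempty
    (f := fun u => dist u (h u)) (continuous_dist.comp_continuousOn (continuousOn_id.prodMk hh.continuousOn))
  have h1 := isMinOn_iff.1 hmin (h x) (hh.mapsTo hx)
  have h2 := hh.contracting x hx _ (hh.mapsTo hx)
  have hfix : x = h x := dist_le_zero.1 (by linarith [dist_nonneg (x := x) (y := h x)])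
  have hfa : f^[a] x = x := by
    conv_lhs => rw [hfix]
    exact hh.right_inv x hx
  refine ⟨x, fun n => ?_⟩
  rw [Function.iterate_fixed hfa]
  exact ⟨_, ⟨h, hh, rfl⟩, x, hx, hfix.symm⟩

lemma returnLimit_subset_mul {k : ℕ} (hk : 0 < k) :
    returnLimit f D a ⊆ returnLimit f D (a * k) := by
  intro x hx n
  rw [Function.iterate_mul, ← Function.iterate_mul]
  have hy : (f^[a])^[k * n] x ∈ returnLimit f D a := mapsTo_returnLimit.iterate _ hx
  obtain ⟨h, h1, -, h3, h4, h5⟩ := exists_iterated_return hy k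
  refine ⟨_, ⟨h, ⟨h1, fun u hu => ?_, fun u hu v hv => (h4 u hu v hv).trans ?_⟩, rfl⟩, _,
    returnLimit_subset (mapsTo_returnLimit.iterate k hy), h5⟩
  · rw [Function.iterate_mul, h3 u hu]
  · gcongr
    calc (1 / 2 : ℝ) ^ k ≤ (1 / 2) ^ 1 := pow_le_pow_of_le_one (by norm_num) (by norm_num) hk
      _ = 1 / 2 := pow_one _

end ReturnLimit

/-! ### Lower bounds for the pressure of full-branch systems -/

section Lower

variable {f : RSphere → RSphere} {D : Set RSphere} {a : ℕ} {ι : Type*} [Fintype ι]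
  {h : ι → RSphere → RSphere} {x₀ : RSphere}

lemma birkhoff_add (f : RSphere → RSphere) (φ : RSphere → ℝ) (m n : ℕ) (x : RSphere) :
    birkhoff f φ (m + n) x = birkhoff f φ m x + birkhoff f φ n (f^[m] x) := by
  simp only [birkhoff, Finset.sum_range_add, ← Function.iterate_add_apply]
  congr 1
  exact Finset.sum_congr rfl fun k _ => by rw [add_comm]

open Classical in
/-- The points obtained from `x₀` by applying words of length `n` in the branches `h`. -/
noncomputable def wordPoints (h : ι → RSphere → RSphere) (x₀ : RSphere) : ℕ → Finset RSphere
  | 0 => {x₀}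
  | n + 1 => (Finset.univ ×ˢ wordPoints h x₀ n).image fun p => h p.1 p.2

lemma mem_wordPoints_succ {n : ℕ} {x : RSphere} :
    x ∈ wordPoints h x₀ (n + 1) ↔ ∃ i, ∃ y ∈ wordPoints h x₀ n, h i y = x := by
  classical
  simp only [wordPoints, Finset.mem_image, Finset.mem_product, Finset.mem_univ, true_and,
    Prod.exists]

lemma wordPoints_subset (hh : ∀ i, IsReturnBranch f D a (h i)) (hx₀ : x₀ ∈ returnLimit f D a)
    (n : ℕ) : ↑(wordPoints h x₀ n) ⊆ returnLimit f D a := by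
  induction n with
  | zero => simpa [wordPoints] using hx₀
  | succ n ih =>
    intro x hx
    obtain ⟨i, y, hy, rfl⟩ := mem_wordPoints_succ.1 hx
    exact (hh i).mapsTo_returnLimit (ih hy)

lemma pow_le_sum_wordPoints (hh : ∀ i, IsReturnBranch f D a (h i))
    (hne : ∀ i j, i ≠ j → ∀ u ∈ D, h i u ≠ h j u) (hx₀ : x₀ ∈ returnLimit f D a)
    {φ : RSphere → ℝ} {c : ι → ℝ} (hc0 : ∀ i, 0 ≤ c i)
    (hc : ∀ i, ∀ u ∈ D, c i ≤ Real.exp (birkhoff f φ a (h i u))) (n : ℕ) :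
    (∑ i, c i) ^ n ≤ ∑ x ∈ wordPoints h x₀ n, Real.exp (birkhoff f φ (a * n) x) := by
  classical
  induction n with
  | zero => simp [wordPoints, birkhoff]
  | succ n ih =>
    have hsub := wordPoints_subset hh hx₀ n
    have hD : ∀ y ∈ wordPoints h x₀ n, y ∈ D := fun y hy => returnLimit_subset (hsub hy)
    rw [wordPoints, Finset.sum_image, Finset.sum_product]
    · rw [pow_succ', Finset.sum_mul]
      refine Finset.sum_le_sum fun i _ => ?_
      calc c i * (∑ i, c i) ^ n ≤ c i * ∑ x ∈ wordPoints h x₀ n, Real.exp (birkhoff f φ (a * n) x) :=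
            mul_le_mul_of_nonneg_left ih (hc0 i)
        _ = ∑ x ∈ wordPoints h x₀ n, c i * Real.exp (birkhoff f φ (a * n) x) := Finset.mul_sum _ _ _
        _ ≤ _ := by
          refine Finset.sum_le_sum fun y hy => ?_
          rw [mul_add, mul_one, add_comm, birkhoff_add, (hh i).right_inv y (hD y hy), Real.exp_add]
          exact mul_le_mul_of_nonneg_right (hc i y (hD y hy)) (Real.exp_pos _).le
    · rintro ⟨i, y⟩ hy ⟨j, z⟩ hz hyz
      simp only [Finset.coe_product, mem_prod, Finset.mem_coe] at hy hz
      have h1 : y = z := by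
        have := congrArg f^[a] hyz
        simpa only [(hh _).right_inv _ (hD _ hy.2), (hh _).right_inv _ (hD _ hz.2)] using this
      subst h1
      by_contra hcon
      exact hne i j (fun hij => hcon (by rw [hij])) y (hD y hy.2) hyz

lemma exists_separation (hD : IsBranchDomain D)
    (hh : ∀ i, IsReturnBranch f D a (h i)) (hne : ∀ i j, i ≠ j → ∀ u ∈ D, h i u ≠ h j u) :
    ∃ δ > 0, ∀ i j, i ≠ j → ∀ u ∈ D, ∀ v ∈ D, δ ≤ dist (h i u) (h j v) := by
  have h1 : ∀ i j, ∃ δ > 0, i ≠ j → ∀ u ∈ D, ∀ v ∈ D, δ ≤ dist (h i u) (h j v) := by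
    intro i j
    by_cases hij : i = j
    · exact ⟨1, one_pos, fun h' => absurd hij h'⟩
    have hc : ContinuousOn (fun p : RSphere × RSphere => dist (h i p.1) (h j p.2)) (D ×ˢ D) :=
      continuous_dist.comp_continuousOn
        (((hh i).continuousOn.comp continuousOn_fst fun p hp => hp.1).prodMk
          ((hh j).continuousOn.comp continuousOn_snd fun p hp => hp.2))
    obtain ⟨p, hp, hmin⟩ := (hD.isCompact.prod hD.isCompact).exists_isMinOn
      (hD.nontrivial.nonempty.prod hD.nontrivial.nonempty) hc
    refine ⟨_, ?_, fun _ u hu v hv => isMinOn_iff.1 hmin (u, v) ⟨hu, hv⟩⟩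
    refine dist_pos.2 fun heq => ?_
    have h2 : p.1 = p.2 := by
      have := congrArg f^[a] heq
      rwa [(hh i).right_inv _ hp.1, (hh j).right_inv _ hp.2] at this
    rw [← h2] at heq
    exact hne i j hij _ hp.1 heq
  choose δ hδ H using h1
  obtain ⟨ε, hε, hle⟩ : ∃ ε > 0, ∀ i j, ε ≤ δ i j := by
    rcases isEmpty_or_nonempty ι with hι | hι
    · exact ⟨1, one_pos, fun i => isEmptyElim i⟩
    · obtain ⟨p, hp⟩ := Finite.exists_min fun p : ι × ι => δ p.1 p.2
      exact ⟨δ p.1 p.2, hδ _ _, fun i j => hp (i, j)⟩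
  exact ⟨ε, hε, fun i j hij u hu v hv => (hle i j).trans (H i j hij u hu v hv)⟩

lemma wordPoints_separated (hh : ∀ i, IsReturnBranch f D a (h i))
    (hx₀ : x₀ ∈ returnLimit f D a) {δ : ℝ}
    (hδ : ∀ i j, i ≠ j → ∀ u ∈ D, ∀ v ∈ D, δ ≤ dist (h i u) (h j v)) (n : ℕ) :
    ∀ x ∈ wordPoints h x₀ n, ∀ y ∈ wordPoints h x₀ n, x ≠ y →
      ∃ k < n, δ ≤ dist ((f^[a])^[k] x) ((f^[a])^[k] y) := by
  induction n with
  | zero =>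
    intro x hx y hy hxy
    simp only [wordPoints, Finset.mem_singleton] at hx hy
    exact absurd (hx.trans hy.symm) hxy
  | succ n ih =>
    intro x hx y hy hxy
    obtain ⟨i, x', hx', rfl⟩ := mem_wordPoints_succ.1 hx
    obtain ⟨j, y', hy', rfl⟩ := mem_wordPoints_succ.1 hy
    have hxD := returnLimit_subset (wordPoints_subset hh hx₀ n hx')
    have hyD := returnLimit_subset (wordPoints_subset hh hx₀ n hy')
    by_cases hij : i = j
    · subst hij
      obtain ⟨k, hk, hd⟩ := ih x' hx' y' hy' fun he => hxy (by rw [he])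
      refine ⟨k + 1, by omega, ?_⟩
      rwa [Function.iterate_succ_apply, Function.iterate_succ_apply, (hh i).right_inv _ hxD,
        (hh i).right_inv _ hyD]
    · exact ⟨0, n.succ_pos, hδ i j hij _ hxD _ hyD⟩

/-- The pressure of full-branch systems is at least that of the corresponding full shift. -/
lemma log_sum_le_normPress (hf : ConformalMap f) (hD : IsBranchDomain D) (ha : 0 < a)
    [Nonempty ι] (hh : ∀ i, IsReturnBranch f D a (h i))
    (hne : ∀ i j, i ≠ j → ∀ u ∈ D, h i u ≠ h j u) {d : ℝ} {c : ι → ℝ} (hc0 : ∀ i, 0 < c i)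
    (hc : ∀ i, ∀ u ∈ D, c i ≤ Real.exp (birkhoff f (geomPot f d) a (h i u))) {k : ℕ}
    (hk : 0 < k) :
    Real.log (∑ i, c i) / a ≤ normPress f (a * k) (returnLimit f D (a * k)) d := by
  obtain ⟨K, hK1, hK⟩ := hf.exists_lipschitz
  obtain ⟨_, hpb⟩ := hf.pressureBounds hK1 hK (expandingOn_returnLimit hf hD (a * k)) d
  obtain ⟨x₀, hx₀⟩ := (hh (Classical.arbitrary ι)).nonempty_returnLimit hD
  obtain ⟨δ, hδ, hsep⟩ := exists_separation hD hh hne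
  have hS : 0 < ∑ i, c i := Finset.sum_pos (fun i _ => hc0 i) Finset.univ_nonempty
  have ha' : (0 : ℝ) < a := by exact_mod_cast ha
  have hk' : (0 : ℝ) < k := by exact_mod_cast hk
  have hKp : 0 < K ^ (a * k) := pow_pos (by linarith) _
  rw [normPress, div_le_div_iff₀ ha' (by push_cast; positivity)]
  suffices hmain : k * Real.log (∑ i, c i) ≤ pressureOn f^[a * k] (returnLimit f D (a * k))
      (birkhoff f (geomPot f d) (a * k)) by
    push_cast
    nlinarith
  refine hpb.le_pressureOn_of_frequently (ε := δ / K ^ (a * k)) (div_pos hδ hKp) (C := 0)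
    (Eventually.of_forall fun n => ?_).frequently
  have hsub := wordPoints_subset hh hx₀ (k * n)
  refine ⟨wordPoints h x₀ (k * n), ⟨hsub.trans (returnLimit_subset_mul hk), ?_⟩, ?_⟩
  · intro x hx y hy hxy
    obtain ⟨q, hq, hd⟩ := wordPoints_separated hh hx₀ hsep (k * n) x hx y hy hxy
    refine ⟨q / k, Nat.div_lt_of_lt_mul hq, ?_⟩
    rw [div_le_iff₀' hKp]
    refine hd.trans ?_
    have h1 : ∀ x, (f^[a])^[q] x = f^[a * (q % k)] ((f^[a * k])^[q / k] x) := fun x => by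
      rw [← Function.iterate_mul, ← Function.iterate_mul, ← Function.iterate_add_apply,
        mul_assoc, ← mul_add, Nat.mod_add_div]
    rw [h1, h1]
    refine (dist_iterate_le hK1 hK _ _ _).trans ?_
    gcongr
    exact (Nat.mod_lt q hk).le
  · simp only [birkhoff_birkhoff, mul_assoc]
    refine le_trans (le_of_eq ?_)
      (pow_le_sum_wordPoints hh hne hx₀ (fun i => (hc0 i).le) hc (k * n))
    rw [add_zero, ← mul_assoc, ← Nat.cast_mul, mul_comm n k, Real.exp_nat_mul, Real.exp_log hS]

end Lower

/-! ### Constructing return branches from orbits in expanding sets -/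

namespace ConformalMap

variable {f : RSphere → RSphere} {L L₀ D : Set RSphere} {z₀ y w : RSphere}

/-- Lower bounds for Birkhoff sums along Lipschitz inverse branches. -/
lemma exists_birkhoff_bound (hf : ConformalMap f) {g : RSphere → RSphere} {n : ℕ} {C : ℝ}
    (hD : ∀ u ∈ D, AccPt u (𝓟 D)) (hC : 0 < C) (hg : ∀ u ∈ D, f^[n] (g u) = u)
    (hlip : ∀ u ∈ D, ∀ v ∈ D, dist (g u) (g v) ≤ C * dist u v) (d : ℝ) :
    ∃ A, ∀ u ∈ D, -A ≤ birkhoff f (geomPot f d) n (g u) := by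
  obtain ⟨K, hK1, hK⟩ := hf.exists_lipschitz
  refine ⟨|d| * (|Real.log (1 / C)| + |Real.log (K ^ n)|), fun u hu => ?_⟩
  have h1 := ((hf.iterate n).smd (g u)).one_div_le_of_section hC hg hlip hu (hD u hu)
  have h2 := hf.sphDeriv_iterate_le hK1 hK n (g u)
  have hC' : 0 < 1 / C := by positivity
  have h0 := hC'.trans_le h1
  rw [hf.birkhoff_geomPot d h0.ne']
  have h3 := Real.log_le_log hC' h1
  have h4 := Real.log_le_log h0 h2
  have h5 : |Real.log (sphDeriv f^[n] (g u))| ≤ |Real.log (1 / C)| + |Real.log (K ^ n)| := by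
    rw [abs_le]
    constructor
    · linarith [neg_abs_le (Real.log (1 / C)), abs_nonneg (Real.log (K ^ n))]
    · linarith [le_abs_self (Real.log (K ^ n)), abs_nonneg (Real.log (1 / C))]
  have h6 : |-d * Real.log (sphDeriv f^[n] (g u))| ≤
      |d| * (|Real.log (1 / C)| + |Real.log (K ^ n)|) := by
    rw [abs_mul, abs_neg]
    gcongr
  linarith [neg_abs_le (-d * Real.log (sphDeriv f^[n] (g u)))]

/-- Branches along an orbit in an expanding set, shadowing the orbit and having almost the same
Birkhoff sums. -/
lemma exists_shadowing_branches (hf : ConformalMap f) (hL : IsExpandingSet f L) (d : ℝ)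
    {η ε : ℝ} (hη : 0 < η) (hε : 0 < ε) :
    ∃ N > 0, ∃ r > 0, ∃ B, ∀ m, ∀ x ∈ L, ∃ h : RSphere → RSphere,
      (∀ u ∈ ball (f^[N * (m / N + 1)] x) r, f^[N * (m / N + 1)] (h u) = u) ∧
      (∀ u ∈ ball (f^[N * (m / N + 1)] x) r, ∀ v ∈ ball (f^[N * (m / N + 1)] x) r,
        dist (h u) (h v) ≤ (1 / 2) ^ (m / N + 1) * dist u v) ∧
      ∀ u ∈ ball (f^[N * (m / N + 1)] x) r,
        dist (h u) x ≤ dist u (f^[N * (m / N + 1)] x) ∧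
        (∀ i < m, dist (f^[i] (h u)) (f^[i] x) < ε) ∧
        birkhoff f (geomPot f d) m x - (B + η * m) ≤
          birkhoff f (geomPot f d) (N * (m / N + 1)) (h u) := by
  obtain ⟨K, hK1, hK⟩ := hf.exists_lipschitz
  obtain ⟨-, -, hLc, hLim, hexp⟩ := hL
  have hfL : MapsTo f L L := mapsTo_iff_image_subset.2 hLim.subset
  obtain ⟨N, hN, r₀, hr₀, -, H⟩ := hf.exists_branches hLc hfL hexp
  have hcont : ∀ x ∈ L, ContinuousAt (geomPot f d) x := fun x hx =>
    continuousAt_const.mul (hf.continuous_sphDeriv.continuousAt.log (not_mem_critSet hexp hx))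
  obtain ⟨r₁, hr₁, Hr₁⟩ : ∃ r₁ > 0, ∀ x ∈ L, ∀ y, dist x y < r₁ →
      |geomPot f d x - geomPot f d y| < η := by
    have := hLc.uniformContinuousAt_of_continuousAt _ hcont (Metric.dist_mem_uniformity hη)
    obtain ⟨r₁, hr₁, h⟩ := Metric.mem_uniformity_dist.1 this
    exact ⟨r₁, hr₁, fun x hx y hxy => h hxy hx⟩
  obtain ⟨b, hb⟩ := hLc.exists_bound_of_continuousOn
    (f := geomPot f d) fun x hx => (hcont x hx).continuousWithinAt
  have hKN : 0 < K ^ N := pow_pos (by linarith) _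
  refine ⟨N, hN, min r₀ (min ε r₁ / K ^ N), lt_min hr₀ (by positivity), N * |b| + η * N,
    fun m x hx => ?_⟩
  obtain ⟨h, -, h2, h3, h4⟩ := H (m / N + 1) x hx
  set k := m / N + 1 with hk
  have hball : ball (f^[N * k] x) (min r₀ (min ε r₁ / K ^ N)) ⊆ ball (f^[N * k] x) r₀ :=
    ball_subset_ball (min_le_left _ _)
  refine ⟨h, fun u hu => h2 u (hball hu), fun u hu v hv => h3 u (hball hu) v (hball hv),
    fun u hu => ?_⟩
  have hmk : m < N * k := Nat.lt_mul_div_succ m hN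
  have hkm : N * k ≤ m + N := by
    rw [hk, mul_add, mul_one]
    exact Nat.add_le_add_right (Nat.mul_div_le m N) N
  have hdist : ∀ i < N * k, dist (f^[i] (h u)) (f^[i] x) < min ε r₁ := by
    intro i hi
    have hq : i / N ≤ k := (Nat.div_lt_of_lt_mul hi).le
    have h5 := h4 u (hball hu) (i / N) hq
    have h6 : ∀ y, f^[i] y = f^[i % N] (f^[N * (i / N)] y) := fun y => by
      rw [← Function.iterate_add_apply, Nat.mod_add_div]
    rw [h6, h6]
    have h7 : dist u (f^[N * k] x) < min ε r₁ / K ^ N := (mem_ball.1 hu).trans_le (min_le_right _ _)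
    rw [lt_div_iff₀' hKN] at h7
    refine lt_of_le_of_lt ?_ h7
    refine (dist_iterate_le hK1 hK _ _ _).trans ?_
    have h8 : ((1 : ℝ) / 2) ^ (k - i / N) ≤ 1 := pow_le_one₀ (by norm_num) (by norm_num)
    have h9 : dist (f^[N * (i / N)] (h u)) (f^[N * (i / N)] x) ≤ dist u (f^[N * k] x) :=
      h5.trans (mul_le_of_le_one_left dist_nonneg h8)
    have h10 : K ^ (i % N) ≤ K ^ N := pow_le_pow_right₀ hK1 (Nat.mod_lt i hN).le
    exact mul_le_mul h10 h9 dist_nonneg hKN.le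
  refine ⟨?_, fun i hi => (hdist i (hi.trans hmk)).trans_le (min_le_left _ _), ?_⟩
  · have := h4 u (hball hu) 0 (Nat.zero_le _)
    simp only [mul_zero, Function.iterate_zero, id] at this
    exact this.trans (mul_le_of_le_one_left dist_nonneg (pow_le_one₀ (by norm_num) (by norm_num)))
  · have h5 : birkhoff f (geomPot f d) (N * k) x - η * (N * k : ℕ) ≤
        birkhoff f (geomPot f d) (N * k) (h u) := by
      have : ∑ i ∈ Finset.range (N * k), (geomPot f d (f^[i] x) - η) ≤
          birkhoff f (geomPot f d) (N * k) (h u) := by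
        refine Finset.sum_le_sum fun i hi => ?_
        have h6 := hdist i (Finset.mem_range.1 hi)
        rw [dist_comm] at h6
        have h7 := Hr₁ _ (hfL.iterate i hx) _ (h6.trans_le (min_le_right _ _))
        linarith [(abs_lt.1 h7).2]
      rw [Finset.sum_sub_distrib, Finset.sum_const, Finset.card_range, nsmul_eq_mul] at this
      rw [birkhoff, mul_comm η]
      exact this
    have h6 : birkhoff f (geomPot f d) m x - N * |b| ≤ birkhoff f (geomPot f d) (N * k) x := by
      obtain ⟨e, he⟩ := Nat.exists_eq_add_of_lt hmk
      have heN : e + 1 ≤ N := by omega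
      rw [he, add_assoc, birkhoff_add]
      have h7 : -((e + 1 : ℕ) * |b|) ≤ birkhoff f (geomPot f d) (e + 1) (f^[m] x) := by
        have : ∑ i ∈ Finset.range (e + 1), -|b| ≤
            birkhoff f (geomPot f d) (e + 1) (f^[m] x) := by
          refine Finset.sum_le_sum fun i _ => ?_
          have h8 := hb _ (hfL.iterate i (hfL.iterate m hx))
          rw [Real.norm_eq_abs] at h8
          linarith [(abs_le.1 h8).1, le_abs_self b]
        rw [Finset.sum_const, Finset.card_range, nsmul_eq_mul] at this
        linarith
      have h8 : ((e + 1 : ℕ) : ℝ) * |b| ≤ N * |b| := by gcongr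
      linarith
    have h7 : η * (N * k : ℕ) ≤ η * m + η * N := by
      rw [← mul_add]
      gcongr
      exact_mod_cast hkm
    linarith

/-- Branches from a fixed domain into neighbourhoods of points of expanding sets. -/
lemma exists_entrance (hf : ConformalMap f)
    (hexc : ¬ IsExceptional f ∨ maxExceptional f ∩ juliaSet f = ∅)
    (hL₀ : IsExpandingSet f L₀) (hz₀ : z₀ ∈ L₀) :
    ∃ r > 0, ∀ D ⊆ ball z₀ r, IsBranchDomain D → ∀ L, IsExpandingSet f L → ∀ y ∈ L,
      ∀ V ∈ 𝓝 y, ∀ d : ℝ, ∃ (s : ℕ) (g : RSphere → RSphere) (C A : ℝ), 0 < C ∧ MapsTo g D V ∧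
        (∀ u ∈ D, f^[s] (g u) = u) ∧ (∀ u ∈ D, ∀ v ∈ D, dist (g u) (g v) ≤ C * dist u v) ∧
        ∀ u ∈ D, -A ≤ birkhoff f (geomPot f d) s (g u) := by
  have hL₀' := hL₀
  obtain ⟨-, -, hLc, hLim, hexp⟩ := hL₀
  obtain ⟨N, hN, r, hr, -, H⟩ := hf.exists_branches hLc
    (mapsTo_iff_image_subset.2 hLim.subset) hexp
  refine ⟨r, hr, fun D hDr hD L hL y hy V hV d => ?_⟩
  have hsurj : ∀ n, ∃ x ∈ L₀, f^[n] x = z₀ := by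
    intro n
    have : f^[n] '' L₀ = L₀ := by
      rw [image_iterate_eq]
      exact Function.iterate_fixed hLim n
    exact this.symm.subset hz₀
  choose x hx hfx using fun n => hsurj (N * n)
  obtain ⟨x', hx', ψ, hψ, hlim⟩ := hLc.tendsto_subseq hx
  obtain ⟨v, hvV, t, rfl, hvt⟩ := hf.exists_bridge hexc hL₀' hL hx' hy (interior_mem_nhds.2 hV)
  have hl : 0 < sphDeriv f^[t] v := lt_of_le_of_ne ((hf.iterate t).sphDeriv_nonneg v) hvt.symm
  obtain ⟨ρ, hρ, g, hg, hglip, -⟩ := ((hf.iterate t).smd v).exists_local_inverse hl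
    ((hf.iterate t).nhds_le v hvt) (lt_add_one _) (mem_interior_iff_mem_nhds.1 hvV)
  obtain ⟨n, hn, hn'⟩ : ∃ n, dist (x n) (f^[t] v) < ρ / 2 ∧ (1 / 2) ^ n * r < ρ / 2 := by
    have h1 : Tendsto (fun n : ℕ => ((1 : ℝ) / 2) ^ n * r) atTop (𝓝 0) := by
      simpa using (tendsto_pow_atTop_nhds_zero_of_lt_one (by norm_num)
        (by norm_num : (1 / 2 : ℝ) < 1)).mul_const r
    obtain ⟨n, h2, h3⟩ := ((hlim.eventually (ball_mem_nhds _ (half_pos hρ))).and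
      ((h1.comp hψ.tendsto_atTop).eventually (gt_mem_nhds (half_pos hρ)))).exists
    exact ⟨ψ n, h2, h3⟩
  obtain ⟨h, h1, h2, h3, h4⟩ := H n (x n) (hx n)
  rw [hfx] at h1 h2 h3 h4
  have hhD : ∀ u ∈ D, h u ∈ ball (f^[t] v) ρ := fun u hu => by
    have h5 := h4 u (hDr hu) 0 (Nat.zero_le _)
    simp only [mul_zero, Function.iterate_zero, id, Nat.sub_zero] at h5
    have h6 : (1 / 2 : ℝ) ^ n * dist u z₀ ≤ (1 / 2) ^ n * r := by
      gcongr
      exact (mem_ball.1 (hDr hu)).le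
    rw [mem_ball]
    linarith [dist_triangle (h u) (x n) (f^[t] v)]
  set C : ℝ := 1 / sphDeriv f^[t] v + 1 with hC
  have hC0 : 0 < C := by positivity
  have hinv : ∀ u ∈ D, f^[N * n + t] (g (h u)) = u := fun u hu => by
    rw [Function.iterate_add_apply, (hg _ (hhD u hu)).2, h2 u (hDr hu)]
  have hlip : ∀ u ∈ D, ∀ w ∈ D, dist (g (h u)) (g (h w)) ≤ C * dist u w := fun u hu w hw => by
    refine (hglip _ (hhD u hu) _ (hhD w hw)).trans ?_
    gcongr
    exact (h3 u (hDr hu) w (hDr hw)).trans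
      (mul_le_of_le_one_left dist_nonneg (pow_le_one₀ (by norm_num) (by norm_num)))
  obtain ⟨A, hA⟩ := hf.exists_birkhoff_bound (g := g ∘ h) (fun u hu => hD.accPt hu) hC0 hinv hlip d
  exact ⟨_, g ∘ h, C, A, hC0, fun u hu => (hg _ (hhD u hu)).1, hinv, hlip, hA⟩

/-- Branches from neighbourhoods of points of expanding sets into a fixed domain. -/
lemma exists_exit (hf : ConformalMap f)
    (hexc : ¬ IsExceptional f ∨ maxExceptional f ∩ juliaSet f = ∅)
    (hL₀ : IsExpandingSet f L₀) (hz₀ : z₀ ∈ L₀) (hD : D ∈ 𝓝 z₀) (hL : IsExpandingSet f L)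
    (hw : w ∈ L) (d : ℝ) :
    ∃ ρ > 0, ∃ (t : ℕ) (g : RSphere → RSphere) (C A : ℝ), 0 < C ∧ MapsTo g (ball w ρ) D ∧
      (∀ u ∈ ball w ρ, f^[t] (g u) = u) ∧
      (∀ u ∈ ball w ρ, ∀ v ∈ ball w ρ, dist (g u) (g v) ≤ C * dist u v) ∧
      ∀ u ∈ ball w ρ, -A ≤ birkhoff f (geomPot f d) t (g u) := by
  obtain ⟨v, hvD, t, rfl, hvt⟩ := hf.exists_bridge hexc hL hL₀ hw hz₀ (interior_mem_nhds.2 hD)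
  have hl : 0 < sphDeriv f^[t] v := lt_of_le_of_ne ((hf.iterate t).sphDeriv_nonneg v) hvt.symm
  obtain ⟨ρ, hρ, g, hg, hglip, -⟩ := ((hf.iterate t).smd v).exists_local_inverse hl
    ((hf.iterate t).nhds_le v hvt) (lt_add_one _) (mem_interior_iff_mem_nhds.1 hvD)
  have hC0 : 0 < 1 / sphDeriv f^[t] v + 1 := by positivity
  obtain ⟨A, hA⟩ := hf.exists_birkhoff_bound (g := g)
    (fun u hu => accPt_of_mem_nhds (isOpen_ball.mem_nhds hu)) hC0 (fun u hu => (hg u hu).2) hglip d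
  exact ⟨ρ, hρ, t, g, _, A, hC0, fun u hu => (hg u hu).1, fun u hu => (hg u hu).2, hglip, hA⟩

end ConformalMap

namespace ConformalMap

variable {f : RSphere → RSphere} {L₀ : Set RSphere} {z₀ : RSphere}

lemma _root_.Finset.exists_real_bound {α : Type*} (s : Finset α) (F : α → ℝ) :
    ∃ M, ∀ x ∈ s, F x ≤ M := by
  classical
  obtain ⟨M, hM⟩ := (s.image F).bddAbove
  exact ⟨M, fun x hx => hM (Finset.mem_coe.2 (Finset.mem_image_of_mem F hx))⟩

/-- The systems of return branches to a suitable domain approximate the pressure on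
every expanding set. -/
lemma exists_branchDomain (hf : ConformalMap f)
    (hexc : ¬ IsExceptional f ∨ maxExceptional f ∩ juliaSet f = ∅)
    (hL₀ : IsExpandingSet f L₀) (hz₀ : z₀ ∈ L₀) :
    ∃ D, IsBranchDomain D ∧ ∀ L, IsExpandingSet f L → ∀ d p, p < normPress f 1 L d →
      ∃ a > 0, (returnLimit f D a).Nonempty ∧
        ∀ k > 0, p ≤ normPress f (a * k) (returnLimit f D (a * k)) d := by
  classical
  obtain ⟨r₀, hr₀, hent⟩ := hf.exists_entrance hexc hL₀ hz₀
  obtain ⟨D, hDz, hDr, hDc, hDp⟩ := exists_compact_connected_nhd (ball_mem_nhds z₀ hr₀)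
  have hDn : D.Nontrivial := by
    obtain ⟨y, hy, hne⟩ := accPt_iff_nhds.1 (accPt_of_mem_nhds hDz) univ univ_mem
    exact ⟨y, hy.2, z₀, mem_of_mem_nhds hDz, hne⟩
  have hD : IsBranchDomain D := ⟨hDc, hDp, hDn⟩
  refine ⟨D, hD, fun L hL d p hp => ?_⟩
  rw [normPress_one] at hp
  obtain ⟨K, hK1, hK⟩ := hf.exists_lipschitz
  have hexp1 : ExpandingOn f^[1] L := by rw [Function.iterate_one]; exact hL.2.2.2.2
  obtain ⟨_, hpb⟩ := hf.pressureBounds hK1 hK hexp1 d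
  rw [Function.iterate_one, show birkhoff f (geomPot f d) 1 = geomPot f d by
    funext x; simp [birkhoff]] at hpb
  obtain ⟨η, hη, hPη⟩ : ∃ η > 0, p + 2 * η < pressureOn f L (geomPot f d) - η :=
    ⟨(pressureOn f L (geomPot f d) - p) / 4, by linarith, by linarith⟩
  set q := p + 2 * η + η with hq
  obtain ⟨ε, hε, hfreq⟩ := hpb.frequently_lt_sum hL.1 (p := q) (by linarith)
  obtain ⟨N, hN, r₁, hr₁, B, hshadow⟩ := hf.exists_shadowing_branches hL d hη (half_pos hε)
  have hexit := fun w (hw : w ∈ L) => hf.exists_exit hexc hL₀ hz₀ hDz hL hw d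
  choose! ρ hρ t g₂ C₂ A₂ hC₂ hg₂D hg₂inv hg₂lip hA₂ using hexit
  obtain ⟨T, hTL, hTcov⟩ := hL.2.2.1.elim_nhds_subcover (fun w => ball w (ρ w / 2))
    fun w hw => ball_mem_nhds _ (half_pos (hρ w hw))
  obtain ⟨r', hr'T, hr'0, hr'1⟩ : ∃ r', (∀ w ∈ T, r' ≤ ρ w / 2) ∧ 0 < r' ∧ r' ≤ r₁ := by
    have h1 : ∀ᶠ r' in 𝓝[>] (0 : ℝ), ∀ w ∈ T, r' ≤ ρ w / 2 := (Finset.eventually_all T).2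
      fun w hw =>
        (eventually_mem_set.2 (Ioc_mem_nhdsGT (half_pos (hρ w (hTL w hw))))).mono fun _ h => h.2
    exact (h1.and (Ioc_mem_nhdsGT hr₁)).exists
  have hentr := fun y (hy : y ∈ L) =>
    hent D hDr hD L hL y hy (ball y (r' / 2)) (ball_mem_nhds _ (half_pos hr'0)) d
  choose! s g₁ C₁ A₁ hC₁ hg₁V hg₁inv hg₁lip hA₁ using hentr
  obtain ⟨S, hSL, hScov⟩ := hL.2.2.1.elim_nhds_subcover (fun y => ball y (r' / 2))
    fun y _ => ball_mem_nhds _ (half_pos hr'0)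
  obtain ⟨Mₐ, hMₐ⟩ := (S ×ˢ T).exists_real_bound fun i => (s i.1 + t i.2 : ℝ)
  obtain ⟨M₁, hM₁⟩ := (S ×ˢ T).exists_real_bound fun i => C₂ i.2 * C₁ i.1
  obtain ⟨M₂, hM₂⟩ := (S ×ˢ T).exists_real_bound fun i => A₁ i.1 + A₂ i.2
  have hlarge : ∀ᶠ m : ℕ in atTop, M₁ * (1 / 2) ^ (m / N + 1) ≤ 1 / 2 := by
    have h1 : Tendsto (fun k : ℕ => M₁ * (1 / 2 : ℝ) ^ k) atTop (𝓝 0) := by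
      simpa using (tendsto_pow_atTop_nhds_zero_of_lt_one (by norm_num)
        (by norm_num : (1 / 2 : ℝ) < 1)).const_mul M₁
    have h2 : Tendsto (fun m : ℕ => m / N + 1) atTop atTop :=
      (tendsto_add_atTop_nat 1).comp (Nat.tendsto_div_const_atTop hN.ne')
    exact (h1.comp h2).eventually (ge_mem_nhds (by norm_num))
  have hlarge' : ∀ᶠ m : ℕ in atTop,
      |p| * (N + Mₐ) + Real.log (S ×ˢ T).card + M₂ + B ≤ 2 * η * m :=
    (tendsto_natCast_atTop_atTop.const_mul_atTop (by positivity)).eventually_ge_atTop _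
  obtain ⟨m, ⟨E, ⟨hEL, hsep⟩, hsum⟩, hm1, hm2⟩ :=
    (hfreq.and_eventually (hlarge.and hlarge')).exists
  choose! h hinv hlip hsh using hshadow m
  set k := m / N + 1 with hk
  have hmk : m < N * k := Nat.lt_mul_div_succ m hN
  have hkm : N * k ≤ m + N := by
    rw [hk, mul_add, mul_one]
    exact Nat.add_le_add_right (Nat.mul_div_le m N) N
  have hfL : MapsTo f L L := mapsTo_iff_image_subset.2 hL.2.2.2.1.subset
  have hY : ∀ x ∈ E, ∃ y ∈ S, f^[N * k] x ∈ ball y (r' / 2) := fun x hx => by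
    simpa only [mem_iUnion, exists_prop] using hScov (hfL.iterate (N * k) (hEL hx))
  have hW : ∀ x ∈ E, ∃ w ∈ T, x ∈ ball w (ρ w / 2) := fun x hx => by
    simpa only [mem_iUnion, exists_prop] using hTcov (hEL hx)
  choose! Y hYS hYb using hY
  choose! W hWT hWb using hW
  have hmaps : ∀ x ∈ E, (Y x, W x) ∈ S ×ˢ T := fun x hx =>
    Finset.mem_product.2 ⟨hYS x hx, hWT x hx⟩
  have hEne : E.Nonempty := by
    by_contra hcon
    rw [Finset.not_nonempty_iff_eq_empty] at hcon
    rw [hcon, Finset.sum_empty] at hsum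
    exact absurd hsum (Real.exp_pos _).not_gt
  have hcard : (0 : ℝ) < (S ×ˢ T).card := by
    obtain ⟨x, hx⟩ := hEne
    exact_mod_cast Finset.card_pos.2 ⟨_, hmaps x hx⟩
  obtain ⟨⟨y, w⟩, hyw, hfiber⟩ : ∃ i ∈ S ×ˢ T, Real.exp (m * q) / (S ×ˢ T).card <
      ∑ x ∈ E with (Y x, W x) = i, Real.exp (birkhoff f (geomPot f d) m x) := by
    refine Finset.exists_lt_of_sum_lt ?_
    rw [Finset.sum_fiberwise_of_maps_to hmaps, Finset.sum_const, nsmul_eq_mul,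
      mul_div_cancel₀ _ hcard.ne']
    exact hsum
  obtain ⟨hyS, hwT⟩ := Finset.mem_product.1 hyw
  have hyL := hSL y hyS
  have hwL := hTL w hwT
  set E' := E.filter fun x => (Y x, W x) = (y, w) with hE'
  have hE'E : ∀ x ∈ E', x ∈ E ∧ f^[N * k] x ∈ ball y (r' / 2) ∧ x ∈ ball w (ρ w / 2) := by
    intro x hx
    obtain ⟨hxE, hxyw⟩ := Finset.mem_filter.1 hx
    obtain ⟨rfl, rfl⟩ := Prod.mk.inj hxyw
    exact ⟨hxE, hYb x hxE, hWb x hxE⟩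
  have hE'ne : E'.Nonempty := by
    by_contra hcon
    rw [Finset.not_nonempty_iff_eq_empty] at hcon
    rw [hcon, Finset.sum_empty] at hfiber
    exact absurd hfiber (div_pos (Real.exp_pos _) hcard).not_gt
  have hg₁ball : ∀ x ∈ E', ∀ u ∈ D, g₁ y u ∈ ball (f^[N * k] x) r' := by
    intro x hx u hu
    have h1 := mem_ball.1 (hg₁V y hyL hu)
    have h2 := mem_ball'.1 (hE'E x hx).2.1
    rw [mem_ball]
    linarith [dist_triangle (g₁ y u) y (f^[N * k] x)]
  have hg₁ball' : ∀ x ∈ E', ∀ u ∈ D, g₁ y u ∈ ball (f^[N * k] x) r₁ := fun x hx u hu =>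
    ball_subset_ball hr'1 (hg₁ball x hx u hu)
  have hball : ∀ x ∈ E', ∀ u ∈ D, h x (g₁ y u) ∈ ball w (ρ w) := by
    intro x hx u hu
    have h1 := (hsh x (hEL (hE'E x hx).1) _ (hg₁ball' x hx u hu)).1
    have h2 := mem_ball.1 (hg₁ball x hx u hu)
    have h3 := hr'T w hwT
    have h4 := mem_ball.1 (hE'E x hx).2.2
    rw [mem_ball]
    linarith [dist_triangle (h x (g₁ y u)) x w]
  set a := s y + (N * k + t w) with ha
  have hapos : 0 < a := by omega
  have hbr : ∀ x ∈ E', IsReturnBranch f D a fun u => g₂ w (h x (g₁ y u)) := by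
    intro x hx
    have hxL := hEL (hE'E x hx).1
    refine ⟨fun u hu => hg₂D w hwL (hball x hx u hu), fun u hu => ?_, fun u hu v hv => ?_⟩
    · rw [ha, Function.iterate_add_apply, Function.iterate_add_apply,
        hg₂inv w hwL _ (hball x hx u hu), hinv x hxL _ (hg₁ball' x hx u hu), hg₁inv y hyL u hu]
    · calc dist (g₂ w (h x (g₁ y u))) (g₂ w (h x (g₁ y v)))
          ≤ C₂ w * dist (h x (g₁ y u)) (h x (g₁ y v)) :=
            hg₂lip w hwL _ (hball x hx u hu) _ (hball x hx v hv)
        _ ≤ C₂ w * ((1 / 2) ^ k * dist (g₁ y u) (g₁ y v)) := by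
            have := (hC₂ w hwL).le
            gcongr
            exact hlip x hxL _ (hg₁ball' x hx u hu) _ (hg₁ball' x hx v hv)
        _ ≤ C₂ w * ((1 / 2) ^ k * (C₁ y * dist u v)) := by
            have := (hC₂ w hwL).le
            gcongr
            exact hg₁lip y hyL u hu v hv
        _ = C₂ w * C₁ y * (1 / 2) ^ k * dist u v := by ring
        _ ≤ M₁ * (1 / 2) ^ k * dist u v := by
            gcongr
            exact hM₁ (y, w) hyw
        _ ≤ 1 / 2 * dist u v := by gcongr
  have hdis : ∀ x ∈ E', ∀ x' ∈ E', x ≠ x' → ∀ u ∈ D,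
      g₂ w (h x (g₁ y u)) ≠ g₂ w (h x' (g₁ y u)) := by
    intro x hx x' hx' hne u hu heq
    have h1 := congrArg f^[t w] heq
    rw [hg₂inv w hwL _ (hball x hx u hu), hg₂inv w hwL _ (hball x' hx' u hu)] at h1
    obtain ⟨i, hi, hdi⟩ := hsep x (hE'E x hx).1 x' (hE'E x' hx').1 hne
    have h2 := (hsh x (hEL (hE'E x hx).1) _ (hg₁ball' x hx u hu)).2.1 i hi
    have h3 := (hsh x' (hEL (hE'E x' hx').1) _ (hg₁ball' x' hx' u hu)).2.1 i hi
    rw [← h1] at h3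
    rw [dist_comm] at h2
    linarith [dist_triangle (f^[i] x) (f^[i] (h x (g₁ y u))) (f^[i] x')]
  set c : RSphere → ℝ := fun x =>
    Real.exp (-(M₂ + B + η * m)) * Real.exp (birkhoff f (geomPot f d) m x) with hc
  have hcle : ∀ x ∈ E', ∀ u ∈ D,
      c x ≤ Real.exp (birkhoff f (geomPot f d) a (g₂ w (h x (g₁ y u)))) := by
    intro x hx u hu
    have hxL := hEL (hE'E x hx).1
    simp only [hc]
    rw [← Real.exp_add, Real.exp_le_exp, show a = t w + (N * k + s y) by omega,
      birkhoff_add, birkhoff_add, hg₂inv w hwL _ (hball x hx u hu),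
      hinv x hxL _ (hg₁ball' x hx u hu)]
    have h1 := hA₂ w hwL _ (hball x hx u hu)
    have h2 := (hsh x hxL _ (hg₁ball' x hx u hu)).2.2
    have h3 := hA₁ y hyL u hu
    have h4 : A₁ y + A₂ w ≤ M₂ := hM₂ (y, w) hyw
    linarith
  have : Nonempty E' := hE'ne.to_subtype
  refine ⟨a, hapos, ?_, fun j hj => ?_⟩
  · obtain ⟨x, hx⟩ := hE'ne
    exact (hbr x hx).nonempty_returnLimit hD
  refine le_trans ?_ (log_sum_le_normPress hf hD hapos (ι := E')
    (h := fun x u => g₂ w (h x (g₁ y u))) (c := fun x => c x) (fun x => hbr x x.2)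
    (fun x x' hne => hdis x x.2 x' x'.2 fun he => hne (Subtype.ext he))
    (fun x => by positivity) (fun x => hcle x x.2) hj)
  have haR : (0 : ℝ) < a := by exact_mod_cast hapos
  rw [Finset.sum_coe_sort E' c, le_div_iff₀ haR, hc, ← Finset.mul_sum]
  have h1 : Real.exp (-(M₂ + B + η * m)) * (Real.exp (m * q) / (S ×ˢ T).card) ≤
      Real.exp (-(M₂ + B + η * m)) *
        ∑ x ∈ E', Real.exp (birkhoff f (geomPot f d) m x) := by gcongr
  refine le_trans ?_ (Real.log_le_log (by positivity) h1)
  rw [Real.log_mul (Real.exp_pos _).ne' (div_pos (Real.exp_pos _) hcard).ne',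
    Real.log_div (Real.exp_pos _).ne' hcard.ne', Real.log_exp, Real.log_exp]
  have h2 : (s y + t w : ℝ) ≤ Mₐ := hMₐ (y, w) hyw
  have h3 : p * (a - m) ≤ |p| * (N + Mₐ) := by
    have h4 : (m : ℝ) ≤ a := by exact_mod_cast (by omega : m ≤ a)
    have h5 : (a : ℝ) ≤ m + N + (s y + t w) := by exact_mod_cast (by omega : a ≤ m + N + (s y + t w))
    exact mul_le_mul (le_abs_self p) (by linarith) (by linarith) (abs_nonneg p)
  rw [hq]
  nlinarith

end ConformalMap

/-! ### Convergence of convex pressure functions and of their Legendre transforms -/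

lemma ConvexOn.exists_tendsto_div {T : ℝ → ℝ} (hT : ConvexOn ℝ univ T) {M : ℝ}
    (hM : ∀ s > 0, (T s - T 0) / s ≤ M) :
    ∃ β ≤ M, Tendsto (fun s => T s / s) atTop (𝓝 β) ∧ ∀ s > 0, (T s - T 0) / s ≤ β := by
  have hmono : ∀ s > 0, ∀ t, s ≤ t → (T s - T 0) / s ≤ (T t - T 0) / t := by
    intro s hs t hst
    have := hT.secant_mono (mem_univ 0) (mem_univ s) (mem_univ t) hs.ne' (hs.trans_le hst).ne' hst
    simpa only [sub_zero] using this
  have hG : Monotone fun s : ℝ => (T (max s 1) - T 0) / max s 1 := fun s t hst =>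
    hmono _ (lt_max_of_lt_right one_pos) _ (max_le_max_right 1 hst)
  have hb : BddAbove (range fun s : ℝ => (T (max s 1) - T 0) / max s 1) :=
    ⟨M, by rintro _ ⟨s, rfl⟩; exact hM _ (lt_max_of_lt_right one_pos)⟩
  have hlim := tendsto_atTop_ciSup hG hb
  set β := ⨆ s : ℝ, (T (max s 1) - T 0) / max s 1
  have hlim' : Tendsto (fun s => (T s - T 0) / s) atTop (𝓝 β) := by
    refine hlim.congr' ?_
    filter_upwards [eventually_ge_atTop 1] with s hs
    rw [max_eq_left hs]
  refine ⟨β, ciSup_le fun s => hM _ (lt_max_of_lt_right one_pos), ?_, fun s hs => ?_⟩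
  · have h1 : Tendsto (fun s : ℝ => T 0 / s) atTop (𝓝 0) := tendsto_const_nhds.div_atTop tendsto_id
    have h2 := hlim'.add h1
    rw [add_zero] at h2
    refine h2.congr fun s => ?_
    rw [← add_div, sub_add_cancel]
  · refine ge_of_tendsto hlim' ?_
    filter_upwards [eventually_ge_atTop s] with t ht using hmono s hs t ht

lemma alphaMinusOf_spec {R : ℝ → ℝ} (hR : ConvexOn ℝ univ R) (ha : Antitone R) :
    Tendsto (fun d => -R d / d) atTop (𝓝 (alphaMinusOf R)) ∧ 0 ≤ alphaMinusOf R ∧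
      ∀ d > 0, alphaMinusOf R ≤ (R 0 - R d) / d := by
  obtain ⟨β, hβ, hlim, hle⟩ := hR.exists_tendsto_div (M := 0) fun s hs =>
    div_nonpos_of_nonpos_of_nonneg (sub_nonpos.2 (ha hs.le)) hs.le
  have h1 : Tendsto (fun d => -R d / d) atTop (𝓝 (-β)) := by
    simpa only [neg_div] using hlim.neg
  have h2 : alphaMinusOf R = -β := h1.limsup_eq
  rw [h2]
  refine ⟨h1, by linarith, fun d hd => ?_⟩
  have := hle d hd
  rw [← neg_sub, neg_div]
  linarith

lemma alphaPlusOf_spec {R : ℝ → ℝ} (hR : ConvexOn ℝ univ R) {C κ : ℝ}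
    (hC : ∀ s ≥ 0, R (-s) ≤ C + κ * s) :
    Tendsto (fun d => -R d / d) atBot (𝓝 (alphaPlusOf R)) ∧
      ∀ s > 0, (R (-s) - R 0) / s ≤ alphaPlusOf R := by
  have hconv : ConvexOn ℝ univ fun s => R (-s) :=
    hR.comp_linearMap (-LinearMap.id)
  have hmono : ∀ s > 0, ∀ t, s ≤ t → (R (-s) - R 0) / s ≤ (R (-t) - R 0) / t := by
    intro s hs t hst
    have := hconv.secant_mono (mem_univ 0) (mem_univ s) (mem_univ t) hs.ne' (hs.trans_le hst).ne' hst
    simpa only [sub_zero, neg_zero] using this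
  obtain ⟨β, -, hlim, hle⟩ := hconv.exists_tendsto_div (M := |C - R 0| + κ) fun s hs => by
    rw [neg_zero]
    refine (hmono s hs (max s 1) (le_max_left _ _)).trans ?_
    have h1 : (1 : ℝ) ≤ max s 1 := le_max_right _ _
    rw [div_le_iff₀ (by linarith)]
    have h2 := hC (max s 1) (by linarith)
    nlinarith [le_abs_self (C - R 0), abs_nonneg (C - R 0)]
  have h1 : Tendsto (fun d => -R d / d) atBot (𝓝 β) := by
    refine (hlim.comp tendsto_neg_atBot_atTop).congr fun d => ?_
    simp only [Function.comp_apply, neg_neg, div_neg, neg_div]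
  have h2 : alphaPlusOf R = β := h1.limsup_eq
  rw [h2]
  exact ⟨h1, fun s hs => by simpa only [neg_zero] using hle s hs⟩

/-- A sequence of convex decreasing functions approximating a function from below. -/
structure ConvexApprox (Q : ℕ → ℝ → ℝ) (P : ℝ → ℝ) (C κ : ℝ) : Prop where
  convex : ∀ m, ConvexOn ℝ univ (Q m)
  antitone : ∀ m, Antitone (Q m)
  le : ∀ m d, Q m d ≤ P d
  eventually_le : ∀ d, ∀ p < P d, ∀ᶠ m in atTop, p ≤ Q m d
  bound : ∀ s ≥ 0, P (-s) ≤ C + κ * s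

namespace ConvexApprox

variable {Q : ℕ → ℝ → ℝ} {P : ℝ → ℝ} {C κ : ℝ}

lemma tendsto (h : ConvexApprox Q P C κ) (d : ℝ) :
    Tendsto (fun m => Q m d) atTop (𝓝 (P d)) := by
  refine tendsto_order.2 ⟨fun p hp => ?_, fun p hp => Eventually.of_forall fun m =>
    (h.le m d).trans_lt hp⟩
  obtain ⟨p', h1, h2⟩ := exists_between hp
  exact (h.eventually_le d p' h2).mono fun m hm => h1.trans_le hm

lemma iSup_eq (h : ConvexApprox Q P C κ) (d : ℝ) : ⨆ m, Q m d = P d :=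
  le_antisymm (ciSup_le fun m => h.le m d) (le_of_tendsto' (h.tendsto d) fun m =>
    le_ciSup (f := fun m => Q m d) ⟨P d, by rintro _ ⟨m, rfl⟩; exact h.le m d⟩ m)

lemma convexOn_limit (h : ConvexApprox Q P C κ) : ConvexOn ℝ univ P := by
  refine ⟨convex_univ, fun x _ y _ a b ha hb hab => ?_⟩
  exact le_of_tendsto_of_tendsto' (h.tendsto _)
    (((h.tendsto x).const_smul a).add ((h.tendsto y).const_smul b))
    fun m => (h.convex m).2 (mem_univ x) (mem_univ y) ha hb hab

lemma antitone_limit (h : ConvexApprox Q P C κ) : Antitone P := fun x y hxy =>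
  le_of_tendsto_of_tendsto' (h.tendsto y) (h.tendsto x) fun m => h.antitone m hxy

lemma alphaMinus_le (h : ConvexApprox Q P C κ) (m : ℕ) : alphaMinusOf P ≤ alphaMinusOf (Q m) := by
  refine le_of_tendsto_of_tendsto (alphaMinusOf_spec h.convexOn_limit h.antitone_limit).1
    (alphaMinusOf_spec (h.convex m) (h.antitone m)).1 ?_
  filter_upwards [eventually_gt_atTop 0] with d hd
  have := h.le m d
  gcongr

lemma tendsto_alphaMinus (h : ConvexApprox Q P C κ) :
    Tendsto (fun m => alphaMinusOf (Q m)) atTop (𝓝 (alphaMinusOf P)) := by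
  refine tendsto_order.2 ⟨fun p hp => Eventually.of_forall fun m =>
    hp.trans_le (h.alphaMinus_le m), fun p hp => ?_⟩
  have h1 := (alphaMinusOf_spec h.convexOn_limit h.antitone_limit).1
  have h2 : Tendsto (fun d : ℝ => P 0 / d) atTop (𝓝 0) := tendsto_const_nhds.div_atTop tendsto_id
  have h3 := h2.add h1
  rw [zero_add] at h3
  obtain ⟨d, hdp, hd⟩ := ((h3.eventually (gt_mem_nhds hp)).and (eventually_gt_atTop 0)).exists
  rw [← add_div, ← sub_eq_add_neg] at hdp
  have h4 : Tendsto (fun m => (Q m 0 - Q m d) / d) atTop (𝓝 ((P 0 - P d) / d)) :=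
    ((h.tendsto 0).sub (h.tendsto d)).div_const d
  filter_upwards [h4.eventually (gt_mem_nhds hdp)] with m hm
  exact ((alphaMinusOf_spec (h.convex m) (h.antitone m)).2.2 d hd).trans_lt hm

lemma iInf_alphaMinus (h : ConvexApprox Q P C κ) :
    ⨅ m, alphaMinusOf (Q m) = alphaMinusOf P :=
  le_antisymm (ge_of_tendsto' h.tendsto_alphaMinus fun m =>
    ciInf_le ⟨alphaMinusOf P, by rintro _ ⟨m, rfl⟩; exact h.alphaMinus_le m⟩ m)
    (le_ciInf h.alphaMinus_le)

lemma alphaPlusOf_spec (h : ConvexApprox Q P C κ) (m : ℕ) :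
    Tendsto (fun d => -Q m d / d) atBot (𝓝 (alphaPlusOf (Q m))) ∧
      ∀ s > 0, (Q m (-s) - Q m 0) / s ≤ alphaPlusOf (Q m) :=
  _root_.alphaPlusOf_spec (h.convex m) fun s hs => (h.le m _).trans (h.bound s hs)

lemma alphaPlus_le (h : ConvexApprox Q P C κ) (m : ℕ) : alphaPlusOf (Q m) ≤ alphaPlusOf P := by
  refine le_of_tendsto_of_tendsto (h.alphaPlusOf_spec m).1
    (_root_.alphaPlusOf_spec h.convexOn_limit h.bound).1 ?_
  filter_upwards [eventually_lt_atBot 0] with d hd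
  exact (div_le_div_right_of_neg hd).2 (neg_le_neg (h.le m d))

lemma tendsto_alphaPlus (h : ConvexApprox Q P C κ) :
    Tendsto (fun m => alphaPlusOf (Q m)) atTop (𝓝 (alphaPlusOf P)) := by
  refine tendsto_order.2 ⟨fun p hp => ?_, fun p hp => Eventually.of_forall fun m =>
    (h.alphaPlus_le m).trans_lt hp⟩
  have h1 := (_root_.alphaPlusOf_spec h.convexOn_limit h.bound).1
  have h2 : Tendsto (fun d : ℝ => P 0 / d) atBot (𝓝 0) := tendsto_const_nhds.div_atBot tendsto_id
  have h3 := h2.add h1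
  rw [zero_add] at h3
  obtain ⟨d, hdp, hd⟩ := ((h3.eventually (lt_mem_nhds hp)).and (eventually_lt_atBot 0)).exists
  rw [← add_div, ← sub_eq_add_neg] at hdp
  have h4 : Tendsto (fun m => (Q m 0 - Q m d) / d) atTop (𝓝 ((P 0 - P d) / d)) :=
    ((h.tendsto 0).sub (h.tendsto d)).div_const d
  filter_upwards [h4.eventually (lt_mem_nhds hdp)] with m hm
  have h5 := (h.alphaPlusOf_spec m).2 (-d) (by linarith)
  rw [neg_neg, div_neg, ← neg_div, neg_sub] at h5
  exact hm.trans_le h5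

lemma iSup_alphaPlus (h : ConvexApprox Q P C κ) :
    ⨆ m, alphaPlusOf (Q m) = alphaPlusOf P :=
  le_antisymm (ciSup_le h.alphaPlus_le) (le_of_tendsto' h.tendsto_alphaPlus fun m =>
    le_ciSup (f := fun m => alphaPlusOf (Q m))
      ⟨alphaPlusOf P, by rintro _ ⟨m, rfl⟩; exact h.alphaPlus_le m⟩ m)

lemma le_specF (h : ConvexApprox Q P C κ) {α : ℝ} (hα : 0 < α) (m : ℕ) :
    specF (Q m) α ≤ specF P α := by
  refine mul_le_mul_of_nonneg_left ?_ (by exact_mod_cast (inv_pos.2 hα).le)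
  refine iInf_mono fun d => ?_
  exact_mod_cast add_le_add_left (h.le m d) _

lemma eventually_le_add (h : ConvexApprox Q P C κ) {α c c' : ℝ} (hα : alphaMinusOf P < α)
    (hα' : α < alphaPlusOf P) (hcc' : c < c') (hc : ∀ d, c' < P d + d * α) :
    ∀ᶠ m in atTop, ∀ d, c ≤ Q m d + d * α := by
  have hspec := alphaMinusOf_spec h.convexOn_limit h.antitone_limit
  have hspec' := _root_.alphaPlusOf_spec h.convexOn_limit h.bound
  have hα0 : 0 < α := hspec.2.1.trans_lt hα
  have hlim : ∀ d, Tendsto (fun m => Q m d + d * α) atTop (𝓝 (P d + d * α)) := fun d =>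
    (h.tendsto d).add_const _
  obtain ⟨d₁, hd₁, hd₁P⟩ : ∃ d > 0, P 0 < P d + d * α := by
    have h2 : Tendsto (fun d : ℝ => P 0 / d) atTop (𝓝 0) := tendsto_const_nhds.div_atTop tendsto_id
    have h3 := h2.add hspec.1
    rw [zero_add] at h3
    obtain ⟨d, hdp, hd⟩ := ((h3.eventually (gt_mem_nhds hα)).and (eventually_gt_atTop 0)).exists
    refine ⟨d, hd, ?_⟩
    rw [← add_div, div_lt_iff₀ hd] at hdp
    linarith
  obtain ⟨d₂, hd₂, hd₂P⟩ : ∃ d < 0, P 0 < P d + d * α := by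
    have h2 : Tendsto (fun d : ℝ => P 0 / d) atBot (𝓝 0) := tendsto_const_nhds.div_atBot tendsto_id
    have h3 := h2.add hspec'.1
    rw [zero_add] at h3
    obtain ⟨d, hdp, hd⟩ := ((h3.eventually (lt_mem_nhds hα')).and (eventually_lt_atBot 0)).exists
    refine ⟨d, hd, ?_⟩
    rw [← add_div, lt_div_iff_of_neg hd] at hdp
    linarith
  set δ := (c' - c) / α with hδ
  have hδ0 : 0 < δ := div_pos (by linarith) hα0
  have hδα : δ * α = c' - c := div_mul_cancel₀ _ hα0.ne'
  have hnet : ∀ᶠ m in atTop, ∀ j ∈ Finset.Icc ⌈d₂ / δ⌉ ⌈d₁ / δ⌉,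
      c' ≤ Q m (j * δ) + (j * δ) * α := (Finset.eventually_all _).2 fun j _ =>
    (hlim (j * δ)).eventually (le_mem_nhds (hc _))
  have h0 : ∀ᶠ m in atTop, c' ≤ Q m 0 + 0 * α := (hlim 0).eventually (le_mem_nhds (hc 0))
  have h1 : ∀ᶠ m in atTop, Q m 0 < Q m d₁ + d₁ * α :=
    (h.tendsto 0).eventually_lt (hlim d₁) hd₁P
  have h2 : ∀ᶠ m in atTop, Q m 0 < Q m d₂ + d₂ * α :=
    (h.tendsto 0).eventually_lt (hlim d₂) hd₂P
  filter_upwards [hnet, h0, h1, h2] with m hm hm0 hm1 hm2 d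
  rcases lt_or_ge d d₂ with hd | hd
  · have h3 := (h.convex m).secant_mono (mem_univ 0) (mem_univ d) (mem_univ d₂)
      (hd.trans hd₂).ne hd₂.ne hd.le
    rw [sub_zero, sub_zero, div_le_iff_of_neg (hd.trans hd₂)] at h3
    have h4 : (Q m d₂ - Q m 0) / d₂ < -α := by
      rw [div_lt_iff_of_neg hd₂]
      linarith
    nlinarith [hd.trans hd₂]
  rcases le_or_gt d d₁ with hd' | hd'
  · have h3 := hm ⌈d / δ⌉ (Finset.mem_Icc.2
      ⟨Int.ceil_mono (by gcongr), Int.ceil_mono (by gcongr)⟩)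
    have h4 : d ≤ ⌈d / δ⌉ * δ := (div_le_iff₀ hδ0).1 (Int.le_ceil _)
    have h5 : ⌈d / δ⌉ * δ ≤ d + δ := by
      have := mul_le_mul_of_nonneg_right (Int.ceil_lt_add_one (d / δ)).le hδ0.le
      rwa [add_mul, div_mul_cancel₀ _ hδ0.ne', one_mul] at this
    have h6 := h.antitone m h4
    nlinarith
  · have h3 := (h.convex m).secant_mono (mem_univ 0) (mem_univ d₁) (mem_univ d)
      hd₁.ne' (hd₁.trans hd').ne' hd'.le
    rw [sub_zero, sub_zero, le_div_iff₀ (hd₁.trans hd')] at h3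
    have h4 : -α < (Q m d₁ - Q m 0) / d₁ := by
      rw [lt_div_iff₀ hd₁]
      linarith
    nlinarith [hd₁.trans hd']

lemma tendsto_specF (h : ConvexApprox Q P C κ) {α : ℝ} (hα : alphaMinusOf P < α)
    (hα' : α < alphaPlusOf P) : Tendsto (fun m => specF (Q m) α) atTop (𝓝 (specF P α)) := by
  have hα0 : 0 < α :=
    (alphaMinusOf_spec h.convexOn_limit h.antitone_limit).2.1.trans_lt hα
  have hinv : ((α⁻¹ : ℝ) : EReal) ≠ 0 := by exact_mod_cast (inv_pos.2 hα0).ne'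
  have hI : Tendsto (fun m => ⨅ d : ℝ, ((Q m d + d * α : ℝ) : EReal)) atTop
      (𝓝 (⨅ d : ℝ, ((P d + d * α : ℝ) : EReal))) := by
    refine tendsto_order.2 ⟨fun p hp => ?_, fun p hp => Eventually.of_forall fun m =>
      lt_of_le_of_lt (iInf_mono fun d => ?_) hp⟩
    · obtain ⟨c, hpc, hc⟩ := EReal.lt_iff_exists_real_btwn.1 hp
      obtain ⟨c', hcc', hc'⟩ := EReal.lt_iff_exists_real_btwn.1 hc
      filter_upwards [h.eventually_le_add hα hα' (EReal.coe_lt_coe_iff.1 hcc') fun d =>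
        EReal.coe_lt_coe_iff.1 (hc'.trans_le (iInf_le _ d))] with m hm
      exact hpc.trans_le (le_iInf fun d => EReal.coe_le_coe_iff.2 (hm d))
    · exact_mod_cast add_le_add_left (h.le m d) _
  have hcont := EReal.continuousAt_mul
    (p := (((α⁻¹ : ℝ) : EReal), ⨅ d : ℝ, ((P d + d * α : ℝ) : EReal)))
    (Or.inl hinv) (Or.inl hinv) (Or.inl (EReal.coe_ne_bot _)) (Or.inl (EReal.coe_ne_top _))
  exact hcont.tendsto.comp (tendsto_const_nhds.prodMk_nhds hI)

lemma iSup_specF (h : ConvexApprox Q P C κ) {α : ℝ} (hα : alphaMinusOf P < α)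
    (hα' : α < alphaPlusOf P) : ⨆ m, specF (Q m) α = specF P α := by
  have hα0 : 0 < α :=
    (alphaMinusOf_spec h.convexOn_limit h.antitone_limit).2.1.trans_lt hα
  exact le_antisymm (iSup_le (h.le_specF hα0)) (le_of_tendsto' (h.tendsto_specF hα hα')
    fun m => le_iSup (fun m => specF (Q m) α) m)

end ConvexApprox

lemma ConformalMap.exists_convexApprox {f : RSphere → RSphere} (hf : ConformalMap f)
    (hexc : ¬ IsExceptional f ∨ maxExceptional f ∩ juliaSet f = ∅)
    {L₀ : Set RSphere} (hL₀ : IsExpandingSet f L₀) :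
    ∃ a : ℕ → ℕ, ∃ Λ : ℕ → Set RSphere, (∀ m, 0 < a m) ∧
      (∀ m, Λ m ⊆ juliaSet f ∧ IsCompact (Λ m) ∧ (f^[a m]) '' Λ m = Λ m ∧
        ExpandingOn (f^[a m]) (Λ m) ∧ TopTransOn (f^[a m]) (Λ m)) ∧
      ∃ C κ, ConvexApprox (seqPress f a Λ) (pressFamily f) C κ := by
  obtain ⟨K, hK1, hK⟩ := hf.exists_lipschitz
  obtain ⟨z₀, hz₀⟩ := hL₀.1
  obtain ⟨D, hD, hDL⟩ := hf.exists_branchDomain hexc hL₀ hz₀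
  obtain ⟨N, hN, hne, -⟩ := hDL L₀ hL₀ 0 (normPress f 1 L₀ 0 - 1) (by linarith)
  have ha : ∀ m : ℕ, 0 < N * (m + 1).factorial := fun m => Nat.mul_pos hN (Nat.factorial_pos _)
  have hne' : ∀ m : ℕ, (returnLimit f D (N * (m + 1).factorial)).Nonempty := fun m =>
    hne.mono (returnLimit_subset_mul (Nat.factorial_pos _))
  have hc : ∀ a, IsCompact (returnLimit f D a) := isCompact_returnLimit hf hD
  have hexp : ∀ a, ExpandingOn (f^[a]) (returnLimit f D a) := expandingOn_returnLimit hf hD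
  have him : ∀ a, (f^[a]) '' returnLimit f D a = returnLimit f D a := fun a => image_returnLimit
  refine ⟨fun m => N * (m + 1).factorial, fun m => returnLimit f D (N * (m + 1).factorial), ha,
    fun m => ⟨?_, hc _, him _, hexp _, topTransOn_returnLimit _ _⟩, 3 * Real.log K, Real.log K,
    ⟨fun m => hf.convexOn_normPress (ha m) (hexp _), fun m => hf.antitone_normPress (hexp _),
      fun m d => hf.normPress_le_pressFamily (ha m) (hne' m) (hc _) (him _) (hexp _) d,
      fun d p hp => ?_, fun s hs => ?_⟩⟩
  · exact (subset_saturation (ha m)).trans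
      (hf.isExpandingSet_saturation (ha m) (hne' m) (hc _) (him _) (hexp _)).2.1
  · rw [pressFamily_eq_iSup] at hp
    have : Nonempty {L // IsExpandingSet f L} := ⟨⟨L₀, hL₀⟩⟩
    obtain ⟨⟨L, hL⟩, hpL⟩ := exists_lt_of_lt_ciSup hp
    obtain ⟨b, hb, -, hle⟩ := hDL L hL d p hpL
    filter_upwards [eventually_ge_atTop b] with m hm
    obtain ⟨k, hk⟩ : b ∣ N * (m + 1).factorial :=
      (Nat.dvd_factorial hb (hm.trans (Nat.le_succ m))).mul_left N
    have hk0 : 0 < k := Nat.pos_of_ne_zero fun h => by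
      have := ha m
      rw [hk, h, mul_zero] at this
      exact this.false
    change p ≤ normPress f (N * (m + 1).factorial) (returnLimit f D (N * (m + 1).factorial)) d
    rw [hk]
    exact hle k hk0
  · have := hf.pressFamily_le hK1 hK hL₀ (-s)
    rw [neg_neg, max_eq_right hs, add_mul, mul_comm s] at this
    exact this

/-- **Proposition (approximation of the pressure by expanding subsystems).**
If `f` is non-exceptional, or exceptional with `Σ ∩ J = ∅`, there are `a_m ∈ ℕ` and
`f^{a_m}`-invariant uniformly expanding topologically transitive sets `Λ_m ⊆ J` such
that the normalized pressures of the subsystems converge (increasingly in the sense of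
suprema) to `P(φ_d)` for every `d`, the corresponding spectra `F_m` converge to `F` on
`(α⁻, α⁺)`, and `α_m^± → α^±`. -/
theorem pressure_approximation (f : RSphere → RSphere) (p q : Polynomial ℂ)
    (hf : IsRationalMap f p q) (hdeg : 2 ≤ ratDeg p q)
    (hexc : ¬ IsExceptional f ∨ maxExceptional f ∩ juliaSet f = ∅) :
    ∃ a : ℕ → ℕ, ∃ Λ : ℕ → Set RSphere,
      (∀ m, 0 < a m) ∧
      (∀ m, Λ m ⊆ juliaSet f ∧ IsCompact (Λ m) ∧ (f^[a m]) '' Λ m = Λ m ∧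
        ExpandingOn (f^[a m]) (Λ m) ∧ TopTransOn (f^[a m]) (Λ m)) ∧
      (∀ d : ℝ,
        Tendsto (fun m => seqPress f a Λ m d) atTop (𝓝 (pressFamily f d)) ∧
        (⨆ m : ℕ, seqPress f a Λ m d) = pressFamily f d) ∧
      (∀ α : ℝ, alphaMinus f < α → α < alphaPlus f →
        Tendsto (fun m => specFext (seqPress f a Λ m) α) atTop (𝓝 (Ffun f α)) ∧
        (⨆ m : ℕ, specFext (seqPress f a Λ m) α) = Ffun f α) ∧
      (Tendsto (fun m => alphaMinusOf (seqPress f a Λ m)) atTop (𝓝 (alphaMinus f)) ∧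
        (⨅ m : ℕ, alphaMinusOf (seqPress f a Λ m)) = alphaMinus f ∧
        Tendsto (fun m => alphaPlusOf (seqPress f a Λ m)) atTop (𝓝 (alphaPlus f)) ∧
        (⨆ m : ℕ, alphaPlusOf (seqPress f a Λ m)) = alphaPlus f) := by
  by_cases hL : ∃ L₀, IsExpandingSet f L₀
  · obtain ⟨L₀, hL₀⟩ := hL
    obtain ⟨a, Λ, ha, hΛ, C, κ, h⟩ := (hf.conformalMap hdeg).exists_convexApprox hexc hL₀
    refine ⟨a, Λ, ha, hΛ, fun d => ⟨h.tendsto d, h.iSup_eq d⟩, fun α hα hα' => ?_,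
      h.tendsto_alphaMinus, h.iInf_alphaMinus, h.tendsto_alphaPlus, h.iSup_alphaPlus⟩
    have hα0 : α ≠ 0 :=
      ((alphaMinusOf_spec h.convexOn_limit h.antitone_limit).2.1.trans_lt hα).ne'
    simp only [Ffun, specFext, if_neg hα0]
    exact ⟨h.tendsto_specF hα hα', h.iSup_specF hα hα'⟩
  · have : IsEmpty {L // IsExpandingSet f L} := ⟨fun L => hL ⟨L.1, L.2⟩⟩
    have hP : ∀ m, seqPress f (fun _ => 1) (fun _ => ∅) m = pressFamily f := fun m => by
      funext d
      rw [pressFamily_eq_iSup, Real.iSup_of_isEmpty]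
      exact normPress_empty f 1 d
    refine ⟨fun _ => 1, fun _ => ∅, fun _ => one_pos, fun _ => ⟨empty_subset _, isCompact_empty,
      image_empty _, ⟨1, one_pos, 2, one_lt_two, fun _ h => h.elim⟩, fun U V _ _ hU _ => ?_⟩, ?_⟩
    · simp at hU
    · simp only [hP, ciSup_const, ciInf_const, Ffun, alphaMinus, alphaPlus]
      exact ⟨fun d => ⟨tendsto_const_nhds, trivial⟩, fun _ _ _ => ⟨tendsto_const_nhds, trivial⟩,
        tendsto_const_nhds, trivial, tendsto_const_nhds, trivial⟩
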